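/- Multi-parameter inclusion H¹_D ⊂ H¹: For every product dyadic lattice D = D₁×…×Dₙ on X = X₁×…×Xₙ there is a constant C depending only on the dimensions N₁,…,Nₙ such that ‖f‖_{H¹(X₁×…×Xₙ)} ≤ C ∫_X S_D f(x) dx for every f ∈ L¹(X). -/

import Mathlib

open MeasureTheory Filter Topology
open scoped ENNReal

noncomputable section

namespace Treil

/-- The cube of sidelength `2^k` of the dyadic lattice `t + 𝒟₀` that contains `x`. -/
def dcube {N : ℕ} (t : Fin N → ℝ) (k : ℤ) (x : Fin N → ℝ) : Set (Fin N → ℝ) :=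
  {y | ∀ i, ⌊(y i - t i) / (2 : ℝ) ^ k⌋ = ⌊(x i - t i) / (2 : ℝ) ^ k⌋}

/-- The averaging operator `E_k` over the cubes of sidelength `2^k` of the (generalized)
dyadic lattice whose layer at scale `2^k` has offset `c k`. -/
def avg {N : ℕ} (c : ℤ → Fin N → ℝ) (k : ℤ) (f : (Fin N → ℝ) → ℝ) (x : Fin N → ℝ) : ℝ :=
  (∫ y in dcube (c k) k x, f y) / ((2 : ℝ) ^ k) ^ (N : ℕ)

/-- The martingale difference `Δ_k = E_{k-1} - E_k`. -/
def mdiff {N : ℕ} (c : ℤ → Fin N → ℝ) (k : ℤ) (f : (Fin N → ℝ) → ℝ) (x : Fin N → ℝ) : ℝ :=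
  avg c (k - 1) f x - avg c k f x

/-- The square of the dyadic square function, `|S_𝒟 f (x)|² = ∑_k |Δ_k f (x)|²`,
with values in `[0,∞]`. -/
def Ssq {N : ℕ} (c : ℤ → Fin N → ℝ) (f : (Fin N → ℝ) → ℝ) (x : Fin N → ℝ) : ℝ≥0∞ :=
  ∑' k : ℤ, ENNReal.ofReal ((mdiff c k f x) ^ 2)

/-- The offset (at scale `2^k`) of the random dyadic lattice on `ℝ` built from the uniform
shift `u ∈ [0,1)` and the fair signs `ξ_j`, `j ≥ 1`, encoded as the binary digits of
`v ∈ [0,1)` (`ξ_j = -1` iff `⌊v 2^j⌋` is odd); the interval `I_0 = [u-1, u)` belongs to the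
lattice, and `I_k` is obtained from `I_{k-1}` by adjoining the right neighbour if `ξ_k = +1`
and the left neighbour if `ξ_k = -1`. -/
def randOffset1 (u v : ℝ) (k : ℤ) : ℝ :=
  u - 1 - ∑ j ∈ Finset.range k.toNat, (if ⌊v * 2 ^ (j + 1)⌋ % 2 = 1 then (2 : ℝ) ^ j else 0)

/-- The sample space for the random dyadic lattice in `ℝ^N`: each of the `N` independent
coordinate lattices is driven by a pair (uniform shift, digit-encoded fair signs). -/
abbrev RSpace (N : ℕ) := Fin N → ℝ × ℝ

/-- The probability measure of the random dyadic lattice in `ℝ^N`. -/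
def randMeasure (N : ℕ) : Measure (RSpace N) :=
  Measure.pi fun _ =>
    (volume.restrict (Set.Ico (0 : ℝ) 1)).prod (volume.restrict (Set.Ico (0 : ℝ) 1))

/-- The per-scale offsets of the random dyadic lattice `𝒟(ω)` in `ℝ^N`. -/
def randOffset {N : ℕ} (ω : RSpace N) (k : ℤ) : Fin N → ℝ :=
  fun i => randOffset1 (ω i).1 (ω i).2 k

/-- An (axis-parallel, half-open) cube in `ℝ^N`. -/
def IsPCube {N : ℕ} (Q : Set (Fin N → ℝ)) : Prop :=
  ∃ (a : Fin N → ℝ) (l : ℝ), 0 < l ∧ Q = Set.univ.pi fun i => Set.Ico (a i) (a i + l)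

/-- An `H¹`-atom: supported in a cube `Q`, bounded by `|Q|⁻¹`, with zero mean. -/
def IsAtom {N : ℕ} (a : (Fin N → ℝ) → ℝ) : Prop :=
  ∃ Q : Set (Fin N → ℝ), IsPCube Q ∧ (∀ x, x ∉ Q → a x = 0) ∧
    (∀ x, |a x| ≤ ((volume Q).toReal)⁻¹) ∧ (∫ x, a x) = 0

/-- The atomic `H¹(ℝ^N)` norm: the infimum of `∑ |λ_j|` over all decompositions
`f = ∑ λ_j a_j` converging in `L¹`, with atoms `a_j`. -/
def H1norm {N : ℕ} (f : (Fin N → ℝ) → ℝ) : ℝ≥0∞ :=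
  ⨅ (lam : ℕ → ℝ) (a : ℕ → (Fin N → ℝ) → ℝ) (_ : ∀ j, IsAtom (a j))
    (_ : Tendsto (fun m => ∫ x, |f x - ∑ j ∈ Finset.range m, lam j * a j x|) atTop (𝓝 0)),
    ∑' j, ENNReal.ofReal |lam j|
/-! ### Multi-parameter setting: `X = X₁ × ⋯ × Xₙ`, `X_j = ℝ^{N_j}` -/

variable (n : ℕ) (Nd : Fin n → ℕ)

/-- The product space `X = X₁ × X₂ × ⋯ × Xₙ`, `X_j = ℝ^{N_j}`. -/
abbrev X := Π j : Fin n, (Fin (Nd j) → ℝ)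

/-- The averaging operator `E_𝐤 = E¹_{k₁} ⋯ Eⁿ_{kₙ}` over the "rectangles"
`R = Q₁ × ⋯ × Qₙ` of the product lattice with per-variable, per-scale offsets `c`. -/
def ravg (c : Π j : Fin n, ℤ → Fin (Nd j) → ℝ) (k : Fin n → ℤ) (f : X n Nd → ℝ)
    (x : X n Nd) : ℝ :=
  (∫ y in Set.univ.pi fun j => dcube (c j (k j)) (k j) (x j), f y) /
    ∏ j, ((2 : ℝ) ^ (k j)) ^ (Nd j : ℕ)

/-- The multi-parameter martingale difference
`Δ_𝐤 = Δ¹_{k₁} ⋯ Δⁿ_{kₙ} = ∏_j (E^j_{k_j - 1} - E^j_{k_j})`, expanded by multilinearity. -/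
def rmdiff (c : Π j : Fin n, ℤ → Fin (Nd j) → ℝ) (k : Fin n → ℤ) (f : X n Nd → ℝ)
    (x : X n Nd) : ℝ :=
  ∑ ε : Fin n → Bool,
    (-1 : ℝ) ^ (Finset.univ.filter fun j => ε j = false).card *
      ravg n Nd c (fun j => k j - if ε j then 1 else 0) f x

/-- The square of the multi-parameter dyadic square function,
`|S_𝒟 f (x)|² = ∑_{R ∋ x} |Δ_R f (x)|² = ∑_{𝐤 ∈ ℤⁿ} |Δ_𝐤 f (x)|²`. -/
def rSsq (c : Π j : Fin n, ℤ → Fin (Nd j) → ℝ) (f : X n Nd → ℝ) (x : X n Nd) : ℝ≥0∞ :=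
  ∑' k : Fin n → ℤ, ENNReal.ofReal ((rmdiff n Nd c k f x) ^ 2)

/-- The sample space of the random product dyadic lattice
`𝒟(ω) = 𝒟₁(ω) × ⋯ × 𝒟ₙ(ω)`. -/
abbrev PSpace := Π j : Fin n, RSpace (Nd j)

instance randMeasure.instSigmaFinite (M : ℕ) : SigmaFinite (randMeasure M) := by
  unfold randMeasure; infer_instance

/-- The probability measure of the random product dyadic lattice (the `n` factors are
independent). -/
def prodRandMeasure : Measure (PSpace n Nd) := Measure.pi fun j => randMeasure (Nd j)

/-- The quantity `∫_X [𝔼_ω |S_{𝒟(ω)} f (x)|²]^{1/2} dx` for the multi-parameter random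
dyadic square function. -/
def randProdSNorm (f : X n Nd → ℝ) : ℝ≥0∞ :=
  ∫⁻ x, (∫⁻ ω, rSsq n Nd (fun j => randOffset (ω j)) f x ∂prodRandMeasure n Nd) ^ (1 / 2 : ℝ)

/-! ### The product (Chang–Fefferman) Hardy space `H¹(X₁ × ⋯ × Xₙ)` -/

/-- The upper half-space variables `((y₁,t₁),…,(yₙ,tₙ))`. -/
abbrev W := Π j : Fin n, ((Fin (Nd j) → ℝ) × ℝ)

/-- The Poisson kernel of the upper half-space `ℝ^{M+1}_+`. -/
def pk (M : ℕ) (y : Fin M → ℝ) (t : ℝ) : ℝ :=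
  (Real.Gamma (((M : ℝ) + 1) / 2) / Real.pi ^ (((M : ℝ) + 1) / 2)) * t /
    ((∑ i, y i ^ 2) + t ^ 2) ^ (((M : ℝ) + 1) / 2)

/-- The extension of `f` to `ℝ^{N₁+1}_+ × ⋯ × ℝ^{Nₙ+1}_+` obtained by applying the Poisson
(harmonic) extension in each variable. -/
def prodPoisson (f : X n Nd → ℝ) (p : W n Nd) : ℝ :=
  ∫ z, f z * ∏ j, pk (Nd j) ((p j).1 - z j) (p j).2

/-- The coordinate direction `i` in the `j`-th half-space factor (`i = N_j` is the
`t_j`-direction). -/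
def dirW (j : Fin n) (i : Fin (Nd j + 1)) : W n Nd :=
  Pi.single j (if h : (i : ℕ) < Nd j then (Pi.single (⟨i, h⟩ : Fin (Nd j)) 1, 0) else (0, 1))

/-- `|∇₁ ∇₂ ⋯ ∇ₙ u (p)|²`: the sum over all choices of one coordinate direction in each
half-space factor of the square of the corresponding mixed partial derivative. -/
def mixedGradSq (u : W n Nd → ℝ) (p : W n Nd) : ℝ :=
  ∑ d : Π j : Fin n, Fin (Nd j + 1),
    (iteratedFDeriv ℝ n u p fun j => dirW n Nd j (d j)) ^ 2

/-- The product cone `Γ_{x₁} × ⋯ × Γ_{xₙ}`, `Γ_{x_j} = {(y,t) : |y - x_j| < t}`. -/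
def prodCone (x : X n Nd) : Set (W n Nd) :=
  {p | ∀ j, Real.sqrt (∑ i, ((p j).1 i - x j i) ^ 2) < (p j).2}

/-- The square of the product Lusin square function `S⃗^L f`. -/
def lusinSq (f : X n Nd → ℝ) (x : X n Nd) : ℝ≥0∞ :=
  ∫⁻ p in prodCone n Nd x,
    ENNReal.ofReal (mixedGradSq n Nd (prodPoisson n Nd f) p *
      ∏ j, (p j).2 ^ (1 - (Nd j : ℝ)))

/-- The norm of the multi-parameter (product) Hardy space `H¹(X₁ × ⋯ × Xₙ)` of
Chang–Fefferman: `‖f‖ = ‖S⃗^L f‖_{L¹(X)}`. -/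
def H1prodNorm (f : X n Nd → ℝ) : ℝ≥0∞ :=
  ∫⁻ x, (lusinSq n Nd f x) ^ (1 / 2 : ℝ)

/-! ### Cauchy–Schwarz inequalities for `[0,∞]`-valued functions -/

lemma lintegral_sqrt_mul_le {α : Type*} [MeasurableSpace α] (μ : Measure α) {u v : α → ℝ≥0∞}
    (hu : AEMeasurable u μ) (hv : AEMeasurable v μ) :
    ∫⁻ a, (u a * v a) ^ (1 / 2 : ℝ) ∂μ ≤
      ((∫⁻ a, u a ∂μ) * ∫⁻ a, v a ∂μ) ^ (1 / 2 : ℝ) := by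
  have h := ENNReal.lintegral_mul_le_Lp_mul_Lq μ Real.HolderConjugate.two_two
    (hu.pow_const (1 / 2 : ℝ)) (hv.pow_const (1 / 2 : ℝ))
  have e : ∀ x : ℝ≥0∞, (x ^ (1 / 2 : ℝ)) ^ (2 : ℝ) = x := fun x => by
    rw [← ENNReal.rpow_mul]; norm_num
  simp only [e, Pi.mul_apply] at h
  rw [ENNReal.mul_rpow_of_nonneg _ _ (by norm_num)]
  refine le_trans (le_of_eq (lintegral_congr fun a => ?_)) h
  rw [ENNReal.mul_rpow_of_nonneg _ _ (by norm_num)]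

lemma sqrt_sq (x : ℝ≥0∞) : (x ^ (1 / 2 : ℝ)) ^ 2 = x := by
  rw [← ENNReal.rpow_natCast, ← ENNReal.rpow_mul]; norm_num

lemma sq_sqrt (x : ℝ≥0∞) : (x ^ 2) ^ (1 / 2 : ℝ) = x := by
  rw [← ENNReal.rpow_natCast, ← ENNReal.rpow_mul]; norm_num

lemma tsum_sqrt_mul_le {ι : Type*} (u v : ι → ℝ≥0∞) :
    ∑' i, (u i * v i) ^ (1 / 2 : ℝ) ≤ ((∑' i, u i) * ∑' i, v i) ^ (1 / 2 : ℝ) := by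
  let _ : MeasurableSpace ι := ⊤
  have h := lintegral_sqrt_mul_le (Measure.count : Measure ι) (u := u) (v := v)
    (Measurable.of_discrete).aemeasurable (Measurable.of_discrete).aemeasurable
  simpa only [lintegral_count] using h

lemma sq_tsum_lintegral_sqrt_mul_le {ι α : Type*} [MeasurableSpace α] (μ : Measure α)
    {u v : ι → α → ℝ≥0∞} (hu : ∀ i, AEMeasurable (u i) μ) (hv : ∀ i, AEMeasurable (v i) μ) :
    (∑' i, ∫⁻ a, (u i a * v i a) ^ (1 / 2 : ℝ) ∂μ) ^ 2 ≤
      (∑' i, ∫⁻ a, u i a ∂μ) * ∑' i, ∫⁻ a, v i a ∂μ := by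
  have h : ∑' i, ∫⁻ a, (u i a * v i a) ^ (1 / 2 : ℝ) ∂μ ≤
      ((∑' i, ∫⁻ a, u i a ∂μ) * ∑' i, ∫⁻ a, v i a ∂μ) ^ (1 / 2 : ℝ) :=
    (ENNReal.tsum_le_tsum fun i => lintegral_sqrt_mul_le μ (hu i) (hv i)).trans
      (tsum_sqrt_mul_le _ _)
  calc _ ≤ (((∑' i, ∫⁻ a, u i a ∂μ) * ∑' i, ∫⁻ a, v i a ∂μ) ^ (1 / 2 : ℝ)) ^ 2 := by gcongr
    _ = _ := sqrt_sq _

/-! ### Square roots of tails of a series -/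

/-- The square root of the tail `∑_{j ≥ k} b_j`. -/
def sqrtTail (b : ℤ → ℝ≥0∞) (k : ℤ) : ℝ≥0∞ := (∑' i : ℕ, b (k + i)) ^ (1 / 2 : ℝ)

/-- The increments of `sqrtTail`. -/
def sqrtTailDiff (b : ℤ → ℝ≥0∞) (k : ℤ) : ℝ≥0∞ := sqrtTail b k - sqrtTail b (k + 1)

lemma sqrtTail_le (b : ℤ → ℝ≥0∞) (k : ℤ) : sqrtTail b k ≤ (∑' j, b j) ^ (1 / 2 : ℝ) := by
  unfold sqrtTail
  gcongr
  exact ENNReal.tsum_comp_le_tsum_of_injective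
    (f := fun i : ℕ => k + (i : ℤ)) (fun a b h => by simpa using h) b

lemma sqrtTail_sq (b : ℤ → ℝ≥0∞) (k : ℤ) :
    sqrtTail b k ^ 2 = b k + sqrtTail b (k + 1) ^ 2 := by
  unfold sqrtTail
  rw [sqrt_sq, sqrt_sq, tsum_eq_zero_add' ENNReal.summable]
  congr 1
  · simp
  · refine tsum_congr fun i => ?_
    congr 1
    push_cast
    ring

lemma sqrtTail_succ_le (b : ℤ → ℝ≥0∞) (k : ℤ) : sqrtTail b (k + 1) ≤ sqrtTail b k := by
  have h : sqrtTail b (k + 1) ^ 2 ≤ sqrtTail b k ^ 2 := by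
    rw [sqrtTail_sq b k]; exact le_add_self
  exact (ENNReal.pow_le_pow_left_iff two_ne_zero).1 h

lemma sum_sqrtTailDiff_add (b : ℤ → ℝ≥0∞) (k : ℤ) (m : ℕ) :
    (∑ i ∈ Finset.range m, sqrtTailDiff b (k + i)) + sqrtTail b (k + m) = sqrtTail b k := by
  induction m with
  | zero => simp
  | succ m ih =>
    rw [Finset.sum_range_succ, ← ih, add_assoc]
    congr 1
    have := tsub_add_cancel_of_le (sqrtTail_succ_le b (k + m))
    rw [← this]
    unfold sqrtTailDiff
    push_cast
    rw [add_assoc k]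

lemma sqrtTail_le_tsum (b : ℤ → ℝ≥0∞) (hb : ∑' j, b j ≠ ∞) (k : ℤ) :
    sqrtTail b k ≤ ∑' i : ℕ, sqrtTailDiff b (k + i) := by
  have h1 : Tendsto (fun m : ℕ => sqrtTail b (k + m)) atTop (𝓝 0) := by
    have h2 : Tendsto (fun m : ℕ => ∑' i : ℕ, b (k + ((i + m : ℕ) : ℤ))) atTop (𝓝 0) := by
      refine ENNReal.tendsto_sum_nat_add (fun i : ℕ => b (k + i)) ?_
      exact ne_top_of_le_ne_top hb (ENNReal.tsum_comp_le_tsum_of_injective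
        (f := fun i : ℕ => k + (i : ℤ)) (fun a b h => by simpa using h) b)
    have h3 := h2.ennrpow_const (1 / 2 : ℝ)
    rw [ENNReal.zero_rpow_of_pos (by norm_num)] at h3
    refine h3.congr fun m => ?_
    unfold sqrtTail
    congr 1
    refine tsum_congr fun i => ?_
    congr 1
    push_cast
    ring
  have h4 : Tendsto (fun m : ℕ => (∑' i : ℕ, sqrtTailDiff b (k + i)) + sqrtTail b (k + m)) atTop
      (𝓝 ((∑' i : ℕ, sqrtTailDiff b (k + i)) + 0)) := h1.const_add _
  rw [add_zero] at h4
  refine ge_of_tendsto' h4 fun m => ?_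
  rw [← sum_sqrtTailDiff_add b k m]
  gcongr
  exact ENNReal.sum_le_tsum _

lemma tsum_sqrtTailDiff_le (b : ℤ → ℝ≥0∞) :
    ∑' k, sqrtTailDiff b k ≤ (∑' j, b j) ^ (1 / 2 : ℝ) := by
  rw [ENNReal.tsum_eq_iSup_sum]
  refine iSup_le fun s => ?_
  obtain ⟨k, hk⟩ := s.bddBelow
  obtain ⟨l, hl⟩ := s.bddAbove
  have hs : s ⊆ (Finset.range (l - k + 1).toNat).image fun i : ℕ => k + (i : ℤ) := by
    intro j hj
    have h1 := hk hj
    have h2 := hl hj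
    simp only [Finset.mem_image, Finset.mem_range]
    exact ⟨(j - k).toNat, by omega, by omega⟩
  calc _ ≤ ∑ j ∈ (Finset.range (l - k + 1).toNat).image (fun i : ℕ => k + (i : ℤ)),
        sqrtTailDiff b j := Finset.sum_le_sum_of_subset hs
    _ = ∑ i ∈ Finset.range (l - k + 1).toNat, sqrtTailDiff b (k + i) :=
        Finset.sum_image fun a _ b _ h => by simpa using h
    _ ≤ sqrtTail b k := by
        rw [← sum_sqrtTailDiff_add b k (l - k + 1).toNat]
        exact le_self_add
    _ ≤ _ := sqrtTail_le b k

lemma le_two_mul_sqrtTailDiff (b : ℤ → ℝ≥0∞) (hb : ∑' j, b j ≠ ∞) (k : ℤ) :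
    b k ≤ 2 * sqrtTailDiff b k * sqrtTail b k := by
  have hF : ∀ k, sqrtTail b k ≠ ∞ := fun k =>
    ne_top_of_le_ne_top (ENNReal.rpow_ne_top_of_nonneg (by norm_num) hb) (sqrtTail_le b k)
  have h1 := sqrtTail_sq b k
  have h2 := sqrtTail_succ_le b k
  have h3 : sqrtTailDiff b k + sqrtTail b (k + 1) = sqrtTail b k := tsub_add_cancel_of_le h2
  set D := sqrtTailDiff b k
  set F := sqrtTail b k
  set F' := sqrtTail b (k + 1)
  have h4 : b k + F' ^ 2 ≤ 2 * D * F + F' ^ 2 := by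
    rw [← h1]
    calc F ^ 2 = (D + F') * F := by rw [h3, sq]
      _ = D * F + F' * (D + F') := by rw [add_mul, h3]
      _ ≤ D * F + (F * D + F' ^ 2) := by
        rw [mul_add, sq]; gcongr
      _ = _ := by ring
  exact (ENNReal.add_le_add_iff_right (ENNReal.pow_ne_top (hF _))).1 h4

lemma measurable_sqrtTail {α : Type*} [MeasurableSpace α] {g : ℤ → α → ℝ≥0∞}
    (hg : ∀ k, Measurable (g k)) (k : ℤ) : Measurable fun z => sqrtTail (fun j => g j z) k := by
  unfold sqrtTail
  exact (Measurable.tsum fun i => hg _).pow_const _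

lemma measurable_sqrtTailDiff {α : Type*} [MeasurableSpace α] {g : ℤ → α → ℝ≥0∞}
    (hg : ∀ k, Measurable (g k)) (k : ℤ) :
    Measurable fun z => sqrtTailDiff (fun j => g j z) k :=
  (measurable_sqrtTail hg k).sub (measurable_sqrtTail hg (k + 1))

lemma sqrtTail_congr {b b' : ℤ → ℝ≥0∞} {k : ℤ} (h : ∀ j, k ≤ j → b j = b' j) :
    sqrtTail b k = sqrtTail b' k := by
  unfold sqrtTail
  congr 1
  exact tsum_congr fun i => h _ (by omega)

lemma sqrtTailDiff_congr {b b' : ℤ → ℝ≥0∞} {k : ℤ} (h : ∀ j, k ≤ j → b j = b' j) :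
    sqrtTailDiff b k = sqrtTailDiff b' k := by
  unfold sqrtTailDiff
  rw [sqrtTail_congr h, sqrtTail_congr fun j hj => h j (by omega)]

/-! ### The one-parameter inequality for positive operators -/

/-- A weighted Schur test in `L¹(ℓ²)` for positive operators acting on sequences `G_k`
whose `k`-th term is constant on the cells of the `k`-th generation. -/
theorem lintegral_sqrt_schur {α β : Type*} [MeasurableSpace α] [MeasurableSpace β]
    (μ : Measure α) [SFinite μ] (ν : Measure β) [SFinite ν]
    {c : α → β → ℝ≥0∞} (hc : Measurable (Function.uncurry c))
    {w : ℤ → β → ℝ≥0∞} (hw : ∀ k, Measurable (w k))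
    (hw' : ∀ k x p, c x p ≠ 0 → w k p ≠ 0 ∧ w k p ≠ ∞)
    {B : ℤ → β → α → ℝ≥0∞} (hB : ∀ k, Measurable (Function.uncurry (B k)))
    {a : ℤ → α → α → ℝ≥0∞} (ha : ∀ k, Measurable (Function.uncurry (a k)))
    {r : ℤ → α → α → Prop} (hr : ∀ k l z z', k ≤ l → r k z z' → r l z z')
    {C₁ C₂ : ℝ≥0∞} (hC₁ : C₁ ≠ 0) (hC₂ : C₂ ≠ 0)
    (h₁ : ∀ k z, ∫⁻ x, ∫⁻ p, c x p * ((w k p)⁻¹ * B k p z) ∂ν ∂μ ≤ C₁)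
    (h₂ : ∀ (j : ℤ) (D : α → ℝ≥0∞), Measurable D → (∀ z z', r j z z' → D z = D z') →
      ∀ x p, c x p ≠ 0 →
        ∑' i : ℕ, w (j - i) p * ∫⁻ z, B (j - i) p z * D z ∂μ ≤ ∫⁻ z, a j x z * D z ∂μ)
    (h₃ : ∀ j z, ∫⁻ x, a j x z ∂μ ≤ C₂)
    {G : ℤ → α → ℝ≥0∞} (hG : ∀ k, Measurable (G k))
    (hGr : ∀ k z z', r k z z' → G k z = G k z') :
    ∫⁻ x, (∫⁻ p, c x p * (∑' k, ∫⁻ z, B k p z * G k z ∂μ) ^ 2 ∂ν) ^ (1 / 2 : ℝ) ∂μ ≤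
      (2 * C₁ * C₂) ^ (1 / 2 : ℝ) * ∫⁻ z, (∑' k, G k z ^ 2) ^ (1 / 2 : ℝ) ∂μ := by
  set S := ∫⁻ z, (∑' k, G k z ^ 2) ^ (1 / 2 : ℝ) ∂μ with hS
  have hb : ∀ k, Measurable fun z => G k z ^ 2 := fun k => (hG k).pow_const _
  by_cases hSt : S = ∞
  · rw [hSt, ENNReal.mul_top]
    · exact le_top
    · simp [hC₁, hC₂]
  have hfin : ∀ᵐ z ∂μ, ∑' k, G k z ^ 2 ≠ ∞ := by
    filter_upwards [ae_lt_top ((Measurable.tsum hb).pow_const _) hSt] with z hz h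
    rw [h] at hz
    simp at hz
  set F : ℤ → α → ℝ≥0∞ := fun k z => sqrtTail (fun j => G j z ^ 2) k with hFdef
  set D : ℤ → α → ℝ≥0∞ := fun k z => sqrtTailDiff (fun j => G j z ^ 2) k with hDdef
  have hF : ∀ k, Measurable (F k) := measurable_sqrtTail hb
  have hD : ∀ k, Measurable (D k) := measurable_sqrtTailDiff hb
  have hDr : ∀ k z z', r k z z' → D k z = D k z' := fun k z z' h =>
    sqrtTailDiff_congr fun j hj => by rw [hGr j z z' (hr k j z z' hj h)]
  have hFD : ∀ᵐ z ∂μ, ∀ k, F k z ≤ ∑' i : ℕ, D (k + i) z := by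
    filter_upwards [hfin] with z hz k using sqrtTail_le_tsum _ hz k
  have hGD : ∀ᵐ z ∂μ, ∀ k, G k z ^ 2 ≤ 2 * D k z * F k z := by
    filter_upwards [hfin] with z hz k using le_two_mul_sqrtTailDiff _ hz k
  have hDS : ∫⁻ z, ∑' j, D j z ∂μ ≤ S := lintegral_mono fun z => tsum_sqrtTailDiff_le _
  clear_value F D
  have hBz : ∀ k p, Measurable (B k p) := fun k p => (hB k).of_uncurry_left
  set I : β → ℝ≥0∞ := fun p => ∑' k, ∫⁻ z, (w k p)⁻¹ * B k p z * (2 * D k z) ∂μ with hI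
  set M : α → ℝ≥0∞ := fun x => ∑' j, ∫⁻ z, a j x z * D j z ∂μ with hM
  have hImeas : Measurable I := by
    refine Measurable.tsum fun k => Measurable.lintegral_prod_right' (f := fun q : β × α =>
      (w k q.1)⁻¹ * B k q.1 q.2 * (2 * D k q.2)) ?_
    exact (((hw k).comp measurable_fst).inv.mul (hB k)).mul
      (((hD k).comp measurable_snd).const_mul _)
  have hMmeas : Measurable M := by
    refine Measurable.tsum fun k => Measurable.lintegral_prod_right' (f := fun q : α × α =>
      a k q.1 q.2 * D k q.2) ?_
    exact (ha k).mul ((hD k).comp measurable_snd)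
  have hcI : Measurable fun q : α × β => c q.1 q.2 * I q.2 := hc.mul (hImeas.comp measurable_snd)
  have hJ : ∀ x p, c x p ≠ 0 → ∑' k, ∫⁻ z, w k p * B k p z * F k z ∂μ ≤ M x := by
    intro x p hxp
    calc ∑' k, ∫⁻ z, w k p * B k p z * F k z ∂μ
        ≤ ∑' k, ∫⁻ z, ∑' i : ℕ, w k p * (B k p z * D (k + i) z) ∂μ := by
          refine ENNReal.tsum_le_tsum fun k => lintegral_mono_ae ?_
          filter_upwards [hFD] with z hz
          rw [ENNReal.tsum_mul_left, ENNReal.tsum_mul_left, ← mul_assoc]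
          gcongr
          exact hz k
      _ = ∑' k, ∑' i : ℕ, w k p * ∫⁻ z, B k p z * D (k + i) z ∂μ := by
          refine tsum_congr fun k => ?_
          rw [lintegral_tsum fun i => by fun_prop]
          exact tsum_congr fun i => lintegral_const_mul _ (by fun_prop)
      _ = ∑' i : ℕ, ∑' k, w k p * ∫⁻ z, B k p z * D (k + i) z ∂μ := ENNReal.tsum_comm
      _ = ∑' i : ℕ, ∑' j, w (j - i) p * ∫⁻ z, B (j - i) p z * D j z ∂μ := by
          refine tsum_congr fun i => ?_
          rw [← (Equiv.addRight (i : ℤ)).tsum_eq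
            fun j => w (j - i) p * ∫⁻ z, B (j - i) p z * D j z ∂μ]
          simp
      _ = ∑' j, ∑' i : ℕ, w (j - i) p * ∫⁻ z, B (j - i) p z * D j z ∂μ := ENNReal.tsum_comm
      _ ≤ M x := ENNReal.tsum_le_tsum fun j => h₂ j (D j) (hD j) (hDr j) x p hxp
  have hpt : ∀ x p, c x p * (∑' k, ∫⁻ z, B k p z * G k z ∂μ) ^ 2 ≤ M x * (c x p * I p) := by
    intro x p
    by_cases hxp : c x p = 0
    · simp [hxp]
    calc c x p * (∑' k, ∫⁻ z, B k p z * G k z ∂μ) ^ 2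
        ≤ c x p * (∑' k, ∫⁻ z, (((w k p)⁻¹ * B k p z * (2 * D k z)) *
            (w k p * B k p z * F k z)) ^ (1 / 2 : ℝ) ∂μ) ^ 2 := by
          refine mul_le_mul_right (pow_le_pow_left' (ENNReal.tsum_le_tsum fun k => ?_) 2) _
          refine lintegral_mono_ae ?_
          filter_upwards [hGD] with z hz
          obtain ⟨h0, h1⟩ := hw' k x p hxp
          rw [← sq_sqrt (B k p z * G k z)]
          gcongr
          calc (B k p z * G k z) ^ 2 = B k p z ^ 2 * G k z ^ 2 := mul_pow _ _ _
            _ ≤ B k p z ^ 2 * (2 * D k z * F k z) := by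
              gcongr
              exact hz k
            _ = ((w k p)⁻¹ * w k p) * (B k p z ^ 2 * (2 * D k z * F k z)) := by
              rw [ENNReal.inv_mul_cancel h0 h1, one_mul]
            _ = _ := by ring
      _ ≤ c x p * (I p * M x) := by
          gcongr
          refine (sq_tsum_lintegral_sqrt_mul_le μ (fun k => ?_) fun k => ?_).trans ?_
          · exact (((hBz k p).const_mul _).mul ((hD k).const_mul _)).aemeasurable
          · exact (((hBz k p).const_mul _).mul (hF k)).aemeasurable
          · gcongr
            exact hJ x p hxp
      _ = _ := by ring
  have hMint : ∫⁻ x, M x ∂μ ≤ C₂ * S := by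
    calc ∫⁻ x, M x ∂μ = ∑' j, ∫⁻ x, ∫⁻ z, a j x z * D j z ∂μ ∂μ := by
          rw [lintegral_tsum fun j => (Measurable.lintegral_prod_right' (f := fun q : α × α =>
            a j q.1 q.2 * D j q.2) ((ha j).mul ((hD j).comp measurable_snd))).aemeasurable]
      _ = ∑' j, ∫⁻ z, ∫⁻ x, a j x z * D j z ∂μ ∂μ := by
          refine tsum_congr fun j => lintegral_lintegral_swap ?_
          exact ((ha j).mul ((hD j).comp measurable_snd)).aemeasurable
      _ ≤ ∑' j, ∫⁻ z, C₂ * D j z ∂μ := by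
          refine ENNReal.tsum_le_tsum fun j => lintegral_mono fun z => ?_
          rw [lintegral_mul_const _ (ha j).of_uncurry_right]
          gcongr
          exact h₃ j z
      _ = C₂ * ∫⁻ z, ∑' j, D j z ∂μ := by
          rw [lintegral_tsum fun j => (hD j).aemeasurable, ← ENNReal.tsum_mul_left]
          exact tsum_congr fun j => lintegral_const_mul _ (hD j)
      _ ≤ C₂ * S := by
          gcongr
  have hNint : ∫⁻ x, ∫⁻ p, c x p * I p ∂ν ∂μ ≤ 2 * C₁ * S := by
    have hm : ∀ k, Measurable fun q : (α × β) × α =>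
        c q.1.1 q.1.2 * ((w k q.1.2)⁻¹ * B k q.1.2 q.2) := fun k =>
      (hc.comp measurable_fst).mul
        (((hw k).comp (measurable_snd.comp measurable_fst)).inv.mul ((hB k).comp
          ((measurable_snd.comp measurable_fst).prodMk measurable_snd)))
    calc ∫⁻ x, ∫⁻ p, c x p * I p ∂ν ∂μ
        = ∫⁻ q, c q.1 q.2 * I q.2 ∂(μ.prod ν) := (lintegral_prod _ hcI.aemeasurable).symm
      _ = ∫⁻ q, ∑' k, ∫⁻ z, c q.1 q.2 * ((w k q.2)⁻¹ * B k q.2 z) * (2 * D k z) ∂μ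
            ∂(μ.prod ν) := by
          refine lintegral_congr fun q => ?_
          rw [← ENNReal.tsum_mul_left]
          refine tsum_congr fun k => ?_
          rw [← lintegral_const_mul _ (by fun_prop)]
          exact lintegral_congr fun z => by ring
      _ = ∑' k, ∫⁻ q, ∫⁻ z, c q.1 q.2 * ((w k q.2)⁻¹ * B k q.2 z) * (2 * D k z) ∂μ
            ∂(μ.prod ν) := by
          refine lintegral_tsum fun k => (Measurable.lintegral_prod_right'
            (f := fun q : (α × β) × α => c q.1.1 q.1.2 * ((w k q.1.2)⁻¹ * B k q.1.2 q.2) *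
              (2 * D k q.2)) ?_).aemeasurable
          exact (hm k).mul (((hD k).comp measurable_snd).const_mul _)
      _ = ∑' k, ∫⁻ z, ∫⁻ q, c q.1 q.2 * ((w k q.2)⁻¹ * B k q.2 z) * (2 * D k z) ∂(μ.prod ν)
            ∂μ := by
          refine tsum_congr fun k => lintegral_lintegral_swap ?_
          exact ((hm k).mul (((hD k).comp measurable_snd).const_mul _)).aemeasurable
      _ ≤ ∑' k, ∫⁻ z, C₁ * (2 * D k z) ∂μ := by
          refine ENNReal.tsum_le_tsum fun k => lintegral_mono fun z => ?_
          have hmz : Measurable fun q : α × β => c q.1 q.2 * ((w k q.2)⁻¹ * B k q.2 z) :=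
          
            (hm k).comp (measurable_id.prodMk measurable_const)
          rw [lintegral_mul_const _ hmz, lintegral_prod _ hmz.aemeasurable]
          gcongr
          exact h₁ k z
      _ = C₁ * (2 * ∫⁻ z, ∑' j, D j z ∂μ) := by
          rw [lintegral_tsum fun j => (hD j).aemeasurable, ← ENNReal.tsum_mul_left,
            ← ENNReal.tsum_mul_left]
          refine tsum_congr fun j => ?_
          rw [lintegral_const_mul _ ((hD j).const_mul _), lintegral_const_mul _ (hD j)]
      _ ≤ C₁ * (2 * S) := by
          gcongr
      _ = _ := by ring
  calc ∫⁻ x, (∫⁻ p, c x p * (∑' k, ∫⁻ z, B k p z * G k z ∂μ) ^ 2 ∂ν) ^ (1 / 2 : ℝ) ∂μ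
      ≤ ∫⁻ x, (M x * ∫⁻ p, c x p * I p ∂ν) ^ (1 / 2 : ℝ) ∂μ := by
        refine lintegral_mono fun x => ENNReal.rpow_le_rpow ?_ (by norm_num)
        have hcx : Measurable fun p => c x p * I p := hcI.comp measurable_prodMk_left
        rw [← lintegral_const_mul _ hcx]
        exact lintegral_mono fun p => hpt x p
    _ ≤ ((∫⁻ x, M x ∂μ) * ∫⁻ x, ∫⁻ p, c x p * I p ∂ν ∂μ) ^ (1 / 2 : ℝ) :=
        lintegral_sqrt_mul_le μ hMmeas.aemeasurable hcI.lintegral_prod_right'.aemeasurable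
    _ ≤ ((C₂ * S) * (2 * C₁ * S)) ^ (1 / 2 : ℝ) := by gcongr
    _ = ((2 * C₁ * C₂) * S ^ 2) ^ (1 / 2 : ℝ) := by congr 1; ring
    _ = _ := by rw [ENNReal.mul_rpow_of_nonneg _ _ (by norm_num), sq_sqrt]

/-! ### Minkowski's inequality in `L²` -/

lemma lintegral_sq_lintegral_le {γ Ω : Type*} [MeasurableSpace γ] [MeasurableSpace Ω]
    (lam : Measure γ) [SFinite lam] (η : Measure Ω) [SFinite η] {h : γ → Ω → ℝ≥0∞}
    (hh : Measurable (Function.uncurry h)) :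
    ∫⁻ ω, (∫⁻ y, h y ω ∂lam) ^ 2 ∂η ≤
      (∫⁻ y, (∫⁻ ω, h y ω ^ 2 ∂η) ^ (1 / 2 : ℝ) ∂lam) ^ 2 := by
  have hm : Measurable fun y => (∫⁻ ω, h y ω ^ 2 ∂η) ^ (1 / 2 : ℝ) :=
    ((hh.pow_const 2).lintegral_prod_right').pow_const _
  have hy : ∀ y, Measurable (h y) := fun y => hh.comp measurable_prodMk_left
  have hω : ∀ ω, Measurable fun y => h y ω := fun ω => hh.comp measurable_prodMk_right
  have hI : Measurable fun ω => ∫⁻ y, h y ω ∂lam := hh.lintegral_prod_left'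
  have sq_eq : ∀ f : γ → ℝ≥0∞, Measurable f →
      (∫⁻ y, f y ∂lam) ^ 2 = ∫⁻ y, ∫⁻ y', f y * f y' ∂lam ∂lam := by
    intro f hf
    rw [sq, ← lintegral_mul_const _ hf]
    exact lintegral_congr fun y => (lintegral_const_mul _ hf).symm
  calc ∫⁻ ω, (∫⁻ y, h y ω ∂lam) ^ 2 ∂η
      = ∫⁻ ω, ∫⁻ y, h y ω * ∫⁻ y', h y' ω ∂lam ∂lam ∂η := by
        refine lintegral_congr fun ω => ?_
        rw [sq, ← lintegral_mul_const _ (hω ω)]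
    _ = ∫⁻ y, ∫⁻ ω, h y ω * ∫⁻ y', h y' ω ∂lam ∂η ∂lam := by
        refine lintegral_lintegral_swap (Measurable.aemeasurable ?_)
        exact (hh.comp measurable_swap).mul (hI.comp measurable_fst)
    _ = ∫⁻ y, ∫⁻ y', ∫⁻ ω, h y ω * h y' ω ∂η ∂lam ∂lam := by
        refine lintegral_congr fun y => ?_
        rw [lintegral_lintegral_swap]
        · exact lintegral_congr fun ω => (lintegral_const_mul _ (hω ω)).symm
        · exact (((hy y).comp measurable_snd).mul hh).aemeasurable
    _ ≤ ∫⁻ y, ∫⁻ y', (∫⁻ ω, h y ω ^ 2 ∂η) ^ (1 / 2 : ℝ) *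
          (∫⁻ ω, h y' ω ^ 2 ∂η) ^ (1 / 2 : ℝ) ∂lam ∂lam := by
        refine lintegral_mono fun y => lintegral_mono fun y' => ?_
        have := lintegral_sqrt_mul_le η ((hy y).pow_const 2).aemeasurable
          ((hy y').pow_const 2).aemeasurable
        simp only [← mul_pow, sq_sqrt] at this
        rwa [ENNReal.mul_rpow_of_nonneg _ _ (by norm_num)] at this
    _ = _ := (sq_eq _ hm).symm

lemma lintegral_count_prod {ι α : Type*} [Countable ι] [MeasurableSpace ι]
    [MeasurableSingletonClass ι] [MeasurableSpace α] (μ : Measure α) [SFinite μ]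
    {f : ι × α → ℝ≥0∞} (hf : Measurable f) :
    ∫⁻ y, f y ∂((Measure.count : Measure ι).prod μ) = ∑' i, ∫⁻ a, f (i, a) ∂μ := by
  rw [lintegral_prod _ hf.aemeasurable, lintegral_count]

lemma lintegral_sq_tsum_lintegral_le {ι α Ω : Type*} [Countable ι] [MeasurableSpace α]
    [MeasurableSpace Ω] (μ : Measure α) [SFinite μ] (η : Measure Ω) [SFinite η]
    {b : ι → α → ℝ≥0∞} (hb : ∀ i, Measurable (b i)) {g : ι → α → Ω → ℝ≥0∞}
    (hg : ∀ i, Measurable (Function.uncurry (g i))) :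
    ∫⁻ ω, (∑' i, ∫⁻ z, b i z * g i z ω ∂μ) ^ 2 ∂η ≤
      (∑' i, ∫⁻ z, b i z * (∫⁻ ω, g i z ω ^ 2 ∂η) ^ (1 / 2 : ℝ) ∂μ) ^ 2 := by
  let _ : MeasurableSpace ι := ⊤
  have hz : ∀ i z, Measurable (g i z) := fun i z => (hg i).comp measurable_prodMk_left
  have hm : Measurable (Function.uncurry fun (y : ι × α) ω => b y.1 y.2 * g y.1 y.2 ω) := by
    have : Measurable fun q : ι × (α × Ω) => b q.1 q.2.1 * g q.1 q.2.1 q.2.2 :=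
      measurable_from_prod_countable_right fun i =>
        ((hb i).comp measurable_fst).mul (hg i)
    exact this.comp MeasurableEquiv.prodAssoc.measurable
  have h := lintegral_sq_lintegral_le ((Measure.count : Measure ι).prod μ) η hm
  have e1 : ∀ ω, ∫⁻ y, b y.1 y.2 * g y.1 y.2 ω ∂((Measure.count : Measure ι).prod μ) =
      ∑' i, ∫⁻ z, b i z * g i z ω ∂μ := fun ω =>
    lintegral_count_prod μ (f := fun y => b y.1 y.2 * g y.1 y.2 ω)
      (hm.comp measurable_prodMk_right)
  have e2 := lintegral_count_prod (ι := ι) μ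
    (f := fun y => (∫⁻ ω, (b y.1 y.2 * g y.1 y.2 ω) ^ 2 ∂η) ^ (1 / 2 : ℝ))
    ((hm.pow_const 2).lintegral_prod_right'.pow_const _)
  rw [e2] at h
  simp only [e1] at h
  refine h.trans (le_of_eq ?_)
  congr 2
  ext i
  refine lintegral_congr fun z => ?_
  simp only [mul_pow]
  rw [lintegral_const_mul _ ((hz i z).pow_const 2), ENNReal.mul_rpow_of_nonneg _ _ (by norm_num),
    sq_sqrt]

/-! ### Iteration over the parameters -/

/-- The positive operator with kernels `B k`, acting on sequences `G k` constant on the cells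
of the `k`-th generation, is bounded from `L¹(ℓ²)` to `L¹` of the square function attached to
the weight `c`. -/
def IsSquareBounded {α β : Type*} [MeasurableSpace α] [MeasurableSpace β]
    (μ : Measure α) (ν : Measure β) (c : α → β → ℝ≥0∞) (B : ℤ → β → α → ℝ≥0∞)
    (r : ℤ → α → α → Prop) (K : ℝ≥0∞) : Prop :=
  ∀ G : ℤ → α → ℝ≥0∞, (∀ k, Measurable (G k)) → (∀ k z z', r k z z' → G k z = G k z') →
    ∫⁻ x, (∫⁻ p, c x p * (∑' k, ∫⁻ z, B k p z * G k z ∂μ) ^ 2 ∂ν) ^ (1 / 2 : ℝ) ∂μ ≤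
      K * ∫⁻ z, (∑' k, G k z ^ 2) ^ (1 / 2 : ℝ) ∂μ

lemma IsSquareBounded.vector {α β Ω : Type*} [MeasurableSpace α] [MeasurableSpace β]
    [MeasurableSpace Ω] {μ : Measure α} [SFinite μ] {ν : Measure β} {c : α → β → ℝ≥0∞}
    {B : ℤ → β → α → ℝ≥0∞} {r : ℤ → α → α → Prop} {K : ℝ≥0∞}
    (h : IsSquareBounded μ ν c B r K) (hB : ∀ k, Measurable (Function.uncurry (B k)))
    (η : Measure Ω) [SFinite η] {g : ℤ → α → Ω → ℝ≥0∞}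
    (hg : ∀ k, Measurable (Function.uncurry (g k)))
    (hgr : ∀ k z z', r k z z' → g k z = g k z') :
    ∫⁻ x, (∫⁻ p, c x p * ∫⁻ ω, (∑' k, ∫⁻ z, B k p z * g k z ω ∂μ) ^ 2 ∂η ∂ν) ^ (1 / 2 : ℝ) ∂μ ≤
      K * ∫⁻ z, (∑' k, ∫⁻ ω, g k z ω ^ 2 ∂η) ^ (1 / 2 : ℝ) ∂μ := by
  have h1 := h (fun k z => (∫⁻ ω, g k z ω ^ 2 ∂η) ^ (1 / 2 : ℝ))
    (fun k => ((hg k).pow_const 2).lintegral_prod_right'.pow_const _)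
    (fun k z z' hz => by simp only [hgr k z z' hz])
  simp only [sqrt_sq] at h1
  refine le_trans (lintegral_mono fun x => ?_) h1
  gcongr with p
  exact lintegral_sq_tsum_lintegral_le μ η (fun k => (hB k).comp measurable_prodMk_left) hg

lemma measurable_fin_cons {n : ℕ} {α : Fin (n + 1) → Type*} [∀ j, MeasurableSpace (α j)] :
    Measurable fun q : α 0 × (∀ j : Fin n, α j.succ) => (Fin.cons q.1 q.2 : ∀ j, α j) := by
  refine measurable_pi_iff.2 fun j => ?_
  refine Fin.cases ?_ (fun i => ?_) j
  · simpa using measurable_fst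
  · simp only [Fin.cons_succ]
    exact (measurable_pi_apply i).comp measurable_snd

lemma measurePreserving_fin_cons {n : ℕ} {α : Fin (n + 1) → Type*} [∀ j, MeasurableSpace (α j)]
    (μ : ∀ j, Measure (α j)) [∀ j, SigmaFinite (μ j)] :
    MeasurePreserving (fun q : α 0 × (∀ j : Fin n, α j.succ) => (Fin.cons q.1 q.2 : ∀ j, α j))
      ((μ 0).prod (Measure.pi fun j : Fin n => μ j.succ)) (Measure.pi μ) := by
  have h := (measurePreserving_piFinSuccAbove μ 0).symm
  have e : (fun q : α 0 × (∀ j : Fin n, α j.succ) => (Fin.cons q.1 q.2 : ∀ j, α j)) =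
      ⇑(MeasurableEquiv.piFinSuccAbove α 0).symm :=
    funext fun q => (Fin.insertNth_zero (α := α) q.1 q.2).symm
  rw [e]
  exact h

lemma lintegral_pi_succ {n : ℕ} {α : Fin (n + 1) → Type*} [∀ j, MeasurableSpace (α j)]
    (μ : ∀ j, Measure (α j)) [∀ j, SigmaFinite (μ j)] {f : (∀ j, α j) → ℝ≥0∞}
    (hf : Measurable f) :
    ∫⁻ x, f x ∂(Measure.pi μ) =
      ∫⁻ a, ∫⁻ b, f (Fin.cons a b) ∂(Measure.pi fun j : Fin n => μ j.succ) ∂(μ 0) := by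
  have h := measurePreserving_fin_cons μ
  rw [← h.lintegral_comp hf]
  exact lintegral_prod _ (hf.comp h.measurable).aemeasurable

lemma lintegral_pi_succ_symm {n : ℕ} {α : Fin (n + 1) → Type*} [∀ j, MeasurableSpace (α j)]
    (μ : ∀ j, Measure (α j)) [∀ j, SigmaFinite (μ j)] {f : (∀ j, α j) → ℝ≥0∞}
    (hf : Measurable f) :
    ∫⁻ x, f x ∂(Measure.pi μ) =
      ∫⁻ b, ∫⁻ a, f (Fin.cons a b) ∂(μ 0) ∂(Measure.pi fun j : Fin n => μ j.succ) := by
  have h := measurePreserving_fin_cons μ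
  rw [← h.lintegral_comp hf]
  exact lintegral_prod_symm _ (hf.comp h.measurable).aemeasurable

lemma tsum_fin_succ {n : ℕ} (f : (Fin (n + 1) → ℤ) → ℝ≥0∞) :
    ∑' k, f k = ∑' k₀ : ℤ, ∑' k' : Fin n → ℤ, f (Fin.cons k₀ k') := by
  rw [← (Fin.consEquiv fun _ : Fin (n + 1) => ℤ).tsum_eq, ENNReal.tsum_prod']
  rfl

lemma IsSquareBounded.pi {n : ℕ} {α β : Fin n → Type} [∀ j, MeasurableSpace (α j)]
    [∀ j, MeasurableSpace (β j)] {μ : ∀ j, Measure (α j)} [∀ j, SigmaFinite (μ j)]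
    {ν : ∀ j, Measure (β j)} [∀ j, SigmaFinite (ν j)] {c : ∀ j, α j → β j → ℝ≥0∞}
    {B : ∀ j, ℤ → β j → α j → ℝ≥0∞} {r : ∀ j, ℤ → α j → α j → Prop} {K : Fin n → ℝ≥0∞}
    (h : ∀ j, IsSquareBounded (μ j) (ν j) (c j) (B j) (r j) (K j))
    (hc : ∀ j, Measurable (Function.uncurry (c j)))
    (hB : ∀ j k, Measurable (Function.uncurry (B j k))) (hr : ∀ j k z, r j k z z)
    {Ω : Type} [MeasurableSpace Ω] (η : Measure Ω) [SFinite η]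
    {g : (Fin n → ℤ) → (∀ j, α j) → Ω → ℝ≥0∞} (hg : ∀ k, Measurable (Function.uncurry (g k)))
    (hgr : ∀ k z z', (∀ j, r j (k j) (z j) (z' j)) → g k z = g k z') :
    ∫⁻ x, (∫⁻ p, (∏ j, c j (x j) (p j)) *
        ∫⁻ ω, (∑' k, ∫⁻ z, (∏ j, B j (k j) (p j) (z j)) * g k z ω ∂(Measure.pi μ)) ^ 2 ∂η
        ∂(Measure.pi ν)) ^ (1 / 2 : ℝ) ∂(Measure.pi μ) ≤
      (∏ j, K j) * ∫⁻ z, (∑' k, ∫⁻ ω, g k z ω ^ 2 ∂η) ^ (1 / 2 : ℝ) ∂(Measure.pi μ) := by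
  induction n generalizing Ω with
  | zero =>
    simp [lintegral_unique]
  | succ n ih =>
    set μ' : ∀ j : Fin n, Measure (α j.succ) := fun j => μ j.succ with hμ'
    set ν' : ∀ j : Fin n, Measure (β j.succ) := fun j => ν j.succ with hν'
    set c' : (∀ j : Fin n, α j.succ) → (∀ j : Fin n, β j.succ) → ℝ≥0∞ :=
      fun x p => ∏ j, c j.succ (x j) (p j) with hc'
    set B' : (Fin n → ℤ) → (∀ j : Fin n, β j.succ) → (∀ j : Fin n, α j.succ) → ℝ≥0∞ :=
      fun k p z => ∏ j, B j.succ (k j) (p j) (z j) with hB'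
    have hcm : Measurable (Function.uncurry c') := by
      refine Finset.measurable_fun_prod _ fun j _ => ?_
      have : Measurable fun q : (∀ j : Fin n, α j.succ) × (∀ j : Fin n, β j.succ) =>
        (q.1 j, q.2 j) := by fun_prop
      exact (hc j.succ).comp this
    have hBm : ∀ k, Measurable (Function.uncurry (B' k)) := by
      refine fun k => Finset.measurable_fun_prod _ fun j _ => ?_
      have : Measurable fun q : (∀ j : Fin n, β j.succ) × (∀ j : Fin n, α j.succ) =>
        (q.1 j, q.2 j) := by fun_prop
      exact (hB j.succ (k j)).comp this
    set T : ℤ → α 0 → (∀ j : Fin n, β j.succ) × Ω → ℝ≥0∞ := fun k₀ z₀ q =>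
      ∑' k', ∫⁻ z', B' k' q.1 z' * g (Fin.cons k₀ k') (Fin.cons z₀ z') q.2 ∂(Measure.pi μ')
      with hT
    have hTm : ∀ k₀, Measurable (Function.uncurry (T k₀)) := by
      intro k₀
      refine Measurable.tsum fun k' => ?_
      refine Measurable.lintegral_prod_right' (f := fun y :
        (α 0 × (∀ j : Fin n, β j.succ) × Ω) × (∀ j : Fin n, α j.succ) =>
        B' k' y.1.2.1 y.2 * g (Fin.cons k₀ k') (Fin.cons y.1.1 y.2) y.1.2.2) ?_
      refine ((hBm k').comp ((measurable_fst.comp (measurable_snd.comp measurable_fst)).prodMk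
        measurable_snd)).mul ((hg _).comp (Measurable.prodMk ?_ (by fun_prop)))
      exact measurable_fin_cons.comp
        ((measurable_fst.comp measurable_fst).prodMk measurable_snd)
    have hT1 : ∀ k₀ z₀, Measurable (T k₀ z₀) := fun k₀ z₀ => (hTm k₀).comp measurable_prodMk_left
    have hpair : ∀ k : Fin (n + 1) → ℤ, Measurable
        (Function.uncurry fun (p : ∀ j, β j) (z : ∀ j, α j) => ∏ j, B j (k j) (p j) (z j)) := by
      refine fun k => Finset.measurable_fun_prod _ fun j _ => ?_
      have : Measurable fun q : (∀ j, β j) × (∀ j, α j) => (q.1 j, q.2 j) := by fun_prop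
      exact (hB j (k j)).comp this
    have hcpair : Measurable
        (Function.uncurry fun (x : ∀ j, α j) (p : ∀ j, β j) => ∏ j, c j (x j) (p j)) := by
      refine Finset.measurable_fun_prod _ fun j _ => ?_
      have : Measurable fun q : (∀ j, α j) × (∀ j, β j) => (q.1 j, q.2 j) := by fun_prop
      exact (hc j).comp this
    have hSm : Measurable fun q : (∀ j, β j) × Ω =>
        ∑' k, ∫⁻ z, (∏ j, B j (k j) (q.1 j) (z j)) * g k z q.2 ∂(Measure.pi μ) := by
      refine Measurable.tsum fun k => ?_
      refine Measurable.lintegral_prod_right' (f := fun y : ((∀ j, β j) × Ω) × (∀ j, α j) =>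
        (∏ j, B j (k j) (y.1.1 j) (y.2 j)) * g k y.2 y.1.2) ?_
      exact ((hpair k).comp ((measurable_fst.comp measurable_fst).prodMk measurable_snd)).mul
        ((hg k).comp (measurable_snd.prodMk (measurable_snd.comp measurable_fst)))
    have hSm2 : Measurable fun p : ∀ j, β j =>
        ∫⁻ ω, (∑' k, ∫⁻ z, (∏ j, B j (k j) (p j) (z j)) * g k z ω ∂(Measure.pi μ)) ^ 2 ∂η :=
      (hSm.pow_const 2).lintegral_prod_right'
    have hLm : Measurable fun q : (∀ j, α j) × (∀ j, β j) => (∏ j, c j (q.1 j) (q.2 j)) *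
        ∫⁻ ω, (∑' k, ∫⁻ z, (∏ j, B j (k j) (q.2 j) (z j)) * g k z ω ∂(Measure.pi μ)) ^ 2 ∂η :=
      hcpair.mul (hSm2.comp measurable_snd)
    have hS : ∀ p₀ p' ω, ∑' k, ∫⁻ z, (∏ j, B j (k j) ((Fin.cons p₀ p' : ∀ j, β j) j) (z j)) *
        g k z ω ∂(Measure.pi μ) = ∑' k₀, ∫⁻ z₀, B 0 k₀ p₀ z₀ * T k₀ z₀ (p', ω) ∂(μ 0) := by
      intro p₀ p' ω
      rw [tsum_fin_succ]
      refine tsum_congr fun k₀ => ?_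
      have m1 : ∀ k z₀, Measurable fun z' : ∀ j : Fin n, α j.succ =>
          B' k p' z' * g (Fin.cons k₀ k) (Fin.cons z₀ z') ω := fun k z₀ =>
        ((hBm k).comp measurable_prodMk_left).mul ((hg _).comp
          ((measurable_fin_cons.comp measurable_prodMk_left).prodMk measurable_const))
      have m2 : ∀ k, Measurable fun z₀ => ∫⁻ z', B' k p' z' *
          g (Fin.cons k₀ k) (Fin.cons z₀ z') ω ∂(Measure.pi μ') := fun k =>
        Measurable.lintegral_prod_right' (f := fun y : α 0 × (∀ j : Fin n, α j.succ) =>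
          B' k p' y.2 * g (Fin.cons k₀ k) (Fin.cons y.1 y.2) ω)
          (((hBm k).comp (measurable_const.prodMk measurable_snd)).mul ((hg _).comp
            (measurable_fin_cons.prodMk measurable_const)))
      have m3 : ∀ z₀, T k₀ z₀ (p', ω) = ∑' k', ∫⁻ z', B' k' p' z' *
          g (Fin.cons k₀ k') (Fin.cons z₀ z') ω ∂(Measure.pi μ') := fun z₀ => rfl
      simp only [m3, ← ENNReal.tsum_mul_left]
      have m9 : ∀ k, Measurable fun z₀ => B 0 k₀ p₀ z₀ * ∫⁻ z', B' k p' z' *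
          g (Fin.cons k₀ k) (Fin.cons z₀ z') ω ∂(Measure.pi μ') := fun k =>
        ((hB 0 k₀).comp measurable_prodMk_left).mul (m2 k)
      rw [lintegral_tsum fun k => (m9 k).aemeasurable]
      refine tsum_congr fun k' => ?_
      have m4 : Measurable fun z : ∀ j, α j =>
          (∏ j, B j ((Fin.cons k₀ k' : Fin (n + 1) → ℤ) j) ((Fin.cons p₀ p' : ∀ j, β j) j) (z j)) *
          g (Fin.cons k₀ k') z ω :=
        ((hpair _).comp measurable_prodMk_left).mul ((hg _).comp measurable_prodMk_right)
      rw [lintegral_pi_succ μ m4]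
      refine lintegral_congr fun z₀ => ?_
      rw [← lintegral_const_mul _ (m1 k' z₀)]
      refine lintegral_congr fun z' => ?_
      simp only [Fin.prod_univ_succ, Fin.cons_zero, Fin.cons_succ, hB', mul_assoc]
    have hM : Measurable (Function.uncurry fun (z₀ : α 0) (x' : ∀ j : Fin n, α j.succ) =>
        (∑' k₀, ∫⁻ p', c' x' p' * ∫⁻ ω, T k₀ z₀ (p', ω) ^ 2 ∂η ∂(Measure.pi ν')) ^
          (1 / 2 : ℝ)) := by
      refine Measurable.pow_const (Measurable.tsum fun k₀ => ?_) _
      refine Measurable.lintegral_prod_right' (f := fun y :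
        (α 0 × (∀ j : Fin n, α j.succ)) × (∀ j : Fin n, β j.succ) =>
        c' y.1.2 y.2 * ∫⁻ ω, T k₀ y.1.1 (y.2, ω) ^ 2 ∂η) ?_
      refine (hcm.comp ((measurable_snd.comp measurable_fst).prodMk measurable_snd)).mul ?_
      refine Measurable.lintegral_prod_right' (f := fun y :
        ((α 0 × (∀ j : Fin n, α j.succ)) × (∀ j : Fin n, β j.succ)) × Ω =>
        T k₀ y.1.1.1 (y.1.2, y.2) ^ 2) ?_
      exact ((hTm k₀).comp ((measurable_fst.comp (measurable_fst.comp measurable_fst)).prodMk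
        ((measurable_snd.comp measurable_fst).prodMk measurable_snd))).pow_const 2
    have hweight : ∀ x' (u : (∀ j : Fin n, β j.succ) × Ω → ℝ≥0∞), Measurable u →
        ∫⁻ q, u q ∂(((Measure.pi ν').withDensity (c' x')).prod η) =
          ∫⁻ p', c' x' p' * ∫⁻ ω, u (p', ω) ∂η ∂(Measure.pi ν') := by
      intro x' u hu
      have hcx : Measurable (c' x') := hcm.comp measurable_prodMk_left
      rw [lintegral_prod _ hu.aemeasurable, lintegral_withDensity_eq_lintegral_mul _
        hcx hu.lintegral_prod_right']
      rfl
    have step1 : ∀ x', ∫⁻ x₀, (∫⁻ p, (∏ j, c j ((Fin.cons x₀ x' : ∀ j, α j) j) (p j)) *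
        ∫⁻ ω, (∑' k, ∫⁻ z, (∏ j, B j (k j) (p j) (z j)) * g k z ω ∂(Measure.pi μ)) ^ 2 ∂η
        ∂(Measure.pi ν)) ^ (1 / 2 : ℝ) ∂(μ 0) ≤
        K 0 * ∫⁻ z₀, (∑' k₀, ∫⁻ p', c' x' p' * ∫⁻ ω, T k₀ z₀ (p', ω) ^ 2 ∂η
          ∂(Measure.pi ν')) ^ (1 / 2 : ℝ) ∂(μ 0) := by
      intro x'
      have := (h 0).vector (hB 0) (((Measure.pi ν').withDensity (c' x')).prod η) (g := T) hTm ?_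
      · simp only [hweight x' _ ((hT1 _ _).pow_const 2)] at this
        refine le_trans (lintegral_mono fun x₀ => ?_) this
        refine ENNReal.rpow_le_rpow (le_of_eq ?_) (by norm_num)
        refine (lintegral_pi_succ ν (hLm.comp measurable_prodMk_left)).trans ?_
        refine lintegral_congr fun p₀ => ?_
        have m5 : Measurable fun q : (∀ j : Fin n, β j.succ) × Ω =>
            ∑' k₀, ∫⁻ z₀, B 0 k₀ p₀ z₀ * T k₀ z₀ q ∂(μ 0) := by
          refine Measurable.tsum fun k₀ => ?_
          refine Measurable.lintegral_prod_right' (f := fun y :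
            ((∀ j : Fin n, β j.succ) × Ω) × α 0 => B 0 k₀ p₀ y.2 * T k₀ y.2 y.1) ?_
          exact ((hB 0 k₀).comp (measurable_const.prodMk measurable_snd)).mul
            ((hTm k₀).comp measurable_swap)
        have m6 := (m5.pow_const 2).lintegral_prod_right' (ν := η)
        have m10 : Measurable fun p' => c' x' p' * ∫⁻ ω, (∑' k₀, ∫⁻ z₀, B 0 k₀ p₀ z₀ *
            T k₀ z₀ (p', ω) ∂(μ 0)) ^ 2 ∂η := (hcm.comp measurable_prodMk_left).mul m6
        rw [hweight x' _ (m5.pow_const 2), ← lintegral_const_mul _ m10]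
        refine lintegral_congr fun p' => ?_
        simp only [Function.comp_apply, hS]
        rw [Fin.prod_univ_succ, ← mul_assoc]
        rfl
      · intro k₀ z z' hz
        funext q
        refine tsum_congr fun k' => lintegral_congr fun w => ?_
        rw [hgr _ (Fin.cons z w) (Fin.cons z' w)]
        refine Fin.cases ?_ fun j => ?_
        · simpa using hz
        · simpa using hr j.succ (k' j) (w j)
    let _ : MeasurableSpace ℤ := ⊤
    have step2 : ∀ z₀, ∫⁻ x', (∑' k₀, ∫⁻ p', c' x' p' * ∫⁻ ω, T k₀ z₀ (p', ω) ^ 2 ∂η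
          ∂(Measure.pi ν')) ^ (1 / 2 : ℝ) ∂(Measure.pi μ') ≤
        (∏ j : Fin n, K j.succ) * ∫⁻ z', (∑' k, ∫⁻ ω, g k (Fin.cons z₀ z') ω ^ 2 ∂η) ^
          (1 / 2 : ℝ) ∂(Measure.pi μ') := by
      intro z₀
      have gm : ∀ k', Measurable (Function.uncurry fun (z' : ∀ j : Fin n, α j.succ) (q : ℤ × Ω) =>
          g (Fin.cons q.1 k') (Fin.cons z₀ z') q.2) := by
        intro k'
        have : Measurable fun q : ℤ × ((∀ j : Fin n, α j.succ) × Ω) =>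
            g (Fin.cons q.1 k') (Fin.cons z₀ q.2.1) q.2.2 :=
          measurable_from_prod_countable_right fun k₀ => (hg (Fin.cons k₀ k')).comp
            ((measurable_fin_cons.comp (measurable_const.prodMk measurable_fst)).prodMk
              measurable_snd)
        exact this.comp ((measurable_fst.comp measurable_snd).prodMk
          (measurable_fst.prodMk (measurable_snd.comp measurable_snd)))
      have := ih (μ := μ') (ν := ν') (fun j => h j.succ) (fun j => hc j.succ) (fun j => hB j.succ)
        (fun j => hr j.succ) ((Measure.count : Measure ℤ).prod η)
        (g := fun k' z' q => g (Fin.cons q.1 k') (Fin.cons z₀ z') q.2) gm ?_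
      · refine le_trans (lintegral_mono fun x' => ?_) (this.trans ?_)
        · refine ENNReal.rpow_le_rpow (le_of_eq ?_) (by norm_num)
          have m7 : ∀ k₀, Measurable fun p' => ∫⁻ ω, T k₀ z₀ (p', ω) ^ 2 ∂η := fun k₀ =>
            ((hT1 k₀ z₀).pow_const 2).lintegral_prod_right'
          have m11 : ∀ k₀, Measurable fun p' => c' x' p' * ∫⁻ ω, T k₀ z₀ (p', ω) ^ 2 ∂η :=
            fun k₀ => (hcm.comp measurable_prodMk_left).mul (m7 k₀)
          rw [← lintegral_tsum fun k₀ => (m11 k₀).aemeasurable]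
          refine lintegral_congr fun p' => ?_
          rw [ENNReal.tsum_mul_left]
          have m8 : Measurable fun q : ℤ × Ω => T q.1 z₀ (p', q.2) ^ 2 :=
            measurable_from_prod_countable_right fun k₀ =>
              ((hT1 k₀ z₀).comp measurable_prodMk_left).pow_const 2
          have := lintegral_count_prod η m8
          simp only [hT] at this ⊢
          rw [← this]
        · refine mul_le_mul_right (lintegral_mono fun z' => ?_) _
          refine ENNReal.rpow_le_rpow (le_of_eq ?_) (by norm_num)
          rw [tsum_fin_succ, ENNReal.tsum_comm]
          refine tsum_congr fun k' => ?_
          exact lintegral_count_prod η (f := fun q : ℤ × Ω =>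
            g (Fin.cons q.1 k') (Fin.cons z₀ z') q.2 ^ 2)
            (((gm k').comp measurable_prodMk_left).pow_const 2)
      · intro k' z z' hz
        funext q
        rw [hgr _ (Fin.cons z₀ z) (Fin.cons z₀ z')]
        refine Fin.cases ?_ fun j => ?_
        · simpa using hr 0 q.1 z₀
        · simpa using hz j
    have hgm : Measurable fun z => (∑' k, ∫⁻ ω, g k z ω ^ 2 ∂η) ^ (1 / 2 : ℝ) :=
      Measurable.pow_const (Measurable.tsum fun k =>
        ((hg k).pow_const 2).lintegral_prod_right') _
    have hgm2 : Measurable fun z₀ => ∫⁻ z', (∑' k, ∫⁻ ω, g k (Fin.cons z₀ z') ω ^ 2 ∂η) ^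
          (1 / 2 : ℝ) ∂(Measure.pi μ') :=
      (hgm.comp measurable_fin_cons).lintegral_prod_right'
    have hM2 : Measurable fun x' => ∫⁻ z₀, (∑' k₀, ∫⁻ p', c' x' p' *
        ∫⁻ ω, T k₀ z₀ (p', ω) ^ 2 ∂η ∂(Measure.pi ν')) ^ (1 / 2 : ℝ) ∂(μ 0) :=
      hM.lintegral_prod_left'
    rw [lintegral_pi_succ_symm μ (hLm.lintegral_prod_right'.pow_const _)]
    refine (lintegral_mono step1).trans ?_
    rw [lintegral_const_mul _ hM2, ← lintegral_lintegral_swap hM.aemeasurable,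
      Fin.prod_univ_succ, mul_assoc, lintegral_pi_succ μ hgm, ← lintegral_const_mul _ hgm2]
    exact mul_le_mul_right (lintegral_mono step2) _

/-! ### Dyadic cubes and averages -/

section Dyadic

variable {N : ℕ}

lemma mem_dcube_comm {t : Fin N → ℝ} {k : ℤ} {x y : Fin N → ℝ} :
    y ∈ dcube t k x ↔ x ∈ dcube t k y :=
  ⟨fun h i => (h i).symm, fun h i => (h i).symm⟩

lemma dcube_eq_of_mem {t : Fin N → ℝ} {k : ℤ} {x y : Fin N → ℝ} (h : y ∈ dcube t k x) :
    dcube t k y = dcube t k x := by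
  ext z
  simp only [dcube, Set.mem_ofPred_eq] at h ⊢
  simp only [h]

lemma floor_div_zpow_eq {k l : ℤ} (hkl : k ≤ l) {a b : ℝ}
    (h : ⌊a / (2 : ℝ) ^ k⌋ = ⌊b / (2 : ℝ) ^ k⌋) : ⌊a / (2 : ℝ) ^ l⌋ = ⌊b / (2 : ℝ) ^ l⌋ := by
  obtain ⟨m, rfl⟩ := Int.le.dest hkl
  have e : ∀ a : ℝ, a / (2 : ℝ) ^ (k + (m : ℤ)) = a / (2 : ℝ) ^ k / ((2 ^ m : ℕ) : ℝ) := by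
    intro a
    rw [zpow_add₀ (by norm_num), div_mul_eq_div_div]
    norm_num
  rw [e, e, Int.floor_div_natCast, Int.floor_div_natCast, h]

lemma dcube_mono (t : Fin N → ℝ) {k l : ℤ} (hkl : k ≤ l) (x : Fin N → ℝ) :
    dcube t k x ⊆ dcube t l x := fun _ hy i => floor_div_zpow_eq hkl (hy i)

lemma norm_sub_le_of_mem_dcube {t : Fin N → ℝ} {k : ℤ} {x y : Fin N → ℝ}
    (h : y ∈ dcube t k x) : ‖y - x‖ ≤ (2 : ℝ) ^ k := by
  have hk : (0 : ℝ) < 2 ^ k := by positivity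
  refine (pi_norm_le_iff_of_nonneg hk.le).2 fun i => ?_
  have := Int.abs_sub_lt_one_of_floor_eq_floor (h i)
  rw [← sub_div, abs_div, abs_of_pos hk, div_lt_one hk, sub_sub_sub_cancel_right] at this
  rw [Pi.sub_apply, Real.norm_eq_abs]
  exact this.le

lemma dcube_eq_pi (t : Fin N → ℝ) (k : ℤ) (x : Fin N → ℝ) :
    dcube t k x = Set.univ.pi fun i =>
      Set.Ico (t i + ⌊(x i - t i) / (2 : ℝ) ^ k⌋ * (2 : ℝ) ^ k)
        (t i + ⌊(x i - t i) / (2 : ℝ) ^ k⌋ * (2 : ℝ) ^ k + 2 ^ k) := by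
  have hk : (0 : ℝ) < 2 ^ k := by positivity
  ext y
  simp only [dcube, Set.mem_ofPred_eq, Set.mem_univ_pi, Set.mem_Ico]
  refine forall_congr' fun i => ?_
  rw [Int.floor_eq_iff, le_div_iff₀ hk, div_lt_iff₀ hk, add_mul, one_mul]
  constructor <;> rintro ⟨h1, h2⟩ <;> constructor <;> linarith

lemma measurableSet_dcube (t : Fin N → ℝ) (k : ℤ) (x : Fin N → ℝ) :
    MeasurableSet (dcube t k x) := by
  rw [dcube_eq_pi]
  exact MeasurableSet.univ_pi fun i => measurableSet_Ico

lemma measurableSet_dcube_rel (t : Fin N → ℝ) (k : ℤ) :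
    MeasurableSet {q : (Fin N → ℝ) × (Fin N → ℝ) | q.2 ∈ dcube t k q.1} := by
  have e : {q : (Fin N → ℝ) × (Fin N → ℝ) | q.2 ∈ dcube t k q.1} = ⋂ i,
      {q | ⌊(q.2 i - t i) / (2 : ℝ) ^ k⌋ = ⌊(q.1 i - t i) / (2 : ℝ) ^ k⌋} := by
    ext q
    simp [dcube]
  rw [e]
  refine MeasurableSet.iInter fun i => ?_
  have h1 : Measurable fun q : (Fin N → ℝ) × (Fin N → ℝ) => ⌊(q.2 i - t i) / (2 : ℝ) ^ k⌋ :=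
    Int.measurable_floor.comp (by fun_prop)
  have h2 : Measurable fun q : (Fin N → ℝ) × (Fin N → ℝ) => ⌊(q.1 i - t i) / (2 : ℝ) ^ k⌋ :=
    Int.measurable_floor.comp (by fun_prop)
  exact measurableSet_eq_fun h1 h2

lemma volume_dcube (t : Fin N → ℝ) (k : ℤ) (x : Fin N → ℝ) :
    volume (dcube t k x) = ENNReal.ofReal (((2 : ℝ) ^ k) ^ N) := by
  rw [dcube_eq_pi, Real.volume_pi_Ico]
  simp only [add_sub_cancel_left, Finset.prod_const, Finset.card_univ, Fintype.card_fin]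
  rw [ENNReal.ofReal_pow (by positivity)]

lemma volume_dcube_ne_top (t : Fin N → ℝ) (k : ℤ) (x : Fin N → ℝ) :
    volume (dcube t k x) ≠ ∞ := by
  rw [volume_dcube]; exact ENNReal.ofReal_ne_top

lemma volume_real_dcube (t : Fin N → ℝ) (k : ℤ) (x : Fin N → ℝ) :
    volume.real (dcube t k x) = ((2 : ℝ) ^ k) ^ N := by
  rw [Measure.real, volume_dcube, ENNReal.toReal_ofReal (by positivity)]

lemma integral_setIntegral_comm {α : Type*} [MeasurableSpace α] {μ : Measure α} [SFinite μ]
    {S : α → Set α} (hS : MeasurableSet {q : α × α | q.2 ∈ S q.1})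
    (hsymm : ∀ x y, y ∈ S x ↔ x ∈ S y) {V : ℝ≥0∞} (hV : V ≠ ∞) (hSV : ∀ x, μ (S x) ≤ V)
    {f ψ : α → ℝ} (hf : Integrable f μ) (hψ : AEStronglyMeasurable ψ μ) {C : ℝ}
    (hC : ∀ x, |ψ x| ≤ C) :
    Integrable (fun x => (∫ y in S x, f y ∂μ) * ψ x) μ ∧
      ∫ x, (∫ y in S x, f y ∂μ) * ψ x ∂μ = ∫ y, f y * ∫ x in S y, ψ x ∂μ ∂μ := by
  classical
  have hSx : ∀ x, MeasurableSet (S x) := fun x => hS.preimage measurable_prodMk_left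
  let F : α → α → ℝ := fun x y => {q : α × α | q.2 ∈ S q.1}.indicator
    (fun q => f q.2 * ψ q.1) (x, y)
  have hF1 : ∀ x y, F x y = (S x).indicator f y * ψ x := by
    intro x y
    by_cases h : y ∈ S x <;> simp [F, h]
  have hF2 : ∀ x y, F x y = f y * (S y).indicator ψ x := by
    intro x y
    by_cases h : y ∈ S x
    · simp [F, h, (hsymm x y).1 h]
    · simp [F, h, mt (hsymm x y).2 h]
  have hFm : AEStronglyMeasurable (Function.uncurry F) (μ.prod μ) :=
    (AEStronglyMeasurable.mul (hf.1.comp_snd) (hψ.comp_fst)).indicator hS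
  have hint : ∀ y, Integrable ((S y).indicator ψ) μ := fun y => by
    rw [integrable_indicator_iff (hSx y)]
    exact Measure.integrableOn_of_bounded (M := C) ((hSV y).trans_lt hV.lt_top).ne hψ
      (Eventually.of_forall hC)
  have hFi : Integrable (Function.uncurry F) (μ.prod μ) := by
    refine (integrable_prod_iff' hFm).2 ⟨Eventually.of_forall fun y => ?_, ?_⟩
    · simp only [Function.uncurry, hF2]
      exact (hint y).const_mul _
    · refine Integrable.mono' (g := fun y => |f y| * (C * V.toReal)) (hf.abs.mul_const _)
        hFm.norm.prod_swap.integral_prod_right' (Eventually.of_forall fun y => ?_)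
      have h0 : (0 : ℝ) ≤ C := (abs_nonneg _).trans (hC y)
      simp only [Function.uncurry, hF2, norm_mul, Real.norm_eq_abs]
      rw [integral_const_mul, abs_mul, abs_abs]
      refine mul_le_mul_of_nonneg_left ?_ (abs_nonneg _)
      rw [abs_of_nonneg (integral_nonneg fun _ => abs_nonneg _)]
      calc ∫ x, |(S y).indicator ψ x| ∂μ ≤ ∫ x, (S y).indicator (fun _ => C) x ∂μ := by
            refine integral_mono (hint y).abs ?_ fun x => ?_
            · rw [integrable_indicator_iff (hSx y)]
              exact integrableOn_const ((hSV y).trans_lt hV.lt_top).ne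
            · by_cases h : x ∈ S y <;> simp [h, hC]
        _ = C * μ.real (S y) := by
            rw [integral_indicator (hSx y), setIntegral_const, smul_eq_mul, mul_comm]
        _ ≤ C * V.toReal := by
            exact mul_le_mul_of_nonneg_left (ENNReal.toReal_mono hV (hSV y)) h0
  have e : ∀ x, ∫ y, F x y ∂μ = (∫ y in S x, f y ∂μ) * ψ x := fun x => by
    simp only [hF1]
    rw [integral_mul_const, integral_indicator (hSx x)]
  refine ⟨by simpa only [← e] using! hFi.integral_prod_left, ?_⟩
  have h := integral_integral_swap hFi
  calc ∫ x, (∫ y in S x, f y ∂μ) * ψ x ∂μ = ∫ x, ∫ y, F x y ∂μ ∂μ := by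
        simp only [e]
    _ = ∫ y, ∫ x, F x y ∂μ ∂μ := h
    _ = _ := by
        refine integral_congr_ae (Eventually.of_forall fun y => ?_)
        simp only [hF2]
        rw [integral_const_mul, integral_indicator (hSx y)]

/-- The averaging operators of a dyadic lattice with offset `t` are symmetric. -/
lemma integral_avg_mul (t : Fin N → ℝ) (k : ℤ) {f ψ : (Fin N → ℝ) → ℝ} (hf : Integrable f)
    (hψ : AEStronglyMeasurable ψ) {C : ℝ} (hC : ∀ x, |ψ x| ≤ C) :
    ∫ x, avg (fun _ => t) k f x * ψ x = ∫ x, f x * avg (fun _ => t) k ψ x := by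
  have h := integral_setIntegral_comm (μ := volume) (measurableSet_dcube_rel t k)
    (fun x y => mem_dcube_comm) ENNReal.ofReal_ne_top (fun x => (volume_dcube t k x).le)
    hf hψ hC |>.2
  simp only [avg, div_mul_eq_mul_div, mul_div_assoc']
  rw [integral_div, integral_div, h]

lemma avg_congr {t : Fin N → ℝ} {k : ℤ} {x x' : Fin N → ℝ} (h : x' ∈ dcube t k x)
    (f : (Fin N → ℝ) → ℝ) : avg (fun _ => t) k f x' = avg (fun _ => t) k f x := by
  simp only [avg, dcube_eq_of_mem h]

/-- If `g` is constant on the cube, its average over the cube is that constant. -/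
lemma avg_of_const {t : Fin N → ℝ} {k : ℤ} {g : (Fin N → ℝ) → ℝ} {x : Fin N → ℝ}
    (h : ∀ y ∈ dcube t k x, g y = g x) : avg (fun _ => t) k g x = g x := by
  rw [avg, setIntegral_congr_fun (measurableSet_dcube t k x) h, setIntegral_const,
    volume_real_dcube, smul_eq_mul, mul_div_assoc, mul_comm, div_mul_cancel₀]
  positivity

lemma measurable_uncurry_avg {P : Type*} [MeasurableSpace P] (t : Fin N → ℝ) (k : ℤ)
    {Φ : P → (Fin N → ℝ) → ℝ} (hΦ : Measurable (Function.uncurry Φ)) :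
    Measurable (Function.uncurry fun p => avg (fun _ => t) k (Φ p)) := by
  have h1 : Measurable fun q : (P × (Fin N → ℝ)) × (Fin N → ℝ) =>
      {q : (Fin N → ℝ) × (Fin N → ℝ) | q.2 ∈ dcube t k q.1}.indicator 1 (q.1.2, q.2) *
        Φ q.1.1 q.2 := by
    refine Measurable.mul ?_ (hΦ.comp ((measurable_fst.comp measurable_fst).prodMk measurable_snd))
    exact (measurable_const.indicator (measurableSet_dcube_rel t k)).comp
      ((measurable_snd.comp measurable_fst).prodMk measurable_snd)
  have h2 := (h1.stronglyMeasurable.integral_prod_right' (ν := volume)).measurable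
  convert h2.div_const (((2 : ℝ) ^ k) ^ N) using 1
  funext q
  simp only [Function.uncurry, avg]
  congr 1
  rw [← integral_indicator (measurableSet_dcube t k q.2)]
  refine integral_congr_ae (Eventually.of_forall fun y => ?_)
  by_cases h : y ∈ dcube t k q.2 <;> simp [h]

lemma measurable_uncurry_mdiff {P : Type*} [MeasurableSpace P] (t : Fin N → ℝ) (k : ℤ)
    {Φ : P → (Fin N → ℝ) → ℝ} (hΦ : Measurable (Function.uncurry Φ)) :
    Measurable (Function.uncurry fun p => mdiff (fun _ => t) k (Φ p)) :=
  (measurable_uncurry_avg t (k - 1) hΦ).sub (measurable_uncurry_avg t k hΦ)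

lemma measurable_avg (t : Fin N → ℝ) (k : ℤ) {f : (Fin N → ℝ) → ℝ} (hf : Measurable f) :
    Measurable (avg (fun _ => t) k f) := by
  have h : Measurable (Function.uncurry fun _ : Unit => f) := hf.comp measurable_snd
  exact (measurable_uncurry_avg t k h).of_uncurry_left (x := ())

lemma measurable_mdiff (t : Fin N → ℝ) (k : ℤ) {f : (Fin N → ℝ) → ℝ} (hf : Measurable f) :
    Measurable (mdiff (fun _ => t) k f) :=
  (measurable_avg t (k - 1) hf).sub (measurable_avg t k hf)

lemma integrableOn_dcube {f : (Fin N → ℝ) → ℝ} (hf : Measurable f) {C : ℝ}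
    (hC : ∀ x, |f x| ≤ C) (t : Fin N → ℝ) (k : ℤ) (x : Fin N → ℝ) :
    IntegrableOn f (dcube t k x) :=
  Measure.integrableOn_of_bounded (volume_dcube_ne_top t k x) hf.aestronglyMeasurable
    (Eventually.of_forall hC)

lemma abs_avg_sub_le {f : (Fin N → ℝ) → ℝ} (hf : Measurable f) {C : ℝ}
    (hC : ∀ x, |f x| ≤ C) {t : Fin N → ℝ} {k : ℤ} {x : Fin N → ℝ} {a b : ℝ}
    (h : ∀ y ∈ dcube t k x, |f y - a| ≤ b) : |avg (fun _ => t) k f x - a| ≤ b := by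
  have hk : (0 : ℝ) < ((2 : ℝ) ^ k) ^ N := by positivity
  have e : avg (fun _ => t) k f x - a = (∫ y in dcube t k x, (f y - a)) / ((2 : ℝ) ^ k) ^ N := by
    rw [integral_sub (integrableOn_dcube hf hC t k x)
      (integrableOn_const (volume_dcube_ne_top t k x)), setIntegral_const, volume_real_dcube, avg]
    field_simp
    simp
  rw [e, abs_div, abs_of_pos hk, div_le_iff₀ hk]
  have := norm_setIntegral_le_of_norm_le_const (μ := volume)
    (volume_dcube_ne_top t k x).lt_top (f := fun y => f y - a) h
  rwa [volume_real_dcube] at this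

lemma abs_avg_le {f : (Fin N → ℝ) → ℝ} (hf : Measurable f) {C : ℝ}
    (hC : ∀ x, |f x| ≤ C) (t : Fin N → ℝ) (k : ℤ) (x : Fin N → ℝ) :
    |avg (fun _ => t) k f x| ≤ C := by
  simpa using abs_avg_sub_le hf hC (a := 0) (b := C) (t := t) (k := k) (x := x)
    fun y _ => by simpa using hC y

lemma avg_sub {f g : (Fin N → ℝ) → ℝ} (t : Fin N → ℝ) (k : ℤ) (x : Fin N → ℝ)
    (hf : IntegrableOn f (dcube t k x)) (hg : IntegrableOn g (dcube t k x)) :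
    avg (fun _ => t) k (fun y => f y - g y) x =
      avg (fun _ => t) k f x - avg (fun _ => t) k g x := by
  simp only [avg]
  rw [integral_sub hf hg, sub_div]

lemma avg_avg_of_le {f : (Fin N → ℝ) → ℝ} (hf : Integrable f) (t : Fin N → ℝ) {k l : ℤ}
    (hkl : k ≤ l) (x : Fin N → ℝ) :
    avg (fun _ => t) l (avg (fun _ => t) k f) x = avg (fun _ => t) l f x := by
  have hQ := measurableSet_dcube t l x
  have h := integral_avg_mul t k hf (ψ := (dcube t l x).indicator 1)
    ((measurable_const.indicator hQ).aestronglyMeasurable) (C := 1) fun y => by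
      by_cases hy : y ∈ dcube t l x <;> simp [hy]
  have e : ∀ y, avg (fun _ => t) k ((dcube t l x).indicator 1) y =
      (dcube t l x).indicator 1 y := by
    refine fun y => avg_of_const fun z hz => ?_
    have : z ∈ dcube t l x ↔ y ∈ dcube t l x := by
      rw [mem_dcube_comm, mem_dcube_comm (y := y), dcube_eq_of_mem (dcube_mono t hkl y hz)]
    by_cases hy : y ∈ dcube t l x <;> simp [hy, this]
  have e2 : ∀ g : (Fin N → ℝ) → ℝ, ∫ y, g y * (dcube t l x).indicator 1 y =
      ∫ y in dcube t l x, g y := by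
    intro g
    rw [← integral_indicator hQ]
    refine integral_congr_ae (Eventually.of_forall fun y => ?_)
    by_cases h : y ∈ dcube t l x <;> simp [h]
  simp only [e, e2] at h
  rw [avg, avg, h]

lemma mdiff_mdiff {f : (Fin N → ℝ) → ℝ} (hf : Measurable f) (hfi : Integrable f) {C : ℝ}
    (hC : ∀ x, |f x| ≤ C) (t : Fin N → ℝ) (k : ℤ) (x : Fin N → ℝ) :
    mdiff (fun _ => t) k (mdiff (fun _ => t) k f) x = mdiff (fun _ => t) k f x := by
  have hi : ∀ m l y, IntegrableOn (avg (fun _ => t) m f) (dcube t l y) := fun m l y =>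
    integrableOn_dcube (measurable_avg t m hf) (abs_avg_le hf hC t m) t l y
  have e : mdiff (fun _ => t) k f =
      fun y => avg (fun _ => t) (k - 1) f y - avg (fun _ => t) k f y := rfl
  have e1 : avg (fun _ => t) (k - 1) (avg (fun _ => t) k f) x = avg (fun _ => t) k f x :=
    avg_of_const fun y hy => avg_congr (dcube_mono t (by lia) x hy) f
  rw [mdiff, e, avg_sub _ _ _ (hi _ _ _) (hi _ _ _), avg_sub _ _ _ (hi _ _ _) (hi _ _ _),
    avg_avg_of_le hfi t (le_refl (k - 1)), avg_avg_of_le hfi t (le_refl k),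
    avg_avg_of_le hfi t (sub_le_self k zero_le_one), e1]
  ring

lemma abs_avg_le_integral {f : (Fin N → ℝ) → ℝ} (hf : Integrable f) (t : Fin N → ℝ) (k : ℤ)
    (x : Fin N → ℝ) : |avg (fun _ => t) k f x| ≤ (∫ y, |f y|) / ((2 : ℝ) ^ k) ^ N := by
  have hk : (0 : ℝ) < ((2 : ℝ) ^ k) ^ N := by positivity
  rw [avg, abs_div, abs_of_pos hk]
  gcongr
  exact (abs_integral_le_integral_abs).trans (setIntegral_le_integral hf.abs
    (Eventually.of_forall fun _ => abs_nonneg _))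

lemma tendsto_avg_atTop (hN : 0 < N) {f : (Fin N → ℝ) → ℝ} (hf : Integrable f) (t : Fin N → ℝ)
    (x : Fin N → ℝ) : Tendsto (fun m : ℕ => avg (fun _ => t) (m : ℤ) f x) atTop (𝓝 0) := by
  refine squeeze_zero_norm (fun m => abs_avg_le_integral hf t m x) ?_
  refine Tendsto.div_atTop tendsto_const_nhds ?_
  simp only [zpow_natCast, ← pow_mul, mul_comm _ N]
  simp only [pow_mul]
  exact tendsto_pow_atTop_atTop_of_one_lt (one_lt_pow₀ (by norm_num) hN.ne')

lemma tendsto_avg_atBot {f : (Fin N → ℝ) → ℝ} (hf : Measurable f) {C : ℝ} (hC : ∀ x, |f x| ≤ C)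
    (t : Fin N → ℝ) {x : Fin N → ℝ} (hx : ContinuousAt f x) :
    Tendsto (fun m : ℕ => avg (fun _ => t) (-(m : ℤ) - 1) f x) atTop (𝓝 (f x)) := by
  rw [Metric.tendsto_atTop]
  intro ε hε
  obtain ⟨δ, hδ, h⟩ := Metric.continuousAt_iff.1 hx (ε / 2) (half_pos hε)
  obtain ⟨M, hM⟩ := exists_pow_lt_of_lt_one hδ (by norm_num : (1 / 2 : ℝ) < 1)
  refine ⟨M, fun m hm => ?_⟩
  refine lt_of_le_of_lt (abs_avg_sub_le hf hC fun y hy => ?_) (half_lt_self hε)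
  refine (h ?_).le
  rw [dist_eq_norm]
  refine (norm_sub_le_of_mem_dcube hy).trans_lt (lt_of_le_of_lt ?_ hM)
  rw [one_div, inv_pow, ← zpow_natCast, ← zpow_neg]
  exact zpow_le_zpow_right₀ (by norm_num) (by lia)

end Dyadic

/-! ### Averages over dyadic rectangles -/

section Product

variable {n} {Nd}

lemma ravg_prod (t : Π j : Fin n, Fin (Nd j) → ℝ) (k : Fin n → ℤ)
    (φ : Π j : Fin n, (Fin (Nd j) → ℝ) → ℝ) (x : X n Nd) :
    ravg n Nd (fun j _ => t j) k (fun z => ∏ j, φ j (z j)) x =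
      ∏ j, avg (fun _ => t j) (k j) (φ j) (x j) := by
  simp only [ravg, avg, Finset.prod_div_distrib]
  congr 1
  rw [volume_pi, Measure.restrict_pi_pi]
  exact integral_fintype_prod_eq_prod _

lemma integral_ravg_mul (t : Π j : Fin n, Fin (Nd j) → ℝ) (k : Fin n → ℤ) {f ψ : X n Nd → ℝ}
    (hf : Integrable f) (hψ : AEStronglyMeasurable ψ) {C : ℝ} (hC : ∀ x, |ψ x| ≤ C) :
    Integrable (fun x => ravg n Nd (fun j _ => t j) k f x * ψ x) ∧
    ∫ x, ravg n Nd (fun j _ => t j) k f x * ψ x =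
      ∫ x, f x * ravg n Nd (fun j _ => t j) k ψ x := by
  have hS : MeasurableSet {q : X n Nd × X n Nd |
      q.2 ∈ Set.univ.pi fun j => dcube (t j) (k j) (q.1 j)} := by
    have e : {q : X n Nd × X n Nd | q.2 ∈ Set.univ.pi fun j => dcube (t j) (k j) (q.1 j)} =
        ⋂ j, {q | q.2 j ∈ dcube (t j) (k j) (q.1 j)} := by
      ext q
      simp
    rw [e]
    refine MeasurableSet.iInter fun j => ?_
    have : Measurable fun q : X n Nd × X n Nd => (q.1 j, q.2 j) := by fun_prop
    exact (measurableSet_dcube_rel (t j) (k j)).preimage this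
  have h := integral_setIntegral_comm (μ := (volume : Measure (X n Nd)))
    (S := fun x => Set.univ.pi fun j => dcube (t j) (k j) (x j)) hS
    (fun x y => by simp only [Set.mem_univ_pi]; exact forall_congr' fun j => mem_dcube_comm)
    (V := ∏ j, ENNReal.ofReal (((2 : ℝ) ^ k j) ^ Nd j))
    (ENNReal.prod_ne_top fun j _ => ENNReal.ofReal_ne_top)
    (fun x => by rw [volume_pi_pi]; simp only [volume_dcube, le_refl]) hf hψ hC
  simp only [ravg, div_mul_eq_mul_div, mul_div_assoc']
  rw [integral_div, integral_div, h.2]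
  exact ⟨h.1.div_const _, rfl⟩

lemma prod_mdiff (t : Π j : Fin n, Fin (Nd j) → ℝ) (k : Fin n → ℤ)
    (φ : Π j : Fin n, (Fin (Nd j) → ℝ) → ℝ) (x : X n Nd) :
    ∏ j, mdiff (fun _ => t j) (k j) (φ j) (x j) =
      ∑ ε : Fin n → Bool, (-1 : ℝ) ^ (Finset.univ.filter fun j => ε j = false).card *
        ∏ j, avg (fun _ => t j) (k j - if ε j then 1 else 0) (φ j) (x j) := by
  have e : ∀ j, mdiff (fun _ => t j) (k j) (φ j) (x j) = ∑ b : Bool,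
      (if b = false then (-1 : ℝ) else 1) *
        avg (fun _ => t j) (k j - if b then 1 else 0) (φ j) (x j) := by
    intro j
    simp [mdiff, sub_eq_add_neg]
  simp only [e]
  rw [Finset.prod_univ_sum, Fintype.piFinset_univ]
  refine Finset.sum_congr rfl fun ε _ => ?_
  rw [Finset.prod_mul_distrib]
  congr 1
  rw [Finset.prod_ite]
  simp

/-- Martingale differences of `f` against a tensor product may be moved to the factors. -/
lemma integral_rmdiff_mul_prod (t : Π j : Fin n, Fin (Nd j) → ℝ) (k : Fin n → ℤ)
    {f : X n Nd → ℝ} (hf : Integrable f) {φ : Π j : Fin n, (Fin (Nd j) → ℝ) → ℝ}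
    (hφ : ∀ j, Measurable (φ j)) {C : Fin n → ℝ} (hC : ∀ j x, |φ j x| ≤ C j) :
    ∫ z, rmdiff n Nd (fun j _ => t j) k f z * ∏ j, φ j (z j) =
      ∫ z, f z * ∏ j, mdiff (fun _ => t j) (k j) (φ j) (z j) := by
  have hm : Measurable fun z : X n Nd => ∏ j, φ j (z j) :=
    Finset.measurable_fun_prod _ fun j _ => (hφ j).comp (measurable_pi_apply j)
  have hb : ∀ z : X n Nd, |∏ j, φ j (z j)| ≤ ∏ j, C j := fun z => by
    rw [Finset.abs_prod]
    exact Finset.prod_le_prod (fun _ _ => abs_nonneg _) fun j _ => hC j _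
  have h := fun k => integral_ravg_mul t k hf hm.aestronglyMeasurable hb
  have hma : ∀ k : Fin n → ℤ, Measurable fun z : X n Nd =>
      ∏ j, avg (fun _ => t j) (k j) (φ j) (z j) := fun k =>
    Finset.measurable_fun_prod _ fun j _ =>
      (measurable_avg (t j) (k j) (hφ j)).comp (measurable_pi_apply j)
  have hba : ∀ (k : Fin n → ℤ) (z : X n Nd),
      |∏ j, avg (fun _ => t j) (k j) (φ j) (z j)| ≤ ∏ j, C j := fun k z => by
    rw [Finset.abs_prod]
    exact Finset.prod_le_prod (fun _ _ => abs_nonneg _) fun j _ =>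
      abs_avg_le (hφ j) (hC j) _ _ _
  have hi : ∀ k : Fin n → ℤ, Integrable fun z : X n Nd =>
      f z * ∏ j, avg (fun _ => t j) (k j) (φ j) (z j) := fun k =>
    hf.mul_bdd (c := ∏ j, C j) (hma k).aestronglyMeasurable (Eventually.of_forall (hba k))
  simp only [rmdiff, prod_mdiff, Finset.sum_mul, Finset.mul_sum, mul_assoc, mul_left_comm (f _)]
  rw [integral_finsetSum _ fun ε _ => ((h _).1.const_mul _),
    integral_finsetSum _ fun ε _ => ((hi _).const_mul _)]
  refine Finset.sum_congr rfl fun ε _ => ?_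
  rw [integral_const_mul, integral_const_mul, (h _).2]
  simp only [ravg_prod]

lemma sum_mdiff {N : ℕ} (t : Fin N → ℝ) (m : ℕ) (f : (Fin N → ℝ) → ℝ) (x : Fin N → ℝ) :
    ∑ k ∈ (Finset.range (2 * m + 1)).image (fun i : ℕ => (i : ℤ) - m), mdiff (fun _ => t) k f x =
      avg (fun _ => t) (-(m : ℤ) - 1) f x - avg (fun _ => t) m f x := by
  rw [Finset.sum_image fun i _ j _ h => by simpa using h]
  have e : ∀ i : ℕ, mdiff (fun _ => t) ((i : ℤ) - m) f x =
      avg (fun _ => t) ((i : ℤ) - m - 1) f x -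
        avg (fun _ => t) (((i + 1 : ℕ) : ℤ) - m - 1) f x := by
    intro i
    rw [mdiff]
    congr 2
    push_cast
    ring
  simp only [e]
  rw [Finset.sum_range_sub' fun i : ℕ => avg (fun _ => t) ((i : ℤ) - m - 1) f x]
  congr 2
  · simp
  · push_cast
    ring

/-- The pairing of an integrable function with a tensor product of nice functions is controlled
by the pairings of the martingale differences. -/
lemma ofReal_abs_integral_mul_prod_le (hNd : ∀ j, 0 < Nd j) (t : Π j : Fin n, Fin (Nd j) → ℝ)
    {f : X n Nd → ℝ} (hf : Integrable f) {φ : Π j : Fin n, (Fin (Nd j) → ℝ) → ℝ}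
    (hφ : ∀ j, Continuous (φ j)) (hφi : ∀ j, Integrable (φ j)) {C : Fin n → ℝ}
    (hC : ∀ j x, |φ j x| ≤ C j) :
    ENNReal.ofReal |∫ z, f z * ∏ j, φ j (z j)| ≤
      ∑' k : Fin n → ℤ, ∫⁻ z, (∏ j, ENNReal.ofReal |mdiff (fun _ => t j) (k j) (φ j) (z j)|) *
        ENNReal.ofReal |rmdiff n Nd (fun j _ => t j) k f z| := by
  have hφm := fun j => (hφ j).measurable
  set S : ℕ → ℝ := fun m => ∫ z, f z * ∏ j, (avg (fun _ => t j) (-(m : ℤ) - 1) (φ j) (z j) -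
    avg (fun _ => t j) m (φ j) (z j)) with hS
  have hdb : ∀ (j : Fin n) k l x,
      |avg (fun _ => t j) k (φ j) x - avg (fun _ => t j) l (φ j) x| ≤ 2 * C j := by
    intro j k l x
    refine (abs_sub _ _).trans ?_
    linarith [abs_avg_le (hφm j) (hC j) (t j) k x, abs_avg_le (hφm j) (hC j) (t j) l x]
  have hmb : ∀ (j : Fin n) k x, |mdiff (fun _ => t j) k (φ j) x| ≤ 2 * C j :=
    fun j k x => hdb j _ _ x
  have hlim : Tendsto S atTop (𝓝 (∫ z, f z * ∏ j, φ j (z j))) := by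
    refine tendsto_integral_of_dominated_convergence (fun z => |f z| * ∏ j, (2 * C j)) ?_
      (hf.abs.mul_const _) ?_ ?_
    · intro m
      refine hf.1.mul (Measurable.aestronglyMeasurable ?_)
      exact Finset.measurable_fun_prod _ fun j _ => ((measurable_avg _ _ (hφm j)).sub
        (measurable_avg _ _ (hφm j))).comp (measurable_pi_apply j)
    · refine fun m => Eventually.of_forall fun z => ?_
      rw [norm_mul, Real.norm_eq_abs, Real.norm_eq_abs, Finset.abs_prod]
      exact mul_le_mul_of_nonneg_left (Finset.prod_le_prod (fun _ _ => abs_nonneg _)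
        fun j _ => hdb j _ _ _) (abs_nonneg _)
    · refine Eventually.of_forall fun z => Tendsto.const_mul _ (tendsto_finsetProd _ fun j _ => ?_)
      have := (tendsto_avg_atBot (hφm j) (hC j) (t j) ((hφ j).continuousAt (x := z j))).sub
        (tendsto_avg_atTop (hNd j) (hφi j) (t j) (z j))
      simpa using this
  refine le_of_tendsto ((ENNReal.continuous_ofReal.comp continuous_abs).continuousAt.tendsto.comp
    hlim) (Eventually.of_forall fun m => ?_)
  have hterm : ∀ k : Fin n → ℤ,
      ENNReal.ofReal |∫ z, f z * ∏ j, mdiff (fun _ => t j) (k j) (φ j) (z j)| ≤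
      ∫⁻ z, (∏ j, ENNReal.ofReal |mdiff (fun _ => t j) (k j) (φ j) (z j)|) *
        ENNReal.ofReal |rmdiff n Nd (fun j _ => t j) k f z| := by
    intro k
    have h := integral_rmdiff_mul_prod t k hf (fun j => measurable_mdiff (t j) (k j) (hφm j))
      (fun j => hmb j (k j))
    simp only [mdiff_mdiff (hφm _) (hφi _) (hC _)] at h
    rw [← h, ← Real.enorm_eq_ofReal_abs]
    refine (enorm_integral_le_lintegral_enorm _).trans (le_of_eq (lintegral_congr fun z => ?_))
    rw [Real.enorm_eq_ofReal_abs, abs_mul, Finset.abs_prod, mul_comm,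
      ENNReal.ofReal_mul (Finset.prod_nonneg fun _ _ => abs_nonneg _),
      ENNReal.ofReal_prod_of_nonneg fun _ _ => abs_nonneg _]
  have hSm : S m = ∑ k ∈ Fintype.piFinset fun _ : Fin n =>
      (Finset.range (2 * m + 1)).image (fun i : ℕ => (i : ℤ) - m),
      ∫ z, f z * ∏ j, mdiff (fun _ => t j) (k j) (φ j) (z j) := by
    rw [← integral_finsetSum]
    · refine integral_congr_ae (Eventually.of_forall fun z => ?_)
      simp only [← Finset.mul_sum, ← sum_mdiff]
      rw [Finset.prod_univ_sum]
    · intro k _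
      refine hf.mul_bdd (c := ∏ j, (2 * C j)) (Measurable.aestronglyMeasurable ?_)
        (Eventually.of_forall fun z => ?_)
      · exact Finset.measurable_fun_prod _ fun j _ =>
          (measurable_mdiff _ _ (hφm j)).comp (measurable_pi_apply j)
      · rw [Real.norm_eq_abs, Finset.abs_prod]
        exact Finset.prod_le_prod (fun _ _ => abs_nonneg _) fun j _ => hmb j _ _
  simp only [Function.comp_apply, hSm]
  calc _ ≤ ENNReal.ofReal (∑ k ∈ Fintype.piFinset fun _ : Fin n =>
      (Finset.range (2 * m + 1)).image (fun i : ℕ => (i : ℤ) - m),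
      |∫ z, f z * ∏ j, mdiff (fun _ => t j) (k j) (φ j) (z j)|) :=
        ENNReal.ofReal_le_ofReal (Finset.abs_sum_le_sum_abs _ _)
    _ ≤ _ := by
        rw [ENNReal.ofReal_sum_of_nonneg fun _ _ => abs_nonneg _]
        exact (Finset.sum_le_sum fun k _ => hterm k).trans (ENNReal.sum_le_tsum _)

end Product

/-! ### Integrals of powers -/

section Kernel

variable {N : ℕ}

lemma lintegral_eq_mul_lintegral_comp_smul {f : (Fin N → ℝ) → ℝ≥0∞} (hf : Measurable f) {s : ℝ}
    (hs : 0 < s) : ∫⁻ w, f w = ENNReal.ofReal (s ^ N) * ∫⁻ u, f (s • u) := by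
  have h := Measure.map_addHaar_smul (volume : Measure (Fin N → ℝ)) hs.ne'
  have h2 : ∫⁻ u, f (s • u) = ∫⁻ w, f w ∂(Measure.map (s • ·) volume) :=
    (lintegral_map hf (measurable_const_smul s)).symm
  rw [h2, h, lintegral_smul_measure, smul_eq_mul, ← mul_assoc, ← ENNReal.ofReal_mul (by positivity)]
  have : s ^ N * |(s ^ Module.finrank ℝ (Fin N → ℝ))⁻¹| = 1 := by
    rw [Module.finrank_fin_fun, abs_of_pos (by positivity), mul_inv_cancel₀ (by positivity)]
  rw [this, ENNReal.ofReal_one, one_mul]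

/-- The profile `s / (s + r)^(N+1)` of the Poisson kernel of `ℝ^N`. -/
def bump (N : ℕ) (s r : ℝ) : ℝ := s / (s + r) ^ (N + 1)

lemma bump_nonneg {s r : ℝ} (hs : 0 ≤ s) (hr : 0 ≤ r) : 0 ≤ bump N s r := by
  unfold bump; positivity

/-- The total mass of the profile `bump N 1 ‖·‖` on `ℝ^N`. -/
def bumpMass (N : ℕ) : ℝ≥0∞ := ∫⁻ u : Fin N → ℝ, ENNReal.ofReal (bump N 1 ‖u‖)

lemma bumpMass_ne_top (N : ℕ) : bumpMass N ≠ ∞ := by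
  have h := integrable_one_add_norm (E := Fin N → ℝ) (μ := volume) (r := (N : ℝ) + 1) (by simp)
  have := h.lintegral_lt_top
  refine (lt_of_le_of_lt (le_of_eq ?_) this).ne
  refine lintegral_congr fun u => ?_
  have hu : (0 : ℝ) ≤ 1 + ‖u‖ := by positivity
  rw [bump, Real.rpow_neg hu, one_div]
  norm_cast

lemma lintegral_bump {s : ℝ} (hs : 0 < s) :
    ∫⁻ w : Fin N → ℝ, ENNReal.ofReal (bump N s ‖w‖) = bumpMass N := by
  have hm : Measurable fun w : Fin N → ℝ => ENNReal.ofReal (bump N s ‖w‖) := by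
    unfold bump; fun_prop
  rw [lintegral_eq_mul_lintegral_comp_smul hm hs, bumpMass, ← lintegral_const_mul]
  · refine lintegral_congr fun u => ?_
    rw [← ENNReal.ofReal_mul (by positivity), norm_smul, Real.norm_of_nonneg hs.le]
    congr 1
    have : 0 < 1 + ‖u‖ := by positivity
    rw [bump, bump, show s + s * ‖u‖ = s * (1 + ‖u‖) by ring, mul_pow]
    field_simp
    ring
  · exact hm.comp (measurable_const_smul s)

lemma lintegral_bump_sub {s : ℝ} (hs : 0 < s) (z : Fin N → ℝ) :
    ∫⁻ x : Fin N → ℝ, ENNReal.ofReal (bump N s ‖x - z‖) = bumpMass N := by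
  rw [lintegral_sub_right_eq_self (μ := volume) fun x => ENNReal.ofReal (bump N s ‖x‖)]
  exact lintegral_bump hs

lemma lintegral_bump_sub' {s : ℝ} (hs : 0 < s) (z : Fin N → ℝ) :
    ∫⁻ x : Fin N → ℝ, ENNReal.ofReal (bump N s ‖z - x‖) = bumpMass N := by
  simp only [norm_sub_rev z]
  exact lintegral_bump_sub hs z

/-- The mass of `(1 + ‖·‖)^(-N-1/2)` on `ℝ^N`. -/
def tailMass (N : ℕ) : ℝ≥0∞ :=
  ∫⁻ u : Fin N → ℝ, ENNReal.ofReal (1 / ((1 + ‖u‖) ^ N * √(1 + ‖u‖)))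

lemma tailMass_ne_top (N : ℕ) : tailMass N ≠ ∞ := by
  have h := integrable_one_add_norm (E := Fin N → ℝ) (μ := volume) (r := (N : ℝ) + 1 / 2) (by simp)
  have := h.lintegral_lt_top
  refine (lt_of_le_of_lt (le_of_eq ?_) this).ne
  refine lintegral_congr fun u => ?_
  have hu : (0 : ℝ) < 1 + ‖u‖ := by positivity
  rw [Real.rpow_neg hu.le, one_div, Real.rpow_add hu, Real.sqrt_eq_rpow, Real.rpow_natCast]

lemma lintegral_tail {s : ℝ} (hs : 0 < s) :
    ∫⁻ w : Fin N → ℝ, ENNReal.ofReal (1 / ((s + ‖w‖) ^ N * √(s + ‖w‖))) =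
      ENNReal.ofReal (1 / √s) * tailMass N := by
  have hm : Measurable fun w : Fin N → ℝ =>
      ENNReal.ofReal (1 / ((s + ‖w‖) ^ N * √(s + ‖w‖))) := by fun_prop
  have hm1 : Measurable fun w : Fin N → ℝ =>
      ENNReal.ofReal (1 / ((1 + ‖w‖) ^ N * √(1 + ‖w‖))) := by fun_prop
  have hm2 : Measurable fun u : Fin N → ℝ =>
      ENNReal.ofReal (1 / ((s + ‖s • u‖) ^ N * √(s + ‖s • u‖))) := by fun_prop
  rw [lintegral_eq_mul_lintegral_comp_smul hm hs, tailMass, ← lintegral_const_mul _ hm1,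
    ← lintegral_const_mul _ hm2]
  · refine lintegral_congr fun u => ?_
    rw [← ENNReal.ofReal_mul (by positivity), ← ENNReal.ofReal_mul (by positivity), norm_smul,
      Real.norm_of_nonneg hs.le]
    congr 1
    have : 0 < 1 + ‖u‖ := by positivity
    have h2 : 0 < √s := Real.sqrt_pos.2 hs
    have h3 : 0 < √(1 + ‖u‖) := Real.sqrt_pos.2 this
    rw [show s + s * ‖u‖ = s * (1 + ‖u‖) by ring, mul_pow, Real.sqrt_mul hs.le]
    field_simp

/-! ### Cubes and their translates -/

lemma volume_dcube_diff_translate_le (hN : 0 < N) (t : Fin N → ℝ) (k : ℤ) (z w : Fin N → ℝ) :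
    volume (dcube t k z \ {y | y - w ∈ dcube t k z}) ≤
      ENNReal.ofReal (N * ((2 : ℝ) ^ k) ^ N * √(‖w‖ / 2 ^ k)) := by
  have hl : (0 : ℝ) < 2 ^ k := by positivity
  have hN1 : (1 : ℝ) ≤ N := by exact_mod_cast hN
  rcases le_or_gt (2 ^ k) ‖w‖ with h | h
  · refine (measure_mono Set.sdiff_subset).trans ?_
    rw [volume_dcube]
    refine ENNReal.ofReal_le_ofReal ?_
    have h1 : 1 ≤ √(‖w‖ / 2 ^ k) := by
      rw [Real.one_le_sqrt, one_le_div hl]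
      exact h
    have h2 : 1 * ((2 : ℝ) ^ k) ^ N ≤ N * ((2 : ℝ) ^ k) ^ N := by gcongr
    nlinarith [pow_pos hl N]
  · set a : Fin N → ℝ := fun i => t i + ⌊(z i - t i) / (2 : ℝ) ^ k⌋ * 2 ^ k with ha
    set Q' : Set (Fin N → ℝ) := Set.univ.pi fun i =>
      Set.Ico (a i + max (w i) 0) (a i + max (w i) 0 + (2 ^ k - ‖w‖)) with hQ'
    have hmem : ∀ y, y ∈ dcube t k z ↔ ∀ i, a i ≤ y i ∧ y i < a i + 2 ^ k := by
      intro y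
      rw [dcube_eq_pi]
      simp only [Set.mem_univ_pi, Set.mem_Ico, ha]
    have hw : ∀ i, |w i| ≤ ‖w‖ := fun i => norm_le_pi_norm w i
    have hsub1 : Q' ⊆ dcube t k z := by
      intro y hy
      rw [hmem]
      intro i
      have h1 := hy i trivial
      have h2 := hw i
      simp only [Set.mem_Ico] at h1
      constructor
      · linarith [le_max_right (w i) 0]
      · have : max (w i) 0 ≤ ‖w‖ := max_le ((le_abs_self _).trans h2) (norm_nonneg _)
        linarith
    have hsub2 : Q' ⊆ {y | y - w ∈ dcube t k z} := by
      intro y hy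
      rw [Set.mem_ofPred_eq, hmem]
      intro i
      have h1 := hy i trivial
      have h2 := hw i
      simp only [Set.mem_Ico] at h1
      simp only [Pi.sub_apply]
      constructor
      · linarith [le_max_left (w i) 0]
      · have : max (w i) 0 ≤ ‖w‖ + w i := max_le (by linarith [norm_nonneg w])
          (by linarith [neg_abs_le (w i)])
        linarith
    have hvol : volume Q' = ENNReal.ofReal ((2 ^ k - ‖w‖) ^ N) := by
      rw [hQ', volume_pi_pi]
      simp only [Real.volume_Ico, add_sub_cancel_left, Finset.prod_const, Finset.card_univ,
        Fintype.card_fin]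
      rw [ENNReal.ofReal_pow (by linarith)]
    have hQm : MeasurableSet Q' := MeasurableSet.univ_pi fun _ => measurableSet_Ico
    calc _ ≤ volume (dcube t k z \ Q') := measure_mono (Set.sdiff_subset_sdiff_right hsub2)
      _ = ENNReal.ofReal (((2 : ℝ) ^ k) ^ N) - ENNReal.ofReal ((2 ^ k - ‖w‖) ^ N) := by
          rw [measure_sdiff hsub1 hQm.nullMeasurableSet (by rw [hvol]; exact ENNReal.ofReal_ne_top),
            volume_dcube, hvol]
      _ = ENNReal.ofReal (((2 : ℝ) ^ k) ^ N - (2 ^ k - ‖w‖) ^ N) :=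
          (ENNReal.ofReal_sub _ (pow_nonneg (by linarith) _)).symm
      _ ≤ _ := by
          refine ENNReal.ofReal_le_ofReal ?_
          set r := ‖w‖ / 2 ^ k with hr
          have hwr : ‖w‖ = 2 ^ k * r := by rw [hr]; field_simp
          have hr0 : 0 ≤ r := by positivity
          have hr1 : r ≤ 1 := by rw [hr, div_le_one hl]; exact h.le
          have hb := one_add_mul_le_pow (a := -r) (by linarith) N
          have hs : r ≤ √r := Real.le_sqrt_of_sq_le (by nlinarith)
          have e : (2 ^ k - ‖w‖) ^ N = ((2 : ℝ) ^ k) ^ N * (1 + -r) ^ N := by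
            rw [hwr, ← mul_pow]; ring
          rw [e]
          have hp : 0 < ((2 : ℝ) ^ k) ^ N := by positivity
          have : 1 - (1 + -r) ^ N ≤ N * √r := by
            have : (N : ℝ) * r ≤ N * √r := by gcongr
            linarith
          nlinarith

lemma volume_translate_dcube_diff_le (hN : 0 < N) (t : Fin N → ℝ) (k : ℤ) (z w : Fin N → ℝ) :
    volume ({y | y - w ∈ dcube t k z} \ dcube t k z) ≤
      ENNReal.ofReal (N * ((2 : ℝ) ^ k) ^ N * √(‖w‖ / 2 ^ k)) := by
  have h := volume_dcube_diff_translate_le hN t k z (-w)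
  rw [norm_neg] at h
  rw [← measure_preimage_add_right volume w]
  refine (measure_mono fun y hy => ?_).trans h
  simpa using hy

end Kernel

/-! ### Estimates for the martingale differences of a kernel -/

section KernelEstimates

variable {N : ℕ}

/-- Size, smoothness and cancellation conditions for a family of kernels with parameter
`τ > 0`, modelled on the derivatives of the Poisson kernel. -/
structure IsKernel (φ : (Fin N → ℝ) → ℝ → ℝ) (A : ℝ) : Prop where
  measurable : Measurable (Function.uncurry φ)
  size : ∀ y τ, 0 < τ → |φ y τ| ≤ A / (τ + ‖y‖) ^ (N + 1)
  smooth : ∀ y y' τ, 0 < τ → ‖y - y'‖ ≤ τ →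
    |φ y τ - φ y' τ| ≤ A * ‖y - y'‖ / (τ + ‖y‖) ^ (N + 2)
  cancel : ∀ τ, 0 < τ → ∫ y, φ y τ = 0

/-- The function `z ↦ φ (y - z) τ` attached to `p = (y, τ)`. -/
def translateKernel (φ : (Fin N → ℝ) → ℝ → ℝ) (p : (Fin N → ℝ) × ℝ) (z : Fin N → ℝ) : ℝ :=
  φ (p.1 - z) p.2

lemma setLIntegral_bump_le (t : Fin N → ℝ) (m : ℤ) {s : ℝ} (hs : 0 < s)
    (hsm : s ≤ 2 * (2 : ℝ) ^ m) (x z : Fin N → ℝ) :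
    ∫⁻ y in dcube t m z, ENNReal.ofReal (bump N s ‖x - y‖) ≤
      ENNReal.ofReal (((2 : ℝ) ^ m) ^ N) *
        ENNReal.ofReal (3 ^ (N + 1) * ((bumpMass N).toReal + 2) * bump N (2 ^ m) ‖x - z‖) := by
  have hl : (0 : ℝ) < 2 ^ m := by positivity
  set l : ℝ := 2 ^ m with hld
  set M := (bumpMass N).toReal with hM
  have hM0 : 0 ≤ M := ENNReal.toReal_nonneg
  set r := ‖x - z‖ with hr
  have hr0 : 0 ≤ r := norm_nonneg _
  rw [← ENNReal.ofReal_mul (by positivity)]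
  rcases le_or_gt r (2 * l) with h | h
  · calc _ ≤ ∫⁻ y, ENNReal.ofReal (bump N s ‖x - y‖) := setLIntegral_le_lintegral _ _
      _ = ENNReal.ofReal M := by
          rw [lintegral_bump_sub' hs, hM, ENNReal.ofReal_toReal (bumpMass_ne_top N)]
      _ ≤ _ := by
          refine ENNReal.ofReal_le_ofReal ?_
          have h1 : l ^ N * (3 ^ (N + 1) * (l / (3 * l) ^ (N + 1))) = 1 := by
            field_simp
            ring
          have h2 : l / (3 * l) ^ (N + 1) ≤ bump N l r := by
            unfold bump
            gcongr
            linarith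
          calc M ≤ (M + 2) * (l ^ N * (3 ^ (N + 1) * (l / (3 * l) ^ (N + 1)))) := by
                rw [h1]; linarith
            _ ≤ (M + 2) * (l ^ N * (3 ^ (N + 1) * bump N l r)) := by gcongr
            _ = _ := by ring
  · calc _ ≤ ∫⁻ y in dcube t m z, ENNReal.ofReal (2 * l / ((r + l) / 3) ^ (N + 1)) := by
          refine setLIntegral_mono' (measurableSet_dcube t m z) fun y hy => ?_
          refine ENNReal.ofReal_le_ofReal ?_
          have h1 := norm_sub_le_of_mem_dcube hy
          have h2 : r ≤ ‖x - y‖ + ‖y - z‖ := norm_sub_le_norm_sub_add_norm_sub x y z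
          unfold bump
          gcongr
          linarith
      _ = ENNReal.ofReal (l ^ N * (2 * l / ((r + l) / 3) ^ (N + 1))) := by
          rw [setLIntegral_const, volume_dcube, mul_comm, ENNReal.ofReal_mul (by positivity)]
      _ ≤ _ := by
          refine ENNReal.ofReal_le_ofReal ?_
          have h1 : 2 * l / ((r + l) / 3) ^ (N + 1) = 3 ^ (N + 1) * 2 * bump N l r := by
            unfold bump
            rw [div_pow, add_comm r l]
            field_simp
          rw [h1]
          have := bump_nonneg (N := N) hl.le hr0
          gcongr
          linarith

lemma lintegral_bump_mul_le (t : Fin N → ℝ) (m : ℤ) {s : ℝ} (hs : 0 < s)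
    (hsm : s ≤ 2 * (2 : ℝ) ^ m) (x : Fin N → ℝ) {D : (Fin N → ℝ) → ℝ≥0∞} (hD : Measurable D)
    (hDm : ∀ z z', z' ∈ dcube t m z → D z = D z') :
    ∫⁻ z, ENNReal.ofReal (bump N s ‖x - z‖) * D z ≤
      ∫⁻ z, ENNReal.ofReal (3 ^ (N + 1) * ((bumpMass N).toReal + 2) * bump N (2 ^ m) ‖x - z‖) *
        D z := by
  have hl : (0 : ℝ) < 2 ^ m := by positivity
  set V := ENNReal.ofReal (((2 : ℝ) ^ m) ^ N) with hV
  have hV0 : V ≠ 0 := by rw [hV, Ne, ENNReal.ofReal_eq_zero, not_le]; positivity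
  have hVt : V ≠ ∞ := ENNReal.ofReal_ne_top
  have hb : Measurable fun z : Fin N → ℝ => ENNReal.ofReal (bump N s ‖x - z‖) := by
    unfold bump; fun_prop
  have hset := measurableSet_dcube_rel t m
  set I : (Fin N → ℝ) → (Fin N → ℝ) → ℝ≥0∞ := fun z y =>
    {q : (Fin N → ℝ) × (Fin N → ℝ) | q.2 ∈ dcube t m q.1}.indicator 1 (z, y) with hI
  have hIm : Measurable (Function.uncurry I) := measurable_const.indicator hset
  have hIs : ∀ z y, I z y = I y z := fun z y => by
    have : y ∈ dcube t m z ↔ z ∈ dcube t m y := mem_dcube_comm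
    by_cases hy : y ∈ dcube t m z
    · simp [hI, hy, this.1 hy]
    · simp [hI, hy, mt this.2 hy]
  have hIset : ∀ z (g : (Fin N → ℝ) → ℝ≥0∞), ∫⁻ y, I z y * g y = ∫⁻ y in dcube t m z, g y := by
    intro z g
    rw [← lintegral_indicator (measurableSet_dcube t m z)]
    refine lintegral_congr fun y => ?_
    by_cases h : y ∈ dcube t m z <;> simp [hI, h]
  have hDavg : ∀ z, D z = V⁻¹ * ∫⁻ y, I z y * D y := by
    intro z
    rw [hIset, setLIntegral_congr_fun (measurableSet_dcube t m z)
      fun y hy => (hDm z y hy).symm, setLIntegral_const, volume_dcube, mul_comm (D z), ← mul_assoc,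
      ENNReal.inv_mul_cancel hV0 hVt, one_mul]
  calc _ = ∫⁻ z, ∫⁻ y, ENNReal.ofReal (bump N s ‖x - z‖) * (V⁻¹ * (I z y * D y)) := by
        refine lintegral_congr fun z => ?_
        have h1 : Measurable fun y => I z y * D y := hIm.of_uncurry_left.mul hD
        rw [lintegral_const_mul _ (h1.const_mul _), lintegral_const_mul _ h1, ← hDavg]
    _ = ∫⁻ y, ∫⁻ z, ENNReal.ofReal (bump N s ‖x - z‖) * (V⁻¹ * (I z y * D y)) := by
        refine lintegral_lintegral_swap (Measurable.aemeasurable ?_)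
        exact (hb.comp measurable_fst).mul ((hIm.mul (hD.comp measurable_snd)).const_mul _)
    _ = ∫⁻ y, V⁻¹ * (∫⁻ z in dcube t m y, ENNReal.ofReal (bump N s ‖x - z‖)) * D y := by
        refine lintegral_congr fun y => ?_
        have h1 : Measurable fun z => I y z * ENNReal.ofReal (bump N s ‖x - z‖) :=
          hIm.of_uncurry_left.mul hb
        rw [← hIset, mul_assoc, ← lintegral_mul_const _ h1, ← lintegral_const_mul _ (h1.mul_const _)]
        refine lintegral_congr fun z => ?_
        rw [hIs]
        ring
    _ ≤ _ := by
        refine lintegral_mono fun y => ?_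
        gcongr
        calc _ ≤ V⁻¹ * (V * _) := by gcongr; exact setLIntegral_bump_le t m hs hsm x y
          _ = _ := by rw [← mul_assoc, ENNReal.inv_mul_cancel hV0 hVt, one_mul]

namespace IsKernel

variable {φ : (Fin N → ℝ) → ℝ → ℝ} {A : ℝ}

lemma const_nonneg (h : IsKernel φ A) : 0 ≤ A := by
  have := (abs_nonneg _).trans (h.size 0 1 one_pos)
  simpa using this

lemma measurable_translateKernel (h : IsKernel φ A) :
    Measurable (Function.uncurry (translateKernel φ)) :=
  h.measurable.comp ((measurable_fst.fst.sub measurable_snd).prodMk measurable_fst.snd)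

lemma measurable_translate (h : IsKernel φ A) (p : (Fin N → ℝ) × ℝ) :
    Measurable (translateKernel φ p) :=
  h.measurable_translateKernel.of_uncurry_left

lemma abs_translate_le (h : IsKernel φ A) {p : (Fin N → ℝ) × ℝ} (hp : 0 < p.2)
    (z : Fin N → ℝ) : |translateKernel φ p z| ≤ A / p.2 ^ (N + 1) := by
  have hA := h.const_nonneg
  refine (h.size _ _ hp).trans ?_
  gcongr
  linarith [norm_nonneg (p.1 - z)]

lemma mul_abs_translate_le (h : IsKernel φ A) {p : (Fin N → ℝ) × ℝ} (hp : 0 < p.2)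
    (z : Fin N → ℝ) : p.2 * |translateKernel φ p z| ≤ A * bump N p.2 ‖p.1 - z‖ := by
  have := h.size (p.1 - z) p.2 hp
  calc _ ≤ p.2 * (A / (p.2 + ‖p.1 - z‖) ^ (N + 1)) := by gcongr; exact this
    _ = _ := by unfold bump; ring

lemma mul_abs_avg_le (h : IsKernel φ A) (t : Fin N → ℝ) (m : ℤ) {p : (Fin N → ℝ) × ℝ}
    (hp : 0 < p.2) (hpm : p.2 ≤ 2 * (2 : ℝ) ^ m) (z : Fin N → ℝ) :
    p.2 * |avg (fun _ => t) m (translateKernel φ p) z| ≤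
      A * (3 ^ (N + 1) * ((bumpMass N).toReal + 2) * bump N (2 ^ m) ‖p.1 - z‖) := by
  have hA := h.const_nonneg
  have hV : (0 : ℝ) < ((2 : ℝ) ^ m) ^ N := by positivity
  have hM0 : 0 ≤ (bumpMass N).toReal := ENNReal.toReal_nonneg
  have hb : 0 ≤ bump N (2 ^ m) ‖p.1 - z‖ := bump_nonneg (by positivity) (norm_nonneg _)
  rw [avg, abs_div, abs_of_pos hV, mul_div_assoc', div_le_iff₀ hV,
    ← ENNReal.ofReal_le_ofReal_iff (by positivity)]
  calc _ = ‖∫ y in dcube t m z, p.2 * translateKernel φ p y‖ₑ := by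
        rw [integral_const_mul, Real.enorm_eq_ofReal_abs, abs_mul, abs_of_pos hp]
    _ ≤ ∫⁻ y in dcube t m z, ‖p.2 * translateKernel φ p y‖ₑ := enorm_integral_le_lintegral_enorm _
    _ ≤ ∫⁻ y in dcube t m z, ENNReal.ofReal A * ENNReal.ofReal (bump N p.2 ‖p.1 - y‖) := by
        refine lintegral_mono fun y => ?_
        rw [Real.enorm_eq_ofReal_abs, abs_mul, abs_of_pos hp, ← ENNReal.ofReal_mul hA]
        exact ENNReal.ofReal_le_ofReal (h.mul_abs_translate_le hp y)
    _ = ENNReal.ofReal A * ∫⁻ y in dcube t m z, ENNReal.ofReal (bump N p.2 ‖p.1 - y‖) := by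
        refine lintegral_const_mul _ ?_
        unfold bump; fun_prop
    _ ≤ ENNReal.ofReal A * (ENNReal.ofReal (((2 : ℝ) ^ m) ^ N) * ENNReal.ofReal
          (3 ^ (N + 1) * ((bumpMass N).toReal + 2) * bump N (2 ^ m) ‖p.1 - z‖)) := by
        gcongr
        exact setLIntegral_bump_le t m hp hpm p.1 z
    _ = _ := by
        rw [← ENNReal.ofReal_mul hV.le, ← ENNReal.ofReal_mul hA]
        congr 1
        ring

/-- Pointwise bound for the martingale differences of a kernel. -/
lemma exists_mul_abs_mdiff_le (h : IsKernel φ A) : ∃ C : ℝ, 0 ≤ C ∧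
    ∀ (t : Fin N → ℝ) (k : ℤ) (p : (Fin N → ℝ) × ℝ) (z : Fin N → ℝ), 0 < p.2 →
      p.2 * |mdiff (fun _ => t) k (translateKernel φ p) z| ≤
        C * ((2 : ℝ) ^ k / (2 ^ k + p.2 + ‖p.1 - z‖) ^ (N + 1)) := by
  have hA := h.const_nonneg
  set M := (bumpMass N).toReal with hM
  have hM0 : 0 ≤ M := ENNReal.toReal_nonneg
  refine ⟨2 * A * 2 ^ (N + 1) + A * (3 ^ (N + 1) * (M + 2)) * (2 * 4 ^ (N + 1)), by positivity,
    fun t k p z hp => ?_⟩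
  have hl : (0 : ℝ) < 2 ^ k := by positivity
  set l : ℝ := 2 ^ k with hld
  have hl1 : (2 : ℝ) ^ (k - 1) = l / 2 := by rw [zpow_sub_one₀ two_ne_zero]; rfl
  set r := ‖p.1 - z‖ with hr
  have hr0 : 0 ≤ r := norm_nonneg _
  have hE : 0 ≤ l / (l + p.2 + r) ^ (N + 1) := by positivity
  rw [mdiff]
  rcases le_or_gt l p.2 with hlp | hlp
  · have key : ∀ j ≤ k, |avg (fun _ => t) j (translateKernel φ p) z - translateKernel φ p z| ≤
        A * l / (p.2 + r) ^ (N + 2) := by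
      intro j hj
      refine abs_avg_sub_le (h.measurable_translate p) (h.abs_translate_le hp) fun y hy => ?_
      have h1 : ‖y - z‖ ≤ l := norm_sub_le_of_mem_dcube (dcube_mono t hj z hy)
      have e : (p.1 - z) - (p.1 - y) = y - z := by abel
      have h2 := h.smooth (p.1 - z) (p.1 - y) p.2 hp (by rw [e]; exact h1.trans hlp)
      rw [e] at h2
      rw [abs_sub_comm]
      refine h2.trans ?_
      gcongr
    have h1 := key (k - 1) (by lia)
    have h2 := key k le_rfl
    rw [abs_sub_comm] at h2
    have h3 := (abs_sub_le _ (translateKernel φ p z) _).trans (add_le_add h1 h2)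
    calc _ ≤ p.2 * (A * l / (p.2 + r) ^ (N + 2) + A * l / (p.2 + r) ^ (N + 2)) := by
          gcongr
      _ = 2 * A * l * (p.2 / (p.2 + r)) / (p.2 + r) ^ (N + 1) := by
          field_simp
          ring
      _ ≤ 2 * A * l * 1 / ((l + p.2 + r) / 2) ^ (N + 1) := by
          gcongr
          · rw [div_le_one (by positivity)]; linarith
          · linarith
      _ = 2 * A * 2 ^ (N + 1) * (l / (l + p.2 + r) ^ (N + 1)) := by
          rw [div_pow]; field_simp
      _ ≤ _ := by
          gcongr
          simp only [le_add_iff_nonneg_right]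
          positivity
  · have h1 := h.mul_abs_avg_le t (k - 1) hp (by rw [hl1]; linarith) z
    have h2 := h.mul_abs_avg_le t k hp (by linarith) z
    rw [hl1] at h1
    have b1 : bump N (l / 2) r ≤ 4 ^ (N + 1) * (l / (l + p.2 + r) ^ (N + 1)) := by
      calc bump N (l / 2) r ≤ l / ((l + p.2 + r) / 4) ^ (N + 1) := by
            unfold bump
            gcongr <;> linarith
        _ = _ := by rw [div_pow]; field_simp
    have b2 : bump N l r ≤ 4 ^ (N + 1) * (l / (l + p.2 + r) ^ (N + 1)) := by
      calc bump N l r ≤ l / ((l + p.2 + r) / 4) ^ (N + 1) := by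
            unfold bump
            gcongr
            linarith
        _ = _ := by rw [div_pow]; field_simp
    have h3 := abs_sub (avg (fun _ => t) (k - 1) (translateKernel φ p) z)
      (avg (fun _ => t) k (translateKernel φ p) z)
    calc _ ≤ p.2 * (|avg (fun _ => t) (k - 1) (translateKernel φ p) z| +
          |avg (fun _ => t) k (translateKernel φ p) z|) := by gcongr
      _ ≤ A * (3 ^ (N + 1) * (M + 2) * bump N (l / 2) r) +
          A * (3 ^ (N + 1) * (M + 2) * bump N l r) := by rw [mul_add]; exact add_le_add h1 h2
      _ ≤ A * (3 ^ (N + 1) * (M + 2) * (4 ^ (N + 1) * (l / (l + p.2 + r) ^ (N + 1)))) +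
          A * (3 ^ (N + 1) * (M + 2) * (4 ^ (N + 1) * (l / (l + p.2 + r) ^ (N + 1)))) := by
          gcongr
      _ = A * (3 ^ (N + 1) * (M + 2)) * (2 * 4 ^ (N + 1)) * (l / (l + p.2 + r) ^ (N + 1)) := by
          ring
      _ ≤ _ := by
          gcongr
          simp only [le_add_iff_nonneg_left]
          positivity

end IsKernel

end KernelEstimates

/-! ### Integrated bounds for the martingale differences of a kernel -/

section KernelIntegrals

variable {N : ℕ}

namespace IsKernel

variable {φ : (Fin N → ℝ) → ℝ → ℝ} {A : ℝ}

lemma lintegral_slice_le (h : IsKernel φ A) {τ : ℝ} (hτ : 0 < τ) :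
    ∫⁻ y, ENNReal.ofReal |φ y τ| ≤ ENNReal.ofReal (A / τ) * bumpMass N := by
  have hA := h.const_nonneg
  rw [← lintegral_bump hτ, ← lintegral_const_mul _ (by unfold bump; fun_prop)]
  refine lintegral_mono fun y => ?_
  rw [← ENNReal.ofReal_mul (by positivity)]
  refine ENNReal.ofReal_le_ofReal ((h.size y τ hτ).trans_eq ?_)
  unfold bump
  field_simp

lemma measurable_slice (h : IsKernel φ A) (τ : ℝ) : Measurable fun y => φ y τ :=
  h.measurable.comp (measurable_id.prodMk measurable_const)

lemma integrable_slice (h : IsKernel φ A) {τ : ℝ} (hτ : 0 < τ) : Integrable fun y => φ y τ := by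
  refine ⟨(h.measurable_slice τ).aestronglyMeasurable, ?_⟩
  rw [hasFiniteIntegral_iff_norm]
  exact (h.lintegral_slice_le hτ).trans_lt
    (ENNReal.mul_lt_top ENNReal.ofReal_lt_top (bumpMass_ne_top N).lt_top)

/-- The averages of a kernel over cubes that are large with respect to `τ` have a small
integral in the translation variable. -/
lemma lintegral_abs_avg_le (h : IsKernel φ A) (hN : 0 < N) (t : Fin N → ℝ) (m : ℤ) {τ : ℝ}
    (hτ : 0 < τ) (z : Fin N → ℝ) :
    ∫⁻ y, ENNReal.ofReal |avg (fun _ => t) m (translateKernel φ (y, τ)) z| ≤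
      ENNReal.ofReal (2 * N * A / (√((2 : ℝ) ^ m) * √τ)) * tailMass N := by
  have hA := h.const_nonneg
  have hl : (0 : ℝ) < 2 ^ m := by positivity
  set l : ℝ := 2 ^ m with hld
  set Q := dcube t m z with hQ
  have hQm : MeasurableSet Q := measurableSet_dcube t m z
  set χ : (Fin N → ℝ) → ℝ := Q.indicator 1 with hχ
  have hχm : Measurable χ := measurable_const.indicator hQm
  have hφi := h.integrable_slice hτ
  have hφm := h.measurable_slice τ
  have hQw : ∀ w, MeasurableSet {y | y - w ∈ Q} := fun w => measurable_id.sub_const w hQm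
  have e1 : ∀ y, ∫ x in Q, translateKernel φ (y, τ) x = ∫ w, (χ (y - w) - χ y) * φ w τ := by
    intro y
    have hi : Integrable fun w => χ (y - w) * φ w τ := by
      refine hφi.bdd_mul (c := 1) (hχm.comp (measurable_const.sub measurable_id)).aestronglyMeasurable
        (Eventually.of_forall fun w => ?_)
      by_cases hw : y - w ∈ Q <;> simp [hχ, hw]
    simp only [sub_mul]
    rw [integral_sub hi (hφi.const_mul _), integral_const_mul, h.cancel τ hτ, mul_zero, sub_zero,
      ← integral_indicator hQm, ← integral_sub_left_eq_self (μ := volume)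
        (fun x => Q.indicator (translateKernel φ (y, τ)) x) y]
    refine integral_congr_ae (Eventually.of_forall fun w => ?_)
    by_cases hw : y - w ∈ Q <;> simp [hχ, hw, translateKernel]
  have e2 : ∀ w, ∫⁻ y, ENNReal.ofReal |χ (y - w) - χ y| ≤
      ENNReal.ofReal (2 * N * l ^ N * √(‖w‖ / l)) := by
    intro w
    calc ∫⁻ y, ENNReal.ofReal |χ (y - w) - χ y|
        ≤ ∫⁻ y, ((Q \ {y | y - w ∈ Q}).indicator 1 y + ({y | y - w ∈ Q} \ Q).indicator 1 y) := by
          refine lintegral_mono fun y => ?_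
          by_cases h1 : y ∈ Q <;> by_cases h2 : y - w ∈ Q <;> simp [hχ, h1, h2]
      _ = volume (Q \ {y | y - w ∈ Q}) + volume ({y | y - w ∈ Q} \ Q) := by
          rw [lintegral_add_left (measurable_one.indicator (hQm.diff (hQw w))),
            lintegral_indicator_one (hQm.diff (hQw w)), lintegral_indicator_one ((hQw w).diff hQm)]
      _ ≤ _ := add_le_add (volume_dcube_diff_translate_le hN t m z w)
          (volume_translate_dcube_diff_le hN t m z w)
      _ = _ := by
          rw [← ENNReal.ofReal_add (by positivity) (by positivity)]
          congr 1
          ring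
  have hm2 : Measurable (Function.uncurry fun y w =>
      ENNReal.ofReal |χ (y - w) - χ y| * ENNReal.ofReal |φ w τ|) := by
    have h1 : Measurable fun q : (Fin N → ℝ) × (Fin N → ℝ) => χ (q.1 - q.2) - χ q.1 :=
      (hχm.comp (measurable_fst.sub measurable_snd)).sub (hχm.comp measurable_fst)
    have h2 : Measurable fun q : (Fin N → ℝ) × (Fin N → ℝ) => φ q.2 τ := hφm.comp measurable_snd
    exact (measurable_norm.comp h1).ennreal_ofReal.mul (measurable_norm.comp h2).ennreal_ofReal
  have hχw : ∀ w, Measurable fun y => ENNReal.ofReal |χ (y - w) - χ y| := fun w =>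
    (measurable_norm.comp ((hχm.comp (measurable_id.sub_const w)).sub hχm)).ennreal_ofReal
  have hm3 : Measurable fun w : Fin N → ℝ =>
      ENNReal.ofReal (1 / ((τ + ‖w‖) ^ N * √(τ + ‖w‖))) := by fun_prop
  calc _ ≤ ∫⁻ y, ∫⁻ w, ENNReal.ofReal (1 / l ^ N) *
        (ENNReal.ofReal |χ (y - w) - χ y| * ENNReal.ofReal |φ w τ|) := by
        refine lintegral_mono fun y => ?_
        rw [lintegral_const_mul _ (hm2.of_uncurry_left (x := y)), avg, e1, div_eq_mul_one_div,
          abs_mul, mul_comm, abs_of_nonneg (by positivity : 0 ≤ 1 / l ^ N),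
          ENNReal.ofReal_mul (by positivity), ← Real.enorm_eq_ofReal_abs]
        gcongr
        refine (enorm_integral_le_lintegral_enorm _).trans_eq (lintegral_congr fun w => ?_)
        rw [Real.enorm_eq_ofReal_abs, abs_mul, ENNReal.ofReal_mul (abs_nonneg _)]
    _ = ∫⁻ w, ∫⁻ y, ENNReal.ofReal (1 / l ^ N) *
        (ENNReal.ofReal |χ (y - w) - χ y| * ENNReal.ofReal |φ w τ|) :=
        lintegral_lintegral_swap (hm2.const_mul _).aemeasurable
    _ = ∫⁻ w, ENNReal.ofReal (1 / l ^ N) *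
        ((∫⁻ y, ENNReal.ofReal |χ (y - w) - χ y|) * ENNReal.ofReal |φ w τ|) := by
        refine lintegral_congr fun w => ?_
        rw [lintegral_const_mul _ ((hχw w).mul_const _), lintegral_mul_const _ (hχw w)]
    _ ≤ ∫⁻ w, ENNReal.ofReal (2 * N * A / √l) *
        ENNReal.ofReal (1 / ((τ + ‖w‖) ^ N * √(τ + ‖w‖))) := by
        refine lintegral_mono fun w => ?_
        have hs : 0 < τ + ‖w‖ := by positivity
        calc _ ≤ ENNReal.ofReal (1 / l ^ N) * (ENNReal.ofReal (2 * N * l ^ N * √(‖w‖ / l)) *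
              ENNReal.ofReal (A / (τ + ‖w‖) ^ (N + 1))) := by
              gcongr
              · exact e2 w
              · exact h.size w τ hτ
          _ = ENNReal.ofReal (1 / l ^ N * (2 * N * l ^ N * √(‖w‖ / l) *
              (A / (τ + ‖w‖) ^ (N + 1)))) := by
              rw [← ENNReal.ofReal_mul (by positivity), ← ENNReal.ofReal_mul (by positivity)]
          _ ≤ _ := by
              rw [← ENNReal.ofReal_mul (by positivity)]
              refine ENNReal.ofReal_le_ofReal ?_
              have h1 : √(‖w‖ / l) ≤ √(τ + ‖w‖) / √l := by
                rw [← Real.sqrt_div hs.le]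
                gcongr
                linarith
              calc _ ≤ 1 / l ^ N * (2 * N * l ^ N * (√(τ + ‖w‖) / √l) *
                    (A / (τ + ‖w‖) ^ (N + 1))) := by gcongr
                _ = _ := by
                    have h2 : 0 < √(τ + ‖w‖) := Real.sqrt_pos.2 hs
                    have h3 : τ + ‖w‖ = √(τ + ‖w‖) * √(τ + ‖w‖) := (Real.mul_self_sqrt hs.le).symm
                    have h4 : 0 < √l := Real.sqrt_pos.2 hl
                    rw [pow_succ (τ + ‖w‖) N]
                    nth_rewrite 3 [h3]
                    field_simp
    _ = _ := by
        rw [lintegral_const_mul _ hm3, lintegral_tail hτ, ← mul_assoc,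
          ← ENNReal.ofReal_mul (by positivity)]
        congr 2
        field_simp

end IsKernel

/-- The integer `κ` with `2 ^ κ ≤ τ < 2 ^ (κ + 1)`. -/
def scale (τ : ℝ) : ℤ := ⌊Real.logb 2 τ⌋

lemma measurable_scale : Measurable scale :=
  (Real.measurable_log.div_const _).floor

lemma zpow_scale_le {τ : ℝ} (hτ : 0 < τ) : (2 : ℝ) ^ scale τ ≤ τ := by
  rw [← Real.rpow_intCast, ← Real.le_logb_iff_rpow_le one_lt_two hτ]
  exact Int.floor_le _

lemma lt_zpow_scale {τ : ℝ} (hτ : 0 < τ) : τ < (2 : ℝ) ^ (scale τ + 1) := by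
  rw [← Real.rpow_intCast, ← Real.logb_lt_iff_lt_rpow one_lt_two hτ]
  push_cast
  exact Int.lt_floor_add_one _

/-- The fourth root of `1/2`. -/
def rho : ℝ := √√(1 / 2)

lemma rho_pos : 0 < rho := by unfold rho; positivity

lemma rho_pow_four : rho ^ 4 = 1 / 2 := by
  rw [show 4 = 2 * 2 by rfl, pow_mul, rho, Real.sq_sqrt (by positivity),
    Real.sq_sqrt (by positivity)]

lemma rho_lt_one : rho < 1 := by
  by_contra! h
  have := one_le_pow₀ (n := 4) h
  rw [rho_pow_four] at this
  norm_num at this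

/-- The decay `ρ ^ |m|`. -/
def decay (m : ℤ) : ℝ := rho ^ m.natAbs

lemma decay_pos (m : ℤ) : 0 < decay m := pow_pos rho_pos _

lemma decay_sq_sq (m : ℤ) : (decay m ^ 2) ^ 2 = ((2 : ℝ) ^ m.natAbs)⁻¹ := by
  rw [decay, ← pow_mul, ← pow_mul, mul_comm, pow_mul, show 2 * 2 = 4 by rfl,
    rho_pow_four, one_div, inv_pow]

lemma decay_le_one (m : ℤ) : decay m ≤ 1 := pow_le_one₀ rho_pos.le rho_lt_one.le

/-- The sum of the decay factors over all integers. -/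
def decaySum : ℝ≥0∞ := ∑' m : ℤ, ENNReal.ofReal (decay m)

lemma decaySum_ne_top : decaySum ≠ ∞ := by
  have h : Summable decay := by
    have h1 := summable_geometric_of_lt_one rho_pos.le rho_lt_one
    refine Summable.of_nat_of_neg ?_ ?_ <;> simpa [decay] using h1
  exact h.tsum_ofReal_ne_top

lemma tsum_decay_sub (k : ℤ) : ∑' m : ℤ, ENNReal.ofReal (decay (k - m)) = decaySum :=
  (Equiv.subLeft k).tsum_eq fun m => ENNReal.ofReal (decay m)

lemma tsum_nat_decay_le (j l : ℤ) :
    ∑' i : ℕ, ENNReal.ofReal (decay (j - i - l)) ≤ decaySum :=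
  ENNReal.tsum_comp_le_tsum_of_injective (f := fun i : ℕ => j - i - l)
    (fun a b hab => by simpa using hab) fun m => ENNReal.ofReal (decay m)

namespace IsKernel

variable {φ : (Fin N → ℝ) → ℝ → ℝ} {A : ℝ}

lemma exists_lintegral_abs_mdiff_le (h : IsKernel φ A) (hN : 0 < N) :
    ∃ C : ℝ≥0∞, C ≠ ∞ ∧ ∀ (t : Fin N → ℝ) (k : ℤ) (z : Fin N → ℝ) (τ : ℝ), 0 < τ →
      ∫⁻ y, ENNReal.ofReal |mdiff (fun _ => t) k (translateKernel φ (y, τ)) z| ≤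
        C * ENNReal.ofReal (decay (k - scale τ) ^ 2 / τ) := by
  have hA := h.const_nonneg
  obtain ⟨C, hC, hP⟩ := h.exists_mul_abs_mdiff_le
  refine ⟨ENNReal.ofReal C * bumpMass N + ENNReal.ofReal (8 * N * A) * tailMass N,
    ENNReal.add_ne_top.2 ⟨ENNReal.mul_ne_top ENNReal.ofReal_ne_top (bumpMass_ne_top N),
      ENNReal.mul_ne_top ENNReal.ofReal_ne_top (tailMass_ne_top N)⟩, fun t k z τ hτ => ?_⟩
  have hd := decay_pos (k - scale τ)
  have hd2 := decay_sq_sq (k - scale τ)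
  set d := decay (k - scale τ) ^ 2 with hdd
  have hd0 : 0 < d := by positivity
  have hd1 : d ≤ 1 := pow_le_one₀ hd.le (decay_le_one _)
  have hs1 := zpow_scale_le hτ
  have hs2 := lt_zpow_scale hτ
  have hl : (0 : ℝ) < 2 ^ k := by positivity
  rcases le_or_gt k (scale τ) with hk | hk
  · have hle : (2 : ℝ) ^ k / τ ≤ d := by
      have e : ((2 : ℝ) ^ (k - scale τ).natAbs)⁻¹ = 2 ^ k / 2 ^ scale τ := by
        rw [← zpow_natCast, ← zpow_neg, ← zpow_sub₀ two_ne_zero]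
        congr 1
        lia
      calc (2 : ℝ) ^ k / τ ≤ 2 ^ k / 2 ^ scale τ := by gcongr
        _ = d ^ 2 := by rw [hd2, e]
        _ ≤ d := by nlinarith
    calc _ ≤ ∫⁻ y, ENNReal.ofReal (C * (d / τ)) * ENNReal.ofReal (bump N τ ‖y - z‖) := by
          refine lintegral_mono fun y => ?_
          have h1 := hP t k (y, τ) z hτ
          dsimp only at h1
          rw [← ENNReal.ofReal_mul (by positivity)]
          refine ENNReal.ofReal_le_ofReal ?_
          rw [mul_comm, ← le_div_iff₀ hτ] at h1
          refine h1.trans ?_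
          calc _ ≤ C * (2 ^ k / (τ + ‖y - z‖) ^ (N + 1)) / τ := by
                gcongr
                linarith
            _ = C * ((2 ^ k / τ) / τ) * (τ / (τ + ‖y - z‖) ^ (N + 1)) := by
                field_simp
            _ ≤ C * (d / τ) * (τ / (τ + ‖y - z‖) ^ (N + 1)) := by gcongr
      _ = ENNReal.ofReal C * bumpMass N * ENNReal.ofReal (d / τ) := by
          rw [lintegral_const_mul _ (by unfold bump; fun_prop), lintegral_bump_sub hτ,
            ENNReal.ofReal_mul hC]
          ring
      _ ≤ _ := by gcongr; exact le_self_add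
  · have hle : √τ ≤ 2 * d * √((2 : ℝ) ^ (k - 1)) := by
      rw [Real.sqrt_le_left (by positivity), mul_pow, mul_pow, hd2, Real.sq_sqrt (by positivity)]
      have e : ((2 : ℝ) ^ (k - scale τ).natAbs)⁻¹ = 2 ^ scale τ / 2 ^ k := by
        rw [← zpow_natCast, ← zpow_neg, ← zpow_sub₀ two_ne_zero]
        congr 1
        lia
      rw [e, zpow_sub_one₀ two_ne_zero]
      rw [zpow_add_one₀ two_ne_zero] at hs2
      calc τ ≤ 2 ^ scale τ * 2 := hs2.le
        _ = _ := by field_simp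
    have hm : ∀ j, Measurable fun y => ENNReal.ofReal |avg (fun _ => t) j
        (translateKernel φ (y, τ)) z| := by
      intro j
      have h1 := (measurable_uncurry_avg t j h.measurable_translateKernel).of_uncurry_right (y := z)
      have h2 := h1.comp (measurable_prodMk_right (y := τ))
      exact (measurable_norm.comp h2).ennreal_ofReal
    have hb : ∀ j, k - 1 ≤ j → j ≤ k →
        ∫⁻ y, ENNReal.ofReal |avg (fun _ => t) j (translateKernel φ (y, τ)) z| ≤
          ENNReal.ofReal (4 * N * A * (d / τ)) * tailMass N := by
      intro j hj1 hj2
      refine (h.lintegral_abs_avg_le hN t j hτ z).trans ?_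
      refine mul_le_mul_left (ENNReal.ofReal_le_ofReal ?_) _
      have h3 : √((2 : ℝ) ^ (k - 1)) ≤ √((2 : ℝ) ^ j) := by
        gcongr
        norm_num
      have h4 : 0 < √((2 : ℝ) ^ j) := by positivity
      have h5 : 0 < √τ := Real.sqrt_pos.2 hτ
      have h6 : √τ ≤ 2 * d * √((2 : ℝ) ^ j) := hle.trans (by gcongr)
      rw [div_le_iff₀ (by positivity)]
      have h7 : τ = √τ * √τ := (Real.mul_self_sqrt hτ.le).symm
      calc 2 * N * A = 2 * N * A * (√τ * √τ) / τ := by rw [← h7]; field_simp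
        _ ≤ 2 * N * A * (√τ * (2 * d * √((2 : ℝ) ^ j))) / τ := by gcongr
        _ = _ := by ring
    calc _ ≤ ∫⁻ y, (ENNReal.ofReal |avg (fun _ => t) (k - 1) (translateKernel φ (y, τ)) z| +
          ENNReal.ofReal |avg (fun _ => t) k (translateKernel φ (y, τ)) z|) := by
          refine lintegral_mono fun y => ?_
          rw [← ENNReal.ofReal_add (abs_nonneg _) (abs_nonneg _)]
          exact ENNReal.ofReal_le_ofReal (abs_sub _ _)
      _ ≤ ENNReal.ofReal (4 * N * A * (d / τ)) * tailMass N +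
          ENNReal.ofReal (4 * N * A * (d / τ)) * tailMass N := by
          rw [lintegral_add_left (hm _)]
          exact add_le_add (hb _ le_rfl (by lia)) (hb _ (by lia) le_rfl)
      _ = ENNReal.ofReal (8 * N * A) * tailMass N * ENNReal.ofReal (d / τ) := by
          rw [← add_mul, ← ENNReal.ofReal_add (by positivity) (by positivity),
            mul_right_comm (ENNReal.ofReal (8 * N * A)),
            ← ENNReal.ofReal_mul (by positivity)]
          congr 2
          ring
      _ ≤ _ := by gcongr; exact le_add_self

end IsKernel

end KernelIntegrals

/-! ### The one-parameter square function estimate -/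

section OneParameter

variable {N : ℕ}

/-- The density of the measure defining the Lusin square function on the cone over `x`. -/
def coneWeight (N : ℕ) (x : Fin N → ℝ) (p : (Fin N → ℝ) × ℝ) : ℝ≥0∞ :=
  {q : (Fin N → ℝ) × ((Fin N → ℝ) × ℝ) | √(∑ i, (q.2.1 i - q.1 i) ^ 2) < q.2.2}.indicator
    (fun q => ENNReal.ofReal (q.2.2 ^ (1 - (N : ℝ)))) (x, p)

lemma measurable_coneWeight : Measurable (Function.uncurry (coneWeight N)) := by
  refine Measurable.indicator (by fun_prop) (measurableSet_lt ?_ (by fun_prop))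
  refine Real.continuous_sqrt.measurable.comp (Finset.measurable_sum _ fun i _ => ?_)
  exact (((measurable_pi_apply i).comp measurable_snd.fst).sub
    ((measurable_pi_apply i).comp measurable_fst)).pow_const 2

lemma norm_sub_le_sqrt_sum (x y : Fin N → ℝ) : ‖y - x‖ ≤ √(∑ i, (y i - x i) ^ 2) := by
  refine (pi_norm_le_iff_of_nonneg (Real.sqrt_nonneg _)).2 fun i => ?_
  refine Real.abs_le_sqrt ?_
  exact Finset.single_le_sum (f := fun i => (y i - x i) ^ 2) (fun _ _ => sq_nonneg _)
    (Finset.mem_univ i)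

lemma lt_of_coneWeight_ne_zero {x : Fin N → ℝ} {p : (Fin N → ℝ) × ℝ}
    (h : coneWeight N x p ≠ 0) : ‖p.1 - x‖ < p.2 :=
  (norm_sub_le_sqrt_sum x p.1).trans_lt <| show (x, p) ∈
      {q : (Fin N → ℝ) × ((Fin N → ℝ) × ℝ) | √(∑ i, (q.2.1 i - q.1 i) ^ 2) < q.2.2} from
    Set.mem_of_indicator_ne_zero h

lemma lintegral_coneWeight_le (p : (Fin N → ℝ) × ℝ) :
    ∫⁻ x, coneWeight N x p ≤ 2 ^ N * ENNReal.ofReal p.2 := by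
  rcases le_or_gt p.2 0 with hp | hp
  · have : ∀ x, coneWeight N x p = 0 := fun x => by
      by_contra h
      exact absurd (lt_of_coneWeight_ne_zero h) (by linarith [norm_nonneg (p.1 - x)])
    simp [this]
  · calc ∫⁻ x, coneWeight N x p
        ≤ ∫⁻ x, (Metric.closedBall p.1 p.2).indicator
            (fun _ => ENNReal.ofReal (p.2 ^ (1 - (N : ℝ)))) x := by
          refine lintegral_mono fun x => ?_
          by_cases h : coneWeight N x p = 0
          · rw [h]; exact zero_le
          · have h1 := lt_of_coneWeight_ne_zero h
            rw [Set.indicator_of_mem (by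
              rw [Metric.mem_closedBall, dist_comm, dist_eq_norm]; exact h1.le)]
            exact Set.indicator_le_self _ _ _
      _ = ENNReal.ofReal (p.2 ^ (1 - (N : ℝ))) * ENNReal.ofReal ((2 * p.2) ^ N) := by
          rw [lintegral_indicator_const measurableSet_closedBall, Real.volume_pi_closedBall _ hp.le,
            Fintype.card_fin]
      _ = _ := by
          rw [← ENNReal.ofReal_mul (by positivity), Real.rpow_sub hp, Real.rpow_one,
            Real.rpow_natCast, mul_pow]
          have : p.2 / p.2 ^ N * (2 ^ N * p.2 ^ N) = 2 ^ N * p.2 := by field_simp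
          rw [this, ENNReal.ofReal_mul (by positivity), ENNReal.ofReal_pow (by norm_num)]
          norm_num

lemma setLIntegral_decay_div_le (k : ℤ) :
    ∫⁻ τ in Set.Ioi (0 : ℝ), ENNReal.ofReal (decay (k - scale τ) / τ) ≤ decaySum := by
  rw [← lintegral_indicator measurableSet_Ioi]
  calc _ ≤ ∫⁻ τ : ℝ, ∑' m : ℤ, (Set.Icc ((2 : ℝ) ^ m) (2 ^ (m + 1))).indicator
        (fun _ => ENNReal.ofReal (decay (k - m) / 2 ^ m)) τ := by
        refine lintegral_mono fun τ => ?_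
        by_cases hτ : τ ∈ Set.Ioi (0 : ℝ)
        · rw [Set.indicator_of_mem hτ]
          refine le_trans ?_ (ENNReal.le_tsum (scale τ))
          rw [Set.indicator_of_mem (Set.mem_Icc.2 ⟨zpow_scale_le hτ, (lt_zpow_scale hτ).le⟩)]
          refine ENNReal.ofReal_le_ofReal ?_
          have := decay_pos (k - scale τ)
          have := zpow_scale_le hτ
          gcongr
        · rw [Set.indicator_of_notMem hτ]
          exact zero_le
    _ = ∑' m : ℤ, ENNReal.ofReal (decay (k - m)) := by
        rw [lintegral_tsum fun m => (measurable_const.indicator measurableSet_Icc).aemeasurable]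
        refine tsum_congr fun m => ?_
        have h2 : (0 : ℝ) < 2 ^ m := by positivity
        rw [lintegral_indicator_const measurableSet_Icc, Real.volume_Icc, zpow_add_one₀ two_ne_zero,
          ← ENNReal.ofReal_mul (div_nonneg (decay_pos _).le h2.le)]
        congr 1
        field_simp
        ring
    _ = decaySum := tsum_decay_sub k

namespace IsKernel

variable {φ : (Fin N → ℝ) → ℝ → ℝ} {A : ℝ}

/-- The absolute value of the martingale differences of the translated kernels. -/
def mdiffKernel (φ : (Fin N → ℝ) → ℝ → ℝ) (t : Fin N → ℝ) (k : ℤ) (p : (Fin N → ℝ) × ℝ)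
    (z : Fin N → ℝ) : ℝ≥0∞ :=
  ENNReal.ofReal |mdiff (fun _ => t) k (translateKernel φ p) z|

lemma measurable_mdiffKernel (h : IsKernel φ A) (t : Fin N → ℝ) (k : ℤ) :
    Measurable (Function.uncurry (mdiffKernel φ t k)) :=
  (measurable_norm.comp
    (measurable_uncurry_mdiff t k h.measurable_translateKernel)).ennreal_ofReal

/-- The one-parameter inequality: the martingale differences of a kernel define an operator
that is bounded from the dyadic to the Lusin square function. -/
theorem exists_isSquareBounded (h : IsKernel φ A) (hN : 0 < N) : ∃ K : ℝ≥0∞, K ≠ ∞ ∧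
    ∀ t : Fin N → ℝ, IsSquareBounded volume volume (coneWeight N) (mdiffKernel φ t)
      (fun k z z' => z' ∈ dcube t (k - 1) z) K := by
  obtain ⟨C, hC, hP⟩ := h.exists_mul_abs_mdiff_le
  obtain ⟨C', hC', hQ⟩ := h.exists_lintegral_abs_mdiff_le hN
  set b : ℝ := C * (3 ^ (N + 1) * ((bumpMass N).toReal + 2)) with hb
  have hM0 : 0 ≤ (bumpMass N).toReal := ENNReal.toReal_nonneg
  have hb0 : 0 ≤ b := by positivity
  set C₁ : ℝ≥0∞ := 2 ^ N * C' * decaySum + 1 with hC₁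
  set C₂ : ℝ≥0∞ := ENNReal.ofReal b * decaySum * bumpMass N + 1 with hC₂
  have hC₁t : C₁ ≠ ∞ := ENNReal.add_ne_top.2
    ⟨ENNReal.mul_ne_top (ENNReal.mul_ne_top (by simp) hC') decaySum_ne_top, by simp⟩
  have hC₂t : C₂ ≠ ∞ := ENNReal.add_ne_top.2
    ⟨ENNReal.mul_ne_top (ENNReal.mul_ne_top (by simp) decaySum_ne_top) (bumpMass_ne_top N),
      by simp⟩
  refine ⟨(2 * C₁ * C₂) ^ (1 / 2 : ℝ), ENNReal.rpow_ne_top_of_nonneg (by norm_num)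
    (ENNReal.mul_ne_top (ENNReal.mul_ne_top (by simp) hC₁t) hC₂t), fun t => ?_⟩
  have hwm : ∀ k : ℤ, Measurable fun p : (Fin N → ℝ) × ℝ =>
      ENNReal.ofReal (p.2 * decay (k - scale p.2)) := fun k =>
    (measurable_snd.mul ((measurable_of_countable fun m : ℤ => decay (k - m)).comp
      (measurable_scale.comp measurable_snd))).ennreal_ofReal
  have hwinv : ∀ (k : ℤ) (p : (Fin N → ℝ) × ℝ), 0 < p.2 →
      ENNReal.ofReal p.2 * (ENNReal.ofReal (p.2 * decay (k - scale p.2)))⁻¹ =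
        ENNReal.ofReal (decay (k - scale p.2))⁻¹ := by
    intro k p hp
    have hd := decay_pos (k - scale p.2)
    rw [← ENNReal.ofReal_inv_of_pos (by positivity), ← ENNReal.ofReal_mul hp.le]
    congr 1
    field_simp
  intro G hG hGr
  refine lintegral_sqrt_schur volume volume measurable_coneWeight
    (w := fun k p => ENNReal.ofReal (p.2 * decay (k - scale p.2)))
    (a := fun j x z => ENNReal.ofReal b * decaySum *
      ENNReal.ofReal (bump N (2 ^ (j - 1)) ‖x - z‖))
    (r := fun k z z' => z' ∈ dcube t (k - 1) z) (C₁ := C₁) (C₂ := C₂)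
    hwm ?_ (h.measurable_mdiffKernel t) ?_ ?_ (by simp [hC₁]) (by simp [hC₂]) ?_ ?_ ?_ hG hGr
  · intro k x p hc
    have hp : 0 < p.2 := (norm_nonneg _).trans_lt (lt_of_coneWeight_ne_zero hc)
    have := decay_pos (k - scale p.2)
    exact ⟨by rw [Ne, ENNReal.ofReal_eq_zero, not_le]; positivity, ENNReal.ofReal_ne_top⟩
  · intro k
    refine Measurable.const_mul ?_ _
    unfold bump
    fun_prop
  · intro k l z z' hkl hz
    exact dcube_mono t (by lia) z hz
  · intro k z
    have hBz : Measurable fun p => mdiffKernel φ t k p z :=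
      (h.measurable_mdiffKernel t k).of_uncurry_right
    calc _ = ∫⁻ p, ∫⁻ x, coneWeight N x p *
          ((ENNReal.ofReal (p.2 * decay (k - scale p.2)))⁻¹ * mdiffKernel φ t k p z) := by
          refine lintegral_lintegral_swap (Measurable.aemeasurable ?_)
          exact measurable_coneWeight.mul (((hwm k).inv.mul hBz).comp measurable_snd)
      _ ≤ ∫⁻ p : (Fin N → ℝ) × ℝ, (Set.Ioi (0 : ℝ)).indicator (fun τ =>
            2 ^ N * ENNReal.ofReal (decay (k - scale τ))⁻¹) p.2 * mdiffKernel φ t k p z := by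
          refine lintegral_mono fun p => ?_
          rw [lintegral_mul_const _ measurable_coneWeight.of_uncurry_right]
          refine (mul_le_mul_left (lintegral_coneWeight_le p) _).trans ?_
          rcases le_or_gt p.2 0 with hp | hp
          · simp [ENNReal.ofReal_of_nonpos hp]
          · rw [Set.indicator_of_mem (Set.mem_Ioi.2 hp), ← hwinv k p hp, mul_assoc, mul_assoc,
              mul_assoc]
      _ = ∫⁻ τ, ∫⁻ y, (Set.Ioi (0 : ℝ)).indicator (fun τ =>
            2 ^ N * ENNReal.ofReal (decay (k - scale τ))⁻¹) τ * mdiffKernel φ t k (y, τ) z := by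
          refine lintegral_prod_symm' _ (Measurable.mul ?_ hBz)
          refine (Measurable.indicator ?_ measurableSet_Ioi).comp measurable_snd
          exact ((measurable_of_countable fun m : ℤ =>
            ENNReal.ofReal (decay (k - m))⁻¹).comp measurable_scale).const_mul _
      _ ≤ ∫⁻ τ, (Set.Ioi (0 : ℝ)).indicator (fun τ =>
            2 ^ N * C' * ENNReal.ofReal (decay (k - scale τ) / τ)) τ := by
          refine lintegral_mono fun τ => ?_
          have h1 : Measurable fun y => mdiffKernel φ t k (y, τ) z :=
            hBz.comp (measurable_prodMk_right (y := τ))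
          rw [lintegral_const_mul _ h1]
          by_cases hτ : τ ∈ Set.Ioi (0 : ℝ)
          · rw [Set.indicator_of_mem hτ, Set.indicator_of_mem hτ]
            have hτ' : 0 < τ := hτ
            have hd := decay_pos (k - scale τ)
            calc _ ≤ 2 ^ N * ENNReal.ofReal (decay (k - scale τ))⁻¹ *
                  (C' * ENNReal.ofReal (decay (k - scale τ) ^ 2 / τ)) := by
                  gcongr; exact hQ t k z τ hτ
              _ = 2 ^ N * C' * (ENNReal.ofReal (decay (k - scale τ))⁻¹ *
                  ENNReal.ofReal (decay (k - scale τ) ^ 2 / τ)) := by ring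
              _ = _ := by
                  rw [← ENNReal.ofReal_mul (by positivity)]
                  congr 2
                  field_simp
          · simp [Set.indicator_of_notMem hτ]
      _ = 2 ^ N * C' * ∫⁻ τ in Set.Ioi (0 : ℝ), ENNReal.ofReal (decay (k - scale τ) / τ) := by
          rw [lintegral_indicator measurableSet_Ioi, lintegral_const_mul]
          exact (((measurable_of_countable fun m : ℤ => decay (k - m)).comp
            measurable_scale).div measurable_id).ennreal_ofReal
      _ ≤ 2 ^ N * C' * decaySum := by gcongr; exact setLIntegral_decay_div_le k
      _ ≤ C₁ := le_self_add
  · intro j D hD hDr x p hc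
    have hxp := lt_of_coneWeight_ne_zero hc
    have hp : 0 < p.2 := (norm_nonneg _).trans_lt hxp
    have hterm : ∀ i : ℕ, ENNReal.ofReal (p.2 * decay (j - i - scale p.2)) *
        ∫⁻ z, mdiffKernel φ t (j - i) p z * D z ≤ ENNReal.ofReal (decay (j - i - scale p.2)) *
          (ENNReal.ofReal b * ∫⁻ z, ENNReal.ofReal (bump N (2 ^ (j - 1)) ‖x - z‖) * D z) := by
      intro i
      have hs : (0 : ℝ) < 2 ^ (j - i) := by positivity
      have hs2 : (2 : ℝ) ^ (j - i) ≤ 2 * 2 ^ (j - 1) := by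
        rw [← zpow_one_add₀ two_ne_zero]
        gcongr
        · norm_num
        · lia
      have hd := decay_pos (j - i - scale p.2)
      have hbm : ∀ s : ℝ, Measurable fun z : Fin N → ℝ => ENNReal.ofReal (bump N s ‖x - z‖) := by
        intro s
        unfold bump; fun_prop
      have hbD : ∀ s : ℝ, Measurable fun z => ENNReal.ofReal (bump N s ‖x - z‖) * D z :=
        fun s => (hbm s).mul hD
      rw [mul_comm p.2, ENNReal.ofReal_mul hd.le, mul_assoc]
      refine mul_le_mul_right ?_ _
      have hBD : Measurable fun z => mdiffKernel φ t (j - i) p z * D z :=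
        (h.measurable_mdiffKernel t _).of_uncurry_left.mul hD
      calc _ = ∫⁻ z, ENNReal.ofReal p.2 * mdiffKernel φ t (j - i) p z * D z := by
            rw [← lintegral_const_mul _ hBD]
            simp only [mul_assoc]
        _ ≤ ∫⁻ z, ENNReal.ofReal C *
            (ENNReal.ofReal (bump N (2 ^ (j - i : ℤ)) ‖x - z‖) * D z) := by
            refine lintegral_mono fun z => ?_
            rw [← mul_assoc]
            refine mul_le_mul_left ?_ _
            rw [mdiffKernel, ← ENNReal.ofReal_mul hp.le, ← ENNReal.ofReal_mul hC]
            refine ENNReal.ofReal_le_ofReal ((hP t (j - i) p z hp).trans ?_)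
            unfold bump
            have h1 : ‖x - z‖ ≤ p.2 + ‖p.1 - z‖ := by
              have := norm_sub_le_norm_sub_add_norm_sub x p.1 z
              rw [norm_sub_rev x p.1] at this
              linarith
            gcongr ?_ * (_ / ?_ ^ _)
            linarith
        _ = ENNReal.ofReal C *
            ∫⁻ z, ENNReal.ofReal (bump N (2 ^ (j - i : ℤ)) ‖x - z‖) * D z :=
            lintegral_const_mul _ (hbD _)
        _ ≤ ENNReal.ofReal C * ∫⁻ z, ENNReal.ofReal
            (3 ^ (N + 1) * ((bumpMass N).toReal + 2) * bump N (2 ^ (j - 1)) ‖x - z‖) * D z := by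
            refine mul_le_mul_right ?_ _
            exact lintegral_bump_mul_le t (j - 1) hs hs2 x hD hDr
        _ = _ := by
            rw [hb, ENNReal.ofReal_mul hC, mul_assoc,
              ← lintegral_const_mul _ (hbD _)]
            congr 1
            refine lintegral_congr fun z => ?_
            rw [ENNReal.ofReal_mul (by positivity), mul_assoc]
    calc _ ≤ ∑' i : ℕ, ENNReal.ofReal (decay (j - i - scale p.2)) *
          (ENNReal.ofReal b * ∫⁻ z, ENNReal.ofReal (bump N (2 ^ (j - 1)) ‖x - z‖) * D z) :=
          ENNReal.tsum_le_tsum hterm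
      _ ≤ decaySum *
          (ENNReal.ofReal b * ∫⁻ z, ENNReal.ofReal (bump N (2 ^ (j - 1)) ‖x - z‖) * D z) := by
          rw [ENNReal.tsum_mul_right]
          gcongr
          exact tsum_nat_decay_le j _
      _ = _ := by
          rw [← mul_assoc, mul_comm decaySum, ← lintegral_const_mul]
          · simp only [mul_assoc]
          · refine Measurable.mul ?_ hD
            unfold bump; fun_prop
  · intro j z
    rw [lintegral_const_mul _ (by unfold bump; fun_prop), lintegral_bump_sub (by positivity)]
    exact le_self_add

end IsKernel

end OneParameter

/-! ### Homogeneous functions -/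

section Homogeneous

variable {E F : Type*} [NormedAddCommGroup E] [NormedSpace ℝ E] [NormedAddCommGroup F]
  [NormedSpace ℝ F]

/-- Homogeneity of degree `-a` on `E \ {0}`, with respect to positive dilations. -/
def IsHomogeneousNeg (a : ℕ) (g : E → F) : Prop :=
  ∀ s : ℝ, 0 < s → ∀ x : E, x ≠ 0 → s ^ a • g (s • x) = g x

namespace IsHomogeneousNeg

variable {a : ℕ} {g : E → F}

lemma fderiv (h : IsHomogeneousNeg a g) : IsHomogeneousNeg (a + 1) (fderiv ℝ g) := by
  intro s hs x hx
  rw [pow_succ, mul_smul, ← fderiv_comp_smul]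
  have h1 : (fun y => s ^ a • g (s • y)) =ᶠ[𝓝 x] g := by
    filter_upwards [isOpen_ne.mem_nhds hx] with y hy using h s hs y hy
  rw [← h1.fderiv_eq]
  exact (congrFun (fderiv_const_smul_field (𝕜 := ℝ) (s ^ a) (f := fun y => g (s • y))) x).symm

lemma iteratedFDeriv (h : IsHomogeneousNeg a g) (m : ℕ) :
    IsHomogeneousNeg (a + m) (iteratedFDeriv ℝ m g) := by
  induction m with
  | zero =>
    intro s hs x hx
    ext v
    simpa using h s hs x hx
  | succ m ih =>
    intro s hs x hx
    rw [iteratedFDeriv_succ_eq_comp_left, Function.comp_apply, Function.comp_apply,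
      ← LinearIsometryEquiv.map_smul, ← add_assoc, ih.fderiv s hs x hx]

lemma exists_norm_le [FiniteDimensional ℝ E] (h : IsHomogeneousNeg a g)
    (hg : ∀ x ≠ 0, ContinuousAt g x) : ∃ C : ℝ, 0 ≤ C ∧ ∀ x ≠ 0, ‖g x‖ ≤ C / ‖x‖ ^ a := by
  have := FiniteDimensional.proper ℝ E
  obtain ⟨C, hC⟩ := (isCompact_sphere (0 : E) 1).exists_bound_of_continuousOn (f := g)
    fun x hx => (hg x (ne_zero_of_mem_unit_sphere ⟨x, hx⟩)).continuousWithinAt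
  refine ⟨max C 0, le_max_right _ _, fun x hx => ?_⟩
  have hx' : 0 < ‖x‖ := norm_pos_iff.2 hx
  have h1 := h ‖x‖⁻¹ (inv_pos.2 hx') x hx
  have h2 := hC (‖x‖⁻¹ • x) (by simp [norm_smul, hx'.ne'])
  rw [← h1, norm_smul, norm_pow, norm_inv, norm_norm, inv_pow, div_eq_inv_mul]
  gcongr
  exact h2.trans (le_max_left _ _)

end IsHomogeneousNeg

end Homogeneous

/-! ### The Poisson kernel -/

section Poisson

variable {N : ℕ}

/-- The Poisson kernel as a function on `ℝ^N × ℝ`. -/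
def poisson (N : ℕ) (p : (Fin N → ℝ) × ℝ) : ℝ := pk N p.1 p.2

/-- The Poisson kernel divided by the time variable. -/
def poissonQuot (N : ℕ) (p : (Fin N → ℝ) × ℝ) : ℝ :=
  (Real.Gamma (((N : ℝ) + 1) / 2) / Real.pi ^ (((N : ℝ) + 1) / 2)) /
    ((∑ i, p.1 i ^ 2) + p.2 ^ 2) ^ (((N : ℝ) + 1) / 2)

lemma poisson_eq (p : (Fin N → ℝ) × ℝ) : poisson N p = p.2 * poissonQuot N p := by
  unfold poisson pk poissonQuot
  ring

lemma sum_sq_add_sq_pos {p : (Fin N → ℝ) × ℝ} (hp : p ≠ 0) : 0 < (∑ i, p.1 i ^ 2) + p.2 ^ 2 := by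
  have h0 : 0 ≤ ∑ i, p.1 i ^ 2 := by positivity
  by_contra! h
  have h2 : p.2 ^ 2 = 0 := by nlinarith [sq_nonneg p.2]
  have h1 : ∑ i, p.1 i ^ 2 = 0 := by nlinarith
  rw [Finset.sum_eq_zero_iff_of_nonneg fun _ _ => sq_nonneg _] at h1
  exact hp (Prod.ext (funext fun i => pow_eq_zero_iff two_ne_zero |>.1 (h1 i (Finset.mem_univ i)))
    (pow_eq_zero_iff two_ne_zero |>.1 h2))

lemma contDiffAt_poissonQuot {m : WithTop ℕ∞} {p : (Fin N → ℝ) × ℝ} (hp : p ≠ 0) :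
    ContDiffAt ℝ m (poissonQuot N) p := by
  have hq := sum_sq_add_sq_pos hp
  unfold poissonQuot
  refine contDiffAt_const.div (ContDiffAt.rpow_const_of_ne ?_ hq.ne') (Real.rpow_pos_of_pos hq _).ne'
  fun_prop

lemma contDiffAt_poisson {m : WithTop ℕ∞} {p : (Fin N → ℝ) × ℝ} (hp : p ≠ 0) :
    ContDiffAt ℝ m (poisson N) p := by
  have : poisson N = fun p => p.2 * poissonQuot N p := funext poisson_eq
  rw [this]
  exact contDiffAt_snd.mul (contDiffAt_poissonQuot hp)

lemma isHomogeneousNeg_poissonQuot : IsHomogeneousNeg (N + 1) (poissonQuot N) := by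
  intro s hs p hp
  have hq := sum_sq_add_sq_pos hp
  have h1 : (∑ i, (s • p).1 i ^ 2) + (s • p).2 ^ 2 = s ^ 2 * ((∑ i, p.1 i ^ 2) + p.2 ^ 2) := by
    simp only [Prod.smul_fst, Prod.smul_snd, Pi.smul_apply, smul_eq_mul, mul_pow, mul_add,
      Finset.mul_sum]
  have h2 : (s ^ 2) ^ (((N : ℝ) + 1) / 2) = s ^ (N + 1) := by
    rw [← Real.rpow_natCast s 2, ← Real.rpow_mul hs.le, ← Real.rpow_natCast]
    congr 1
    push_cast
    ring
  have h3 : 0 < s ^ (N + 1) := by positivity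
  unfold poissonQuot
  rw [h1, Real.mul_rpow (by positivity) hq.le, h2, smul_eq_mul]
  field_simp

lemma isHomogeneousNeg_poisson : IsHomogeneousNeg N (poisson N) := by
  intro s hs p hp
  rw [poisson_eq, poisson_eq, ← isHomogeneousNeg_poissonQuot s hs p hp, Prod.smul_snd,
    smul_eq_mul, smul_eq_mul, smul_eq_mul]
  ring

lemma exists_norm_iteratedFDeriv_poisson_le (N m : ℕ) : ∃ C : ℝ, 0 ≤ C ∧
    ∀ p ≠ 0, ‖iteratedFDeriv ℝ m (poisson N) p‖ ≤ C / ‖p‖ ^ (N + m) :=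
  (isHomogeneousNeg_poisson.iteratedFDeriv m).exists_norm_le fun _ hp =>
    ((contDiffAt_poisson hp).iteratedFDeriv_right (m := 0) (n := m) (by simp)).continuousAt

lemma add_norm_le_two_mul_norm {y : Fin N → ℝ} {τ : ℝ} (hτ : 0 < τ) :
    τ + ‖y‖ ≤ 2 * ‖((y, τ) : (Fin N → ℝ) × ℝ)‖ := by
  have h1 := le_max_left ‖y‖ ‖τ‖
  have h2 := le_max_right ‖y‖ ‖τ‖
  rw [Prod.norm_mk]
  rw [Real.norm_of_nonneg hτ.le] at *
  linarith

lemma mk_ne_zero {y : Fin N → ℝ} {τ : ℝ} (hτ : 0 < τ) : ((y, τ) : (Fin N → ℝ) × ℝ) ≠ 0 :=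
  fun h => hτ.ne' (congrArg Prod.snd h)

lemma exists_abs_poisson_le (N : ℕ) : ∃ C : ℝ, 0 ≤ C ∧ ∀ (y : Fin N → ℝ) (τ : ℝ), 0 < τ →
    |poisson N (y, τ)| ≤ C * bump N τ ‖y‖ := by
  obtain ⟨C, hC0, hC⟩ := isHomogeneousNeg_poissonQuot.exists_norm_le (g := poissonQuot N)
    fun p hp => (contDiffAt_poissonQuot (m := 0) hp).continuousAt
  refine ⟨C * 2 ^ (N + 1), by positivity, fun y τ hτ => ?_⟩
  have h1 := hC (y, τ) (mk_ne_zero hτ)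
  have h2 := add_norm_le_two_mul_norm (y := y) hτ
  have h3 : 0 < τ + ‖y‖ := by positivity
  rw [poisson_eq, abs_mul, abs_of_pos hτ]
  rw [Real.norm_eq_abs] at h1
  calc τ * |poissonQuot N (y, τ)| ≤ τ * (C / ((τ + ‖y‖) / 2) ^ (N + 1)) := by
        refine mul_le_mul_of_nonneg_left (h1.trans ?_) hτ.le
        gcongr
        linarith
    _ = _ := by
        unfold bump
        rw [div_pow]
        field_simp

lemma measurable_poisson : Measurable (poisson N) := by
  unfold poisson pk
  fun_prop

lemma integrable_bump {s : ℝ} (hs : 0 < s) : Integrable fun y : Fin N → ℝ => bump N s ‖y‖ := by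
  refine ⟨(by unfold bump; fun_prop : Measurable fun y : Fin N → ℝ => bump N s ‖y‖).aestronglyMeasurable, ?_⟩
  rw [hasFiniteIntegral_iff_ofReal (.of_forall fun y => bump_nonneg hs.le (norm_nonneg y)),
    lintegral_bump hs]
  exact (bumpMass_ne_top N).lt_top

lemma integrable_poisson {τ : ℝ} (hτ : 0 < τ) : Integrable fun y : Fin N → ℝ => poisson N (y, τ) := by
  obtain ⟨C, -, hC⟩ := exists_abs_poisson_le N
  exact ((integrable_bump hτ).const_mul C).mono'
    (measurable_poisson.comp measurable_prodMk_right).aestronglyMeasurable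
    (.of_forall fun y => hC y τ hτ)

lemma integral_poisson_eq {τ : ℝ} (hτ : 0 < τ) :
    ∫ y : Fin N → ℝ, poisson N (y, τ) = ∫ y : Fin N → ℝ, poisson N (y, 1) := by
  have h1 : ∀ y : Fin N → ℝ, poisson N (y, 1) = τ ^ N * poisson N (τ • y, τ) := fun y => by
    rw [← isHomogeneousNeg_poisson τ hτ (y, 1) (mk_ne_zero one_pos), smul_eq_mul, Prod.smul_mk,
      smul_eq_mul, mul_one]
  simp_rw [h1]
  rw [integral_const_mul, Measure.integral_comp_smul_of_nonneg volume
    (fun y : Fin N → ℝ => poisson N (y, τ)) τ (hR := hτ.le)]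
  rw [Module.finrank_fin_fun, smul_eq_mul, ← mul_assoc, mul_inv_cancel₀ (by positivity), one_mul]

end Poisson

/-! ### Derivatives of the Poisson kernel -/

section PoissonDeriv

variable {N : ℕ}

/-- The coordinate directions of `ℝ^N × ℝ`; the last one is the time direction. -/
def dirVec (N : ℕ) (d : Fin (N + 1)) : (Fin N → ℝ) × ℝ :=
  if h : (d : ℕ) < N then (Pi.single (⟨d, h⟩ : Fin N) 1, 0) else (0, 1)

lemma norm_dirVec_le (d : Fin (N + 1)) : ‖dirVec N d‖ ≤ 1 := by
  unfold dirVec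
  split_ifs with h
  · simp [Prod.norm_mk, Pi.norm_single]
  · simp [Prod.norm_mk]

/-- A first order partial derivative of the Poisson kernel. -/
def poissonDeriv (N : ℕ) (d : Fin (N + 1)) (y : Fin N → ℝ) (τ : ℝ) : ℝ :=
  fderiv ℝ (poisson N) (y, τ) (dirVec N d)

lemma exists_abs_poissonDeriv_le (N : ℕ) : ∃ A : ℝ, 0 ≤ A ∧
    ∀ (d : Fin (N + 1)) (y : Fin N → ℝ) (τ : ℝ), 0 < τ →
      |poissonDeriv N d y τ| ≤ A / (τ + ‖y‖) ^ (N + 1) := by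
  obtain ⟨C, hC0, hC⟩ := isHomogeneousNeg_poisson.fderiv.exists_norm_le (g := fderiv ℝ (poisson N))
    fun p hp => (contDiffAt_poisson (m := 1) hp).continuousAt_fderiv one_ne_zero
  refine ⟨C * 2 ^ (N + 1), by positivity, fun d y τ hτ => ?_⟩
  have h1 := hC (y, τ) (mk_ne_zero hτ)
  have h2 := add_norm_le_two_mul_norm (y := y) hτ
  have h3 : 0 < τ + ‖y‖ := by positivity
  calc |poissonDeriv N d y τ| ≤ ‖fderiv ℝ (poisson N) (y, τ)‖ * 1 :=
        (fderiv ℝ (poisson N) (y, τ)).le_opNorm_of_le (norm_dirVec_le d)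
    _ ≤ C / ((τ + ‖y‖) / 2) ^ (N + 1) := by
        rw [mul_one]
        refine h1.trans ?_
        gcongr
        linarith
    _ = _ := by
        rw [div_pow]
        field_simp

lemma exists_abs_poissonDeriv_sub_le (N : ℕ) : ∃ A : ℝ, 0 ≤ A ∧
    ∀ (d : Fin (N + 1)) (y y' : Fin N → ℝ) (τ : ℝ), 0 < τ → ‖y - y'‖ ≤ τ →
      |poissonDeriv N d y τ - poissonDeriv N d y' τ| ≤ A * ‖y - y'‖ / (τ + ‖y‖) ^ (N + 2) := by
  obtain ⟨C, hC0, hC⟩ := isHomogeneousNeg_poisson.fderiv.fderiv.exists_norm_le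
    (g := fderiv ℝ (fderiv ℝ (poisson N))) fun p hp =>
      ((contDiffAt_poisson (m := 2) hp).fderiv_right (m := 1) (by norm_num)).continuousAt_fderiv
        one_ne_zero
  refine ⟨C * 3 ^ (N + 2), by positivity, fun d y y' τ hτ hy => ?_⟩
  have h3 : 0 < τ + ‖y‖ := by positivity
  have hseg : ∀ p ∈ segment ℝ ((y', τ) : (Fin N → ℝ) × ℝ) (y, τ), p ≠ 0 ∧
      (τ + ‖y‖) / 3 ≤ ‖p‖ := by
    rintro p hp
    obtain ⟨θ, hθ, rfl⟩ := (segment_eq_image_lineMap ℝ _ _).le hp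
    have e : AffineMap.lineMap ((y', τ) : (Fin N → ℝ) × ℝ) (y, τ) θ
        = (y' + θ • (y - y'), τ) := by
      simp [AffineMap.lineMap_apply, add_comm]
    rw [e]
    refine ⟨mk_ne_zero hτ, ?_⟩
    have h4 := add_norm_le_two_mul_norm (y := y' + θ • (y - y')) hτ
    have h6 : τ ≤ ‖((y' + θ • (y - y'), τ) : (Fin N → ℝ) × ℝ)‖ := by
      simp [Prod.norm_mk, abs_of_pos hτ]
    have h5 : ‖y‖ ≤ ‖y' + θ • (y - y')‖ + τ := by
      have : y = (y' + θ • (y - y')) + (1 - θ) • (y - y') := by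
        rw [sub_smul, one_smul]; abel
      calc ‖y‖ = ‖(y' + θ • (y - y')) + (1 - θ) • (y - y')‖ := by rw [← this]
        _ ≤ ‖y' + θ • (y - y')‖ + ‖(1 - θ) • (y - y')‖ := norm_add_le _ _
        _ ≤ _ := by
          rw [norm_smul, Real.norm_of_nonneg (by linarith [hθ.2])]
          nlinarith [hθ.1, hθ.2, norm_nonneg (y - y')]
    linarith
  have hmv := (convex_segment ((y', τ) : (Fin N → ℝ) × ℝ) (y, τ)).norm_image_sub_le_of_norm_fderiv_le
    (𝕜 := ℝ) (f := fderiv ℝ (poisson N)) (C := C / ((τ + ‖y‖) / 3) ^ (N + 2))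
    (fun p hp => ((contDiffAt_poisson (m := 2) (hseg p hp).1).fderiv_right (m := 1)
      (by norm_num)).differentiableAt one_ne_zero)
    (fun p hp => (hC p (hseg p hp).1).trans (by have := (hseg p hp).2; gcongr))
    (left_mem_segment ℝ _ _) (right_mem_segment ℝ _ _)
  have e : ((y, τ) : (Fin N → ℝ) × ℝ) - (y', τ) = (y - y', 0) := by simp
  rw [e, Prod.norm_mk, norm_zero, max_eq_left (norm_nonneg _)] at hmv
  calc |poissonDeriv N d y τ - poissonDeriv N d y' τ|
      = ‖(fderiv ℝ (poisson N) (y, τ) - fderiv ℝ (poisson N) (y', τ)) (dirVec N d)‖ := rfl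
    _ ≤ ‖fderiv ℝ (poisson N) (y, τ) - fderiv ℝ (poisson N) (y', τ)‖ * 1 :=
        ContinuousLinearMap.le_opNorm_of_le _ (norm_dirVec_le d)
    _ ≤ _ := by
        rw [mul_one]
        refine hmv.trans_eq ?_
        rw [div_pow]
        field_simp

lemma measurable_poissonDeriv (d : Fin (N + 1)) :
    Measurable (Function.uncurry (poissonDeriv N d)) :=
  measurable_fderiv_apply_const ℝ (poisson N) (dirVec N d)

lemma poissonDeriv_neg (d : Fin (N + 1)) (hd : (d : ℕ) < N) (y : Fin N → ℝ) (τ : ℝ) :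
    poissonDeriv N d (-y) τ = -poissonDeriv N d y τ := by
  let e : ((Fin N → ℝ) × ℝ) ≃L[ℝ] ((Fin N → ℝ) × ℝ) :=
    (ContinuousLinearEquiv.neg ℝ).prodCongr (ContinuousLinearEquiv.refl ℝ ℝ)
  have he : poisson N ∘ e = poisson N := by
    ext p
    simp [e, poisson, pk]
  have h1 : e (dirVec N d) = -dirVec N d := by
    simp [e, dirVec, hd]
  have h2 : e (y, τ) = (-y, τ) := by simp [e]
  unfold poissonDeriv
  conv_rhs => rw [← he, ContinuousLinearEquiv.comp_right_fderiv]
  rw [h2, ContinuousLinearMap.comp_apply]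
  simp [h1]

lemma hasDerivAt_poisson (y : Fin N → ℝ) {τ : ℝ} (hτ : 0 < τ) (d : Fin (N + 1))
    (hd : ¬ (d : ℕ) < N) :
    HasDerivAt (fun s => poisson N (y, s)) (poissonDeriv N d y τ) τ := by
  have h1 := ((contDiffAt_poisson (m := 1) (mk_ne_zero (y := y) hτ)).differentiableAt
    one_ne_zero).hasFDerivAt
  have h2 : HasDerivAt (fun s : ℝ => ((y, s) : (Fin N → ℝ) × ℝ)) (0, 1) τ :=
    (hasDerivAt_const τ y).prodMk (hasDerivAt_id τ)
  have h3 := h1.comp_hasDerivAt τ h2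
  have h4 : poissonDeriv N d y τ = fderiv ℝ (poisson N) (y, τ) (0, 1) := by
    simp [poissonDeriv, dirVec, hd]
  rw [h4]
  exact h3

lemma integral_poissonDeriv (d : Fin (N + 1)) {τ : ℝ} (hτ : 0 < τ) :
    ∫ y : Fin N → ℝ, poissonDeriv N d y τ = 0 := by
  by_cases hd : (d : ℕ) < N
  · have h := integral_neg_eq_self (fun y : Fin N → ℝ => poissonDeriv N d y τ) volume
    simp_rw [poissonDeriv_neg d hd, integral_neg] at h
    linarith
  · obtain ⟨A, hA0, hA⟩ := exists_abs_poissonDeriv_le N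
    have hτ2 : 0 < τ / 2 := half_pos hτ
    have h1 := (hasDerivAt_integral_of_dominated_loc_of_deriv_le (μ := volume) (x₀ := τ)
      (s := Set.Ioi (τ / 2)) (F := fun s (y : Fin N → ℝ) => poisson N (y, s))
      (F' := fun s y => poissonDeriv N d y s)
      (bound := fun y => A / (τ / 2) * bump N (τ / 2) ‖y‖)
      (Ioi_mem_nhds (half_lt_self hτ))
      (.of_forall fun s => (measurable_poisson.comp measurable_prodMk_right).aestronglyMeasurable)
      (integrable_poisson hτ)
      ((measurable_poissonDeriv d).comp measurable_prodMk_right).aestronglyMeasurable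
      (.of_forall fun y s hs => by
        have hs' : τ / 2 < s := hs
        refine (hA d y s (hτ2.trans hs)).trans ?_
        have : A / (τ / 2) * bump N (τ / 2) ‖y‖ = A / (τ / 2 + ‖y‖) ^ (N + 1) := by
          unfold bump
          field_simp
        rw [this]
        gcongr)
      ((integrable_bump hτ2).const_mul _)
      (.of_forall fun y s hs => hasDerivAt_poisson y (hτ2.trans hs) d hd)).2
    have h2 : (fun s => ∫ y : Fin N → ℝ, poisson N (y, s)) =ᶠ[𝓝 τ]
        fun _ => ∫ y : Fin N → ℝ, poisson N (y, 1) := by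
      filter_upwards [Ioi_mem_nhds hτ] with s hs using integral_poisson_eq hs
    exact h1.unique ((hasDerivAt_const τ _).congr_of_eventuallyEq h2)

theorem exists_isKernel_poissonDeriv (d : Fin (N + 1)) : ∃ A, IsKernel (poissonDeriv N d) A := by
  obtain ⟨A, hA0, hA⟩ := exists_abs_poissonDeriv_le N
  obtain ⟨B, hB0, hB⟩ := exists_abs_poissonDeriv_sub_le N
  refine ⟨max A B, measurable_poissonDeriv d, fun y τ hτ => (hA d y τ hτ).trans ?_,
    fun y y' τ hτ hy => (hB d y y' τ hτ hy).trans ?_, fun τ hτ => integral_poissonDeriv d hτ⟩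
  · gcongr
    exact le_max_left _ _
  · gcongr
    exact le_max_right _ _

lemma continuous_poissonDeriv (d : Fin (N + 1)) {τ : ℝ} (hτ : 0 < τ) :
    Continuous fun y => poissonDeriv N d y τ := by
  refine continuous_iff_continuousAt.2 fun y => ?_
  have h1 := (contDiffAt_poisson (m := 1) (mk_ne_zero (y := y) hτ)).continuousAt_fderiv one_ne_zero
  have h2 : ContinuousAt (fun z : Fin N → ℝ => ((z, τ) : (Fin N → ℝ) × ℝ)) y := by fun_prop
  exact (ContinuousAt.comp (f := fun z : Fin N → ℝ => ((z, τ) : (Fin N → ℝ) × ℝ)) h1 h2).clm_apply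
    continuousAt_const

end PoissonDeriv

/-! ### Differentiation under the integral sign -/

section IteratedDerivIntegral

open scoped ContDiff

lemma integral_smul_linearIsometryEquiv {α F F' : Type*} [MeasurableSpace α] {μ : Measure α}
    [NormedAddCommGroup F] [NormedSpace ℝ F]
    [NormedAddCommGroup F'] [NormedSpace ℝ F'] (e : F ≃ₗᵢ[ℝ] F') (f : α → ℝ) (g : α → F) :
    ∫ z, f z • e (g z) ∂μ = e (∫ z, f z • g z ∂μ) := by
  simp_rw [← LinearIsometryEquiv.map_smul]
  exact e.toContinuousLinearEquiv.integral_comp_comm fun z => f z • g z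

variable {V α : Type*} [NormedAddCommGroup V] [NormedSpace ℝ V] [TopologicalSpace α]
  [SecondCountableTopology α] [MeasurableSpace α] [OpensMeasurableSpace α] {μ : Measure α}

/-- Differentiation under the integral sign for `p ↦ ∫ f z G (p - ι z)`, when `G` and its derivative
are bounded on the translates, locally uniformly. -/
lemma hasFDerivAt_integral_smul_translate {F : Type*} [NormedAddCommGroup F] [NormedSpace ℝ F]
    {G : V → F} {U : Set V} {ι : α → V} {f : α → ℝ}
    (hU : IsOpen U) (hι : Continuous ι) (hUι : ∀ p ∈ U, ∀ z, p - ι z ∈ U)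
    (hG : ∀ p ∈ U, ContDiffAt ℝ 1 G p) (hf : Integrable f μ) {p : V} (hp : p ∈ U)
    {s : Set V} (hs : s ∈ 𝓝 p) {C C' : ℝ} (hC : ∀ q ∈ s, ∀ z, ‖fderiv ℝ G (q - ι z)‖ ≤ C)
    (hC' : ∀ z, ‖G (p - ι z)‖ ≤ C') :
    HasFDerivAt (fun p => ∫ z, f z • G (p - ι z) ∂μ) (∫ z, f z • fderiv ℝ G (p - ι z) ∂μ) p := by
  have hcont : ∀ p ∈ U, Continuous fun z => G (p - ι z) :=
    fun p hp => continuous_iff_continuousAt.2 fun z =>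
      ContinuousAt.comp (f := fun z => p - ι z) (hG _ (hUι p hp z)).continuousAt
        (continuous_const.sub hι).continuousAt
  refine hasFDerivAt_integral_of_dominated_of_fderiv_le (s := s ∩ U)
    (F' := fun p z => f z • fderiv ℝ G (p - ι z))
    (bound := fun z => ‖f z‖ * C) (inter_mem hs (hU.mem_nhds hp)) ?_ ?_ ?_ ?_ ?_ ?_
  · filter_upwards [hU.mem_nhds hp] with q hq
    exact hf.aestronglyMeasurable.smul (hcont q hq).aestronglyMeasurable
  · refine (hf.norm.mul_const C').mono'
      (hf.aestronglyMeasurable.smul (hcont p hp).aestronglyMeasurable) (.of_forall fun z => ?_)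
    rw [norm_smul]
    exact mul_le_mul_of_nonneg_left (hC' z) (norm_nonneg _)
  · have := secondCountableTopologyEither_of_left α (V →L[ℝ] F)
    refine hf.aestronglyMeasurable.smul (Continuous.aestronglyMeasurable ?_)
    exact continuous_iff_continuousAt.2 fun z =>
      ContinuousAt.comp (f := fun z => p - ι z)
        ((hG _ (hUι p hp z)).continuousAt_fderiv (by simp))
        (continuous_const.sub hι).continuousAt
  · refine .of_forall fun z q hq => ?_
    rw [norm_smul]
    exact mul_le_mul_of_nonneg_left (hC q hq.1 z) (norm_nonneg _)
  · exact hf.norm.mul_const C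
  · refine .of_forall fun z q hq => ?_
    have h := ((hG _ (hUι q hq.2 z)).differentiableAt (by simp)).hasFDerivAt
    exact (((hasFDerivAt_comp_sub (f := G) (ι z)).2 h)).fun_const_smul (f z)

/-- Iterated derivatives of `p ↦ ∫ f z κ (p - ι z)` can be computed under the integral sign, when
the iterated derivatives of the translates of `κ` are bounded locally uniformly. -/
lemma iteratedFDeriv_integral_translate {κ : V → ℝ} {U : Set V} {ι : α → V} {f : α → ℝ}
    (hU : IsOpen U) (hι : Continuous ι) (hUι : ∀ p ∈ U, ∀ z, p - ι z ∈ U)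
    (hκ : ∀ p ∈ U, ContDiffAt ℝ ∞ κ p) (hf : Integrable f μ)
    (hb : ∀ (m : ℕ), ∀ p ∈ U, ∃ s ∈ 𝓝 p, ∃ C : ℝ, ∀ q ∈ s, ∀ z,
      ‖iteratedFDeriv ℝ m κ (q - ι z)‖ ≤ C) (m : ℕ) :
    ∀ p ∈ U, iteratedFDeriv ℝ m (fun p => ∫ z, f z • κ (p - ι z) ∂μ) p =
      ∫ z, f z • iteratedFDeriv ℝ m κ (p - ι z) ∂μ := by
  induction m with
  | zero =>
    intro p _
    simp_rw [iteratedFDeriv_zero_eq_comp, Function.comp_apply]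
    exact (integral_smul_linearIsometryEquiv (continuousMultilinearCurryFin0 ℝ V ℝ).symm _ _).symm
  | succ m ih =>
    intro p hp
    obtain ⟨s, hs, C, hC⟩ := hb (m + 1) p hp
    obtain ⟨s', hs', C', hC'⟩ := hb m p hp
    have hder := hasFDerivAt_integral_smul_translate (μ := μ) (G := iteratedFDeriv ℝ m κ) hU hι hUι
      (fun q hq => (hκ q hq).iteratedFDeriv_right (mod_cast le_top)) hf hp hs (C := C) (C' := C')
      (fun q hq z => by rw [norm_fderiv_iteratedFDeriv]; exact hC q hq z)
      fun z => hC' p (mem_of_mem_nhds hs') z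
    have heq : iteratedFDeriv ℝ m (fun p => ∫ z, f z • κ (p - ι z) ∂μ) =ᶠ[𝓝 p]
        fun p => ∫ z, f z • iteratedFDeriv ℝ m κ (p - ι z) ∂μ := by
      filter_upwards [hU.mem_nhds hp] with q hq using ih q hq
    rw [iteratedFDeriv_succ_eq_comp_left, Function.comp_apply, heq.fderiv_eq, hder.fderiv]
    simp_rw [iteratedFDeriv_succ_eq_comp_left, Function.comp_apply]
    exact (integral_smul_linearIsometryEquiv (μ := μ) (F := V →L[ℝ] V [×m]→L[ℝ] ℝ)
      (F' := V [×(m + 1)]→L[ℝ] ℝ)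
      (continuousMultilinearCurryLeftEquiv ℝ (fun _ : Fin (m + 1) => V) ℝ).symm f
      fun z => fderiv ℝ (iteratedFDeriv ℝ m κ) (p - ι z)).symm

end IteratedDerivIntegral

section ProductPoisson

open scoped ContDiff

variable {n} {Nd}

/-- The product of the Poisson kernels. -/
def poissonProd (p : W n Nd) : ℝ := ∏ j, poisson (Nd j) (p j)

/-- The product of the upper half-spaces. -/
def upper (n : ℕ) (Nd : Fin n → ℕ) : Set (W n Nd) := {p | ∀ j, 0 < (p j).2}

lemma isOpen_upper : IsOpen (upper n Nd) := by
  have : upper n Nd = ⋂ j, {p : W n Nd | 0 < (p j).2} := by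
    ext p
    simp [upper]
  rw [this]
  exact isOpen_iInter_of_finite fun j => isOpen_lt continuous_const (by fun_prop)

lemma ne_zero_of_mem_upper {p : W n Nd} (hp : p ∈ upper n Nd) (j : Fin n) : p j ≠ 0 :=
  fun h => (hp j).ne' (congrArg Prod.snd h)

lemma contDiffAt_poisson_apply {m : WithTop ℕ∞} {p : W n Nd} (hp : p ∈ upper n Nd) (j : Fin n) :
    ContDiffAt ℝ m (fun p : W n Nd => poisson (Nd j) (p j)) p :=
  ContDiffAt.comp (g := poisson (Nd j)) p (contDiffAt_poisson (ne_zero_of_mem_upper hp j))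
    (ContinuousLinearMap.proj (R := ℝ) j : W n Nd →L[ℝ] (Fin (Nd j) → ℝ) × ℝ).contDiff.contDiffAt

lemma contDiffAt_poissonProd {m : WithTop ℕ∞} {p : W n Nd} (hp : p ∈ upper n Nd) :
    ContDiffAt ℝ m (poissonProd (n := n) (Nd := Nd)) p := by
  unfold poissonProd
  exact contDiffAt_prod fun j _ => contDiffAt_poisson_apply hp j

lemma exists_norm_iteratedFDeriv_poisson_apply_le (m : ℕ) (j : Fin n) {δ : ℝ} (hδ : 0 < δ) :
    ∃ C : ℝ, ∀ p : W n Nd, (∀ j, δ ≤ (p j).2) →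
      ‖iteratedFDerivWithin ℝ m (fun p : W n Nd => poisson (Nd j) (p j)) (upper n Nd) p‖ ≤ C := by
  obtain ⟨C, hC0, hC⟩ := exists_norm_iteratedFDeriv_poisson_le (Nd j) m
  refine ⟨C / δ ^ (Nd j + m), fun p hp => ?_⟩
  have hpU : p ∈ upper n Nd := fun j => hδ.trans_le (hp j)
  let L : W n Nd →L[ℝ] ((Fin (Nd j) → ℝ) × ℝ) := ContinuousLinearMap.proj j
  have hL : ‖L‖ ≤ 1 := ContinuousLinearMap.opNorm_le_bound _ zero_le_one fun q => by
    rw [one_mul]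
    exact norm_le_pi_norm q j
  have hs : IsOpen {q : (Fin (Nd j) → ℝ) × ℝ | 0 < q.2} := isOpen_lt continuous_const continuous_snd
  have h1 := L.iteratedFDerivWithin_comp_right (𝕜 := ℝ) (f := poisson (Nd j)) (n := m) (i := m)
    (s := {q | 0 < q.2}) (x := p)
    (fun q hq => (contDiffAt_poisson (p := q) fun h =>
      (ne_of_gt hq) (congrArg Prod.snd h)).contDiffWithinAt)
    hs.uniqueDiffOn (hs.preimage L.continuous).uniqueDiffOn
    (show L p ∈ {q : (Fin (Nd j) → ℝ) × ℝ | 0 < q.2} from hpU j) le_rfl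
  rw [iteratedFDerivWithin_of_isOpen m (hs.preimage L.continuous)
    (show p ∈ L ⁻¹' {q : (Fin (Nd j) → ℝ) × ℝ | 0 < q.2} from hpU j),
    iteratedFDerivWithin_of_isOpen m hs
      (show L p ∈ {q : (Fin (Nd j) → ℝ) × ℝ | 0 < q.2} from hpU j)] at h1
  rw [iteratedFDerivWithin_of_isOpen m isOpen_upper hpU]
  change ‖iteratedFDeriv ℝ m (poisson (Nd j) ∘ L) p‖ ≤ _
  rw [h1]
  refine (ContinuousMultilinearMap.norm_compContinuousLinearMap_le _ _).trans ?_
  have h2 : ∏ _i : Fin m, ‖L‖ ≤ 1 := Finset.prod_le_one (fun _ _ => norm_nonneg _) fun _ _ => hL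
  have h3 : δ ≤ ‖p j‖ := (hp j).trans ((le_abs_self _).trans (norm_snd_le (p j)))
  calc ‖iteratedFDeriv ℝ m (poisson (Nd j)) (L p)‖ * ∏ _i : Fin m, ‖L‖
      ≤ ‖iteratedFDeriv ℝ m (poisson (Nd j)) (p j)‖ * 1 :=
        mul_le_mul_of_nonneg_left h2 (norm_nonneg _)
    _ ≤ C / ‖p j‖ ^ (Nd j + m) := by
        rw [mul_one]
        exact hC _ (ne_zero_of_mem_upper hpU j)
    _ ≤ _ := by gcongr

lemma exists_norm_iteratedFDeriv_poissonProd_le (m : ℕ) {δ : ℝ} (hδ : 0 < δ) :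
    ∃ C : ℝ, ∀ p : W n Nd, (∀ j, δ ≤ (p j).2) →
      ‖iteratedFDeriv ℝ m (poissonProd (n := n) (Nd := Nd)) p‖ ≤ C := by
  choose C hC using fun (m : ℕ) (j : Fin n) =>
    exists_norm_iteratedFDeriv_poisson_apply_le (Nd := Nd) m j hδ
  refine ⟨∑ q ∈ (Finset.univ : Finset (Fin n)).sym m,
    ((q : Sym (Fin n) m) : Multiset (Fin n)).countPerms *
      ∏ j, C (Multiset.count j ((q : Sym (Fin n) m) : Multiset (Fin n))) j, fun p hp => ?_⟩
  have hpU : p ∈ upper n Nd := fun j => hδ.trans_le (hp j)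
  rw [← iteratedFDerivWithin_of_isOpen m isOpen_upper hpU]
  refine (norm_iteratedFDerivWithin_prod_le (𝕜 := ℝ) (u := Finset.univ) (N := m)
    (f := fun j (p : W n Nd) => poisson (Nd j) (p j))
    (fun j _ q hq => (contDiffAt_poisson_apply hq j).contDiffWithinAt)
    isOpen_upper.uniqueDiffOn hpU le_rfl).trans ?_
  gcongr with q _ j _
  exact hC _ j p hp

/-- The product of the Poisson kernels, differentiated once in the variables in `S`. -/
def poissonProdDeriv (d : Π j : Fin n, Fin (Nd j + 1)) (S : Finset (Fin n)) (p : W n Nd) : ℝ :=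
  ∏ j, if j ∈ S then poissonDeriv (Nd j) (d j) (p j).1 (p j).2 else poisson (Nd j) (p j)

end ProductPoisson

section MixedDerivative

open scoped ContDiff

variable {n} {Nd}

lemma hasLineDerivAt_poissonProdDeriv {d : Π j : Fin n, Fin (Nd j + 1)} {S : Finset (Fin n)}
    {j : Fin n} (hj : j ∉ S) {p : W n Nd} (hp : p ∈ upper n Nd) :
    HasLineDerivAt ℝ (poissonProdDeriv d S) (poissonProdDeriv d (insert j S) p) p
      (dirW n Nd j (d j)) := by
  have h1 : HasLineDerivAt ℝ (poisson (Nd j)) (poissonDeriv (Nd j) (d j) (p j).1 (p j).2) (p j)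
      (dirVec (Nd j) (d j)) :=
    ((contDiffAt_poisson (m := 1) (ne_zero_of_mem_upper hp j)).differentiableAt
      (by simp)).hasFDerivAt.hasLineDerivAt _
  unfold HasLineDerivAt at h1 ⊢
  have h2 := h1.mul_const (∏ i ∈ Finset.univ.erase j,
    if i ∈ S then poissonDeriv (Nd i) (d i) (p i).1 (p i).2 else poisson (Nd i) (p i))
  have h3 : ∀ t : ℝ, poissonProdDeriv d S (p + t • dirW n Nd j (d j)) =
      poisson (Nd j) (p j + t • dirVec (Nd j) (d j)) * ∏ i ∈ Finset.univ.erase j,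
        if i ∈ S then poissonDeriv (Nd i) (d i) (p i).1 (p i).2 else poisson (Nd i) (p i) := by
    intro t
    rw [poissonProdDeriv, ← Finset.mul_prod_erase _ _ (Finset.mem_univ j), if_neg hj]
    congr 1
    · simp [dirW, dirVec]
    · refine Finset.prod_congr rfl fun i hi => ?_
      have : (p + t • dirW n Nd j (d j)) i = p i := by
        simp [dirW, Finset.ne_of_mem_erase hi]
      rw [this]
  have h4 : poissonProdDeriv d (insert j S) p =
      poissonDeriv (Nd j) (d j) (p j).1 (p j).2 * ∏ i ∈ Finset.univ.erase j,
        if i ∈ S then poissonDeriv (Nd i) (d i) (p i).1 (p i).2 else poisson (Nd i) (p i) := by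
    rw [poissonProdDeriv, ← Finset.mul_prod_erase _ _ (Finset.mem_univ j),
      if_pos (Finset.mem_insert_self _ _)]
    congr 1
    refine Finset.prod_congr rfl fun i hi => ?_
    simp [Finset.mem_insert, Finset.ne_of_mem_erase hi]
  simp_rw [h3, h4]
  exact h2

lemma iteratedFDeriv_poissonProd (d : Π j : Fin n, Fin (Nd j + 1)) {m : ℕ} (σ : Fin m → Fin n)
    (hσ : Function.Injective σ) {p : W n Nd} (hp : p ∈ upper n Nd) :
    iteratedFDeriv ℝ m (poissonProd (n := n) (Nd := Nd)) p
      (fun i => dirW n Nd (σ i) (d (σ i))) = poissonProdDeriv d (Finset.univ.image σ) p := by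
  induction m generalizing p with
  | zero => simp [poissonProdDeriv, poissonProd]
  | succ m ih =>
    have hdiff : DifferentiableAt ℝ (iteratedFDeriv ℝ m (poissonProd (n := n) (Nd := Nd))) p :=
      ((contDiffAt_poissonProd (m := ∞) hp).iteratedFDeriv_right (m := 1)
        (mod_cast le_top)).differentiableAt (by simp)
    have heq : (fun q => iteratedFDeriv ℝ m (poissonProd (n := n) (Nd := Nd)) q
        (fun i => dirW n Nd (σ i.succ) (d (σ i.succ)))) =ᶠ[𝓝 p]
          poissonProdDeriv d (Finset.univ.image fun i : Fin m => σ i.succ) := by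
      filter_upwards [isOpen_upper.mem_nhds hp] with q hq using
        ih (fun i => σ i.succ) (hσ.comp (Fin.succ_injective m)) hq
    have hd' : DifferentiableAt ℝ
        (poissonProdDeriv d (Finset.univ.image fun i : Fin m => σ i.succ)) p :=
      heq.differentiableAt_iff.1 (hdiff.continuousMultilinear_apply_const _)
    rw [hdiff.iteratedFDeriv_succ_apply_left']
    change fderiv ℝ (fun q => iteratedFDeriv ℝ m (poissonProd (n := n) (Nd := Nd)) q
        (fun i => dirW n Nd (σ i.succ) (d (σ i.succ)))) p (dirW n Nd (σ 0) (d (σ 0))) = _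
    rw [heq.fderiv_eq, ← hd'.lineDeriv_eq_fderiv, (hasLineDerivAt_poissonProdDeriv ?_ hp).lineDeriv]
    · congr 1
      ext j
      simp [Fin.exists_fin_succ, eq_comm]
    · simp only [Finset.mem_image, Finset.mem_univ, true_and, not_exists]
      exact fun i hi => (Fin.succ_ne_zero i) (hσ hi)

lemma prodPoisson_eq (f : X n Nd → ℝ) :
    prodPoisson n Nd f = fun p => ∫ z, f z • poissonProd fun j => p j - (z j, 0) := by
  funext p
  simp [prodPoisson, poissonProd, poisson]

/-- The mixed derivatives of the Poisson extension of `f`. -/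
lemma iteratedFDeriv_prodPoisson {f : X n Nd → ℝ} (hf : Integrable f)
    (d : Π j : Fin n, Fin (Nd j + 1)) {p : W n Nd} (hp : p ∈ upper n Nd) :
    iteratedFDeriv ℝ n (prodPoisson n Nd f) p (fun j => dirW n Nd j (d j)) =
      ∫ z, f z * ∏ j, translateKernel (poissonDeriv (Nd j) (d j)) (p j) (z j) := by
  have hι : Continuous fun (z : X n Nd) (j : Fin n) => ((z j, 0) : (Fin (Nd j) → ℝ) × ℝ) := by
    fun_prop
  have hU : ∀ q ∈ upper n Nd, ∀ z : X n Nd,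
      q - (fun j => ((z j, 0) : (Fin (Nd j) → ℝ) × ℝ)) ∈ upper n Nd :=
    fun q hq z j => by simpa using hq j
  have hb : ∀ m : ℕ, ∀ q ∈ upper n Nd, ∃ s ∈ 𝓝 q, ∃ C : ℝ, ∀ q' ∈ s, ∀ z : X n Nd,
      ‖iteratedFDeriv ℝ m (poissonProd (n := n) (Nd := Nd))
        (q' - fun j => ((z j, 0) : (Fin (Nd j) → ℝ) × ℝ))‖ ≤ C := by
    intro m q hq
    obtain ⟨δ, hδ, hδq⟩ : ∃ δ : ℝ, 0 < δ ∧ ∀ j, δ < (q j).2 := by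
      have : ∀ᶠ δ : ℝ in 𝓝[>] 0, 0 < δ ∧ ∀ j, δ < (q j).2 :=
        (eventually_mem_nhdsWithin).and <| eventually_all.2 fun j =>
          nhdsWithin_le_nhds (eventually_lt_nhds (hq j))
      exact this.exists
    obtain ⟨C, hC⟩ := exists_norm_iteratedFDeriv_poissonProd_le (n := n) (Nd := Nd) m hδ
    refine ⟨{q' | ∀ j, δ < (q' j).2}, ?_, C, fun q' hq' z => hC _ fun j => ?_⟩
    · exact eventually_all.2 fun j =>
        (((continuous_apply j).snd).continuousAt (x := q)).eventually (lt_mem_nhds (hδq j))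
    · simpa using (hq' j).le
  have hcont : Continuous fun z : X n Nd => iteratedFDeriv ℝ n (poissonProd (n := n) (Nd := Nd))
      (p - fun j => ((z j, 0) : (Fin (Nd j) → ℝ) × ℝ)) :=
    continuous_iff_continuousAt.2 fun z =>
      ContinuousAt.comp (f := fun z : X n Nd => p - fun j => ((z j, 0) : (Fin (Nd j) → ℝ) × ℝ))
        ((contDiffAt_poissonProd (m := ∞) (hU p hp z)).iteratedFDeriv_right (m := 0) (i := n)
          (mod_cast le_top)).continuousAt
        (continuous_const.sub hι).continuousAt
  rw [prodPoisson_eq]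
  have h1 := iteratedFDeriv_integral_translate (μ := volume) isOpen_upper hι hU
    (fun q hq => contDiffAt_poissonProd hq) hf hb n p hp
  have hint : Integrable fun z : X n Nd => f z •
      iteratedFDeriv ℝ n (poissonProd (n := n) (Nd := Nd))
        (p - fun j => ((z j, 0) : (Fin (Nd j) → ℝ) × ℝ)) := by
    obtain ⟨s, hs, C, hC⟩ := hb n p hp
    refine (hf.norm.mul_const C).mono'
      (hf.aestronglyMeasurable.smul hcont.aestronglyMeasurable) (.of_forall fun z => ?_)
    rw [norm_smul]
    exact mul_le_mul_of_nonneg_left (hC p (mem_of_mem_nhds hs) z) (norm_nonneg _)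
  have h2 := (ContinuousMultilinearMap.apply ℝ (fun _ : Fin n => W n Nd) ℝ
    (fun j => dirW n Nd j (d j))).integral_comp_comm hint
  refine (congrArg (fun M => M fun j => dirW n Nd j (d j)) h1).trans (h2.symm.trans ?_)
  refine integral_congr_ae (.of_forall fun z => ?_)
  change f z * iteratedFDeriv ℝ n (poissonProd (n := n) (Nd := Nd)) _
    (fun j => dirW n Nd j (d j)) = _
  rw [iteratedFDeriv_poissonProd d (fun j => j) Function.injective_id (hU p hp z)]
  simp [poissonProdDeriv, translateKernel]

end MixedDerivative

section Assembly

variable {n} {Nd}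

lemma ravg_congr {t : Π j : Fin n, Fin (Nd j) → ℝ} {k : Fin n → ℤ} {z z' : X n Nd}
    (h : ∀ j, z' j ∈ dcube (t j) (k j) (z j)) (f : X n Nd → ℝ) :
    ravg n Nd (fun j _ => t j) k f z = ravg n Nd (fun j _ => t j) k f z' := by
  simp only [ravg, fun j => dcube_eq_of_mem (h j)]

lemma rmdiff_congr {t : Π j : Fin n, Fin (Nd j) → ℝ} {k : Fin n → ℤ} {z z' : X n Nd}
    (h : ∀ j, z' j ∈ dcube (t j) (k j - 1) (z j)) (f : X n Nd → ℝ) :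
    rmdiff n Nd (fun j _ => t j) k f z = rmdiff n Nd (fun j _ => t j) k f z' := by
  refine Finset.sum_congr rfl fun ε _ => ?_
  rw [ravg_congr (fun j => dcube_mono (t j) _ (z j) (h j)) f]
  intro j
  split_ifs <;> lia

lemma measurable_ravg (t : Π j : Fin n, Fin (Nd j) → ℝ) (k : Fin n → ℤ) (f : X n Nd → ℝ) :
    Measurable (ravg n Nd (fun j _ => t j) k f) := by
  let G : (Π j : Fin n, Fin (Nd j) → ℤ) → ℝ := fun a =>
    (∫ y in {y : X n Nd | ∀ j i, ⌊(y j i - t j i) / (2 : ℝ) ^ k j⌋ = a j i}, f y) /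
      ∏ j, ((2 : ℝ) ^ (k j)) ^ (Nd j : ℕ)
  have hG : ravg n Nd (fun j _ => t j) k f =
      G ∘ fun x j i => ⌊(x j i - t j i) / (2 : ℝ) ^ k j⌋ := by
    funext x
    have : (Set.univ.pi fun j => dcube (t j) (k j) (x j)) =
        {y : X n Nd | ∀ j i, ⌊(y j i - t j i) / (2 : ℝ) ^ k j⌋ =
          ⌊(x j i - t j i) / (2 : ℝ) ^ k j⌋} := by
      ext y
      simp [dcube]
    simp only [ravg, this, G, Function.comp_apply]
  rw [hG]
  refine (measurable_of_countable G).comp ?_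
  refine measurable_pi_lambda _ fun j => measurable_pi_lambda _ fun i => Int.measurable_floor.comp ?_
  fun_prop

lemma measurable_rmdiff (t : Π j : Fin n, Fin (Nd j) → ℝ) (k : Fin n → ℤ) (f : X n Nd → ℝ) :
    Measurable (rmdiff n Nd (fun j _ => t j) k f) :=
  Finset.measurable_fun_sum _ fun _ _ => (measurable_ravg t _ f).const_mul _

/-- The square of the majorant of the mixed derivatives in the directions `d` of the Poisson
extension of `f`, in terms of the martingale differences of `f`. -/
def majorant (d : Π j : Fin n, Fin (Nd j + 1)) (t : Π j : Fin n, Fin (Nd j) → ℝ) (f : X n Nd → ℝ)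
    (p : W n Nd) : ℝ≥0∞ :=
  (∑' k : Fin n → ℤ, ∫⁻ z, (∏ j, IsKernel.mdiffKernel (poissonDeriv (Nd j) (d j)) (t j) (k j)
    (p j) (z j)) * ENNReal.ofReal |rmdiff n Nd (fun j _ => t j) k f z|) ^ 2

lemma measurable_majorant (d : Π j : Fin n, Fin (Nd j + 1)) (t : Π j : Fin n, Fin (Nd j) → ℝ)
    (f : X n Nd → ℝ) : Measurable (majorant d t f) := by
  refine Measurable.pow_const (Measurable.tsum fun k => ?_) 2
  refine Measurable.lintegral_prod_right' (f := fun q : W n Nd × X n Nd =>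
    (∏ j, IsKernel.mdiffKernel (poissonDeriv (Nd j) (d j)) (t j) (k j) (q.1 j) (q.2 j)) *
      ENNReal.ofReal |rmdiff n Nd (fun j _ => t j) k f q.2|) ?_
  refine (Finset.measurable_fun_prod _ fun j _ => ?_).mul ?_
  · obtain ⟨A, hA⟩ := exists_isKernel_poissonDeriv (N := Nd j) (d j)
    have hj : Measurable fun q : W n Nd × X n Nd => (q.1 j, q.2 j) := by fun_prop
    have h2 := (hA.measurable_mdiffKernel (t j) (k j)).comp hj
    exact h2
  · exact ((measurable_norm.comp (measurable_rmdiff t k f)).comp measurable_snd).ennreal_ofReal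

lemma ofReal_sq_mixedDeriv_le (hNd : ∀ j, 0 < Nd j) (d : Π j : Fin n, Fin (Nd j + 1))
    (t : Π j : Fin n, Fin (Nd j) → ℝ) {f : X n Nd → ℝ} (hf : Integrable f) {p : W n Nd}
    (hp : p ∈ upper n Nd) :
    ENNReal.ofReal ((iteratedFDeriv ℝ n (prodPoisson n Nd f) p fun j => dirW n Nd j (d j)) ^ 2) ≤
      majorant d t f p := by
  rw [iteratedFDeriv_prodPoisson hf d hp, ← sq_abs, ENNReal.ofReal_pow (abs_nonneg _)]
  choose A hA using fun j => exists_isKernel_poissonDeriv (N := Nd j) (d j)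
  refine pow_le_pow_left' (ofReal_abs_integral_mul_prod_le hNd t hf (fun j => ?_) (fun j => ?_)
    fun j => (hA j).abs_translate_le (hp j)) 2
  · exact (continuous_poissonDeriv (d j) (hp j)).comp (continuous_const.sub continuous_id)
  · exact ((hA j).integrable_slice (hp j)).comp_sub_left (p j).1

lemma coneWeight_of_lt {N : ℕ} {x : Fin N → ℝ} {p : (Fin N → ℝ) × ℝ}
    (h : √(∑ i, (p.1 i - x i) ^ 2) < p.2) :
    coneWeight N x p = ENNReal.ofReal (p.2 ^ (1 - (N : ℝ))) :=
  Set.indicator_of_mem (s := {q : (Fin N → ℝ) × ((Fin N → ℝ) × ℝ) |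
    √(∑ i, (q.2.1 i - q.1 i) ^ 2) < q.2.2}) h _

lemma lusinSq_le (hNd : ∀ j, 0 < Nd j) (t : Π j : Fin n, Fin (Nd j) → ℝ) {f : X n Nd → ℝ}
    (hf : Integrable f) (x : X n Nd) :
    lusinSq n Nd f x ≤ ∑ d : Π j : Fin n, Fin (Nd j + 1),
      ∫⁻ p : W n Nd, (∏ j, coneWeight (Nd j) (x j) (p j)) * majorant d t f p := by
  have hm : ∀ d, Measurable fun p : W n Nd =>
      (∏ j, coneWeight (Nd j) (x j) (p j)) * majorant d t f p := fun d =>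
    (Finset.measurable_fun_prod _ fun j _ =>
      measurable_coneWeight.of_uncurry_left.comp (measurable_pi_apply j)).mul
        (measurable_majorant d t f)
  rw [← lintegral_finsetSum _ fun d _ => hm d]
  refine (lintegral_mono_ae ?_).trans (setLIntegral_le_lintegral (prodCone n Nd x) _)
  have hmeas : MeasurableSet (prodCone n Nd x) := by
    have : prodCone n Nd x = ⋂ j, {p : W n Nd | √(∑ i, ((p j).1 i - x j i) ^ 2) < (p j).2} := by
      ext p
      simp [prodCone]
    rw [this]
    exact .iInter fun j => (isOpen_lt (by fun_prop) (by fun_prop)).measurableSet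
  filter_upwards [ae_restrict_mem hmeas] with p hp
  have hpU : p ∈ upper n Nd := fun j => (Real.sqrt_nonneg _).trans_lt (hp j)
  have hw : ∏ j, coneWeight (Nd j) (x j) (p j) =
      ENNReal.ofReal (∏ j, (p j).2 ^ (1 - (Nd j : ℝ))) := by
    rw [ENNReal.ofReal_prod_of_nonneg fun j _ => Real.rpow_nonneg (hpU j).le _]
    exact Finset.prod_congr rfl fun j _ => coneWeight_of_lt (hp j)
  rw [mixedGradSq, ENNReal.ofReal_mul (Finset.sum_nonneg fun d _ => sq_nonneg _), ← hw,
    ENNReal.ofReal_sum_of_nonneg fun d _ => sq_nonneg _, mul_comm, Finset.mul_sum]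
  exact Finset.sum_le_sum fun d _ => mul_le_mul_right (ofReal_sq_mixedDeriv_le hNd d t hf hpU) _

lemma measurable_lintegral_majorant (d : Π j : Fin n, Fin (Nd j + 1))
    (t : Π j : Fin n, Fin (Nd j) → ℝ) (f : X n Nd → ℝ) :
    Measurable fun x : X n Nd => (∫⁻ p : W n Nd,
      (∏ j, coneWeight (Nd j) (x j) (p j)) * majorant d t f p) ^ (1 / 2 : ℝ) := by
  refine Measurable.pow_const (Measurable.lintegral_prod_right'
    (f := fun q : X n Nd × W n Nd =>
      (∏ j, coneWeight (Nd j) (q.1 j) (q.2 j)) * majorant d t f q.2) ?_) _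
  refine (Finset.measurable_fun_prod _ fun j _ => ?_).mul
    ((measurable_majorant d t f).comp measurable_snd)
  have hj : Measurable fun q : X n Nd × W n Nd => (q.1 j, q.2 j) := by fun_prop
  have h2 := (measurable_coneWeight (N := Nd j)).comp hj
  exact h2

lemma sqrt_sum_le {ι : Type*} (s : Finset ι) (a : ι → ℝ≥0∞) :
    (∑ i ∈ s, a i) ^ (1 / 2 : ℝ) ≤ ∑ i ∈ s, a i ^ (1 / 2 : ℝ) := by
  classical
  induction s using Finset.induction_on with
  | empty => simp
  | insert d s hd ih =>
    rw [Finset.sum_insert hd, Finset.sum_insert hd]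
    exact (ENNReal.rpow_add_le_add_rpow _ _ (by norm_num) (by norm_num)).trans (by gcongr)

lemma exists_lintegral_sqrt_majorant_le (hNd : ∀ j, 0 < Nd j) (d : Π j : Fin n, Fin (Nd j + 1)) :
    ∃ K : ℝ≥0∞, K ≠ ∞ ∧ ∀ (t : Π j : Fin n, Fin (Nd j) → ℝ) (f : X n Nd → ℝ),
      ∫⁻ x : X n Nd, (∫⁻ p : W n Nd, (∏ j, coneWeight (Nd j) (x j) (p j)) *
        majorant d t f p) ^ (1 / 2 : ℝ) ≤
      K * ∫⁻ x, (rSsq n Nd (fun j _ => t j) f x) ^ (1 / 2 : ℝ) := by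
  choose A hA using fun j => exists_isKernel_poissonDeriv (N := Nd j) (d j)
  choose K hK h using fun j => (hA j).exists_isSquareBounded (hNd j)
  refine ⟨∏ j, K j, ENNReal.prod_ne_top fun j _ => hK j, fun t f => ?_⟩
  have hpi := IsSquareBounded.pi (fun j => h j (t j)) (fun _ => measurable_coneWeight)
    (fun j k => (hA j).measurable_mdiffKernel (t j) k) (fun _ _ _ _ => rfl)
    (Measure.dirac ()) (g := fun k z _ => ENNReal.ofReal |rmdiff n Nd (fun j _ => t j) k f z|)
    (fun k => ((measurable_norm.comp (measurable_rmdiff t k f)).comp measurable_fst).ennreal_ofReal)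
    fun k z z' hz => by rw [rmdiff_congr hz f]
  simp only [lintegral_dirac, ← volume_pi] at hpi
  refine hpi.trans_eq ?_
  simp only [rSsq]
  congr! 6 with z k
  rw [← ENNReal.ofReal_pow (abs_nonneg _), sq_abs]

end Assembly

/-- **Multi-parameter inclusion `H¹_𝒟 ⊂ H¹`**: for every product dyadic lattice
`𝒟 = 𝒟₁ × ⋯ × 𝒟ₙ` (with `𝒟_j = t_j + 𝒟₀`) on `X = X₁ × ⋯ × Xₙ`,
`‖f‖_{H¹(X)} ≤ C ∫_X S_𝒟 f (x) dx` with `C` depending only on `N₁, …, Nₙ`. -/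
theorem product_dyadic_H1_subset_H1 (n : ℕ) (hn : 0 < n) (Nd : Fin n → ℕ)
    (hNd : ∀ j, 0 < Nd j) :
    ∃ C : ℝ, 0 < C ∧
      ∀ (t : Π j : Fin n, Fin (Nd j) → ℝ) (f : X n Nd → ℝ), Integrable f volume →
        H1prodNorm n Nd f ≤
          ENNReal.ofReal C * ∫⁻ x, (rSsq n Nd (fun j _ => t j) f x) ^ (1 / 2 : ℝ) := by
  choose K hK h using exists_lintegral_sqrt_majorant_le hNd
  have hKs : ∑ d, K d ≠ ∞ := ENNReal.sum_ne_top.2 fun d _ => hK d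
  refine ⟨(∑ d, K d).toReal + 1, by positivity, fun t f hf => ?_⟩
  have e1 : H1prodNorm n Nd f ≤ ∫⁻ x : X n Nd, ∑ d : Π j : Fin n, Fin (Nd j + 1), (∫⁻ p : W n Nd,
      (∏ j, coneWeight (Nd j) (x j) (p j)) * majorant d t f p) ^ (1 / 2 : ℝ) :=
    lintegral_mono fun x => (ENNReal.rpow_le_rpow (lusinSq_le hNd t hf x)
      (by norm_num)).trans (sqrt_sum_le _ _)
  rw [lintegral_finsetSum _ fun d _ => measurable_lintegral_majorant d t f] at e1
  refine e1.trans ((Finset.sum_le_sum fun d _ => h d t f).trans ?_)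
  rw [← Finset.sum_mul]
  refine mul_le_mul_left ?_ _
  rw [← ENNReal.ofReal_toReal hKs]
  exact ENNReal.ofReal_le_ofReal (by simp)

end Treil
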